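/- For every real ε > 0 there exists a natural number n₀ such that the following holds. Let X be a finite set with n := |X| ≥ n₀, let G ≤ Sym(X) be primitive with G ≠ Alt(X), and let k be a natural number with (n : ℝ)^(1/2 + ε) ≤ k and 2·k ≤ n. Then there exists a nonempty family ℬ of k-element subsets of X such that Aut(X,ℬ) = G and G acts transitively on ℬ, i.e., for all B₁, B₂ ∈ ℬ there is g ∈ G with g(B₁) = B₂. -/

import Mathlib

open MulAction

/-- A subgroup `G ≤ Sym(X)` is primitive if its natural action on `X` is transitive
and every `G`-block is trivial (i.e. the action is preprimitive). -/
def IsPrimitiveSubgroup {X : Type*} (G : Subgroup (Equiv.Perm X)) : Prop :=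
  MulAction.IsPretransitive G X ∧ ∀ B : Set X, MulAction.IsBlock G B → MulAction.IsTrivialBlock B

/-- A greedy hitting set: a family of large subsets has a small transversal. -/
theorem exists_small_hitting_set {α ι : Type*} [Fintype α] [DecidableEq α] [Fintype ι]
    (F : ι → Finset α) (c : ℝ) (hc : 0 < c) (hF : ∀ i, c ≤ (F i).card) :
    ∃ S : Finset α, (∀ i, ∃ a ∈ S, a ∈ F i) ∧
      (S.card : ℝ) ≤ Fintype.card α / c * Real.log (Fintype.card ι) + 1 := by
  classical
  rcases isEmpty_or_nonempty ι with hι | ⟨⟨i₀⟩⟩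
  · exact ⟨∅, fun i => (hι.false i).elim, by simp⟩
  have hN : (0 : ℝ) < Fintype.card α := by
    have h1 : (F i₀).card ≤ Fintype.card α := Finset.card_le_univ _
    have h2 : ((F i₀).card : ℝ) ≤ Fintype.card α := by exact_mod_cast h1
    linarith [hF i₀]
  set N : ℝ := (Fintype.card α : ℝ) with hNdef
  have hstep : ∀ U : Finset ι, ∃ a : α,
      c / N * U.card ≤ ((U.filter fun i => a ∈ F i).card : ℝ) := by
    intro U
    by_contra! hcon
    have hα : Nonempty α := by
      rw [← Fintype.card_pos_iff, ← Nat.cast_pos (α := ℝ)]; exact hN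
    have h1 : ∑ a : α, ((U.filter fun i => a ∈ F i).card : ℝ) = ∑ i ∈ U, ((F i).card : ℝ) := by
      have := Finset.sum_card_bipartiteAbove_eq_sum_card_bipartiteBelow
        (s := (Finset.univ : Finset α)) (t := U) (fun a i => a ∈ F i)
      simp only [Finset.bipartiteAbove, Finset.bipartiteBelow] at this
      have h3 : ∀ i, (Finset.univ.filter fun a => a ∈ F i) = F i := by intro i; ext; simp
      simp only [h3] at this
      exact_mod_cast this
    have h2 : ∑ a : α, ((U.filter fun i => a ∈ F i).card : ℝ) < ∑ a : α, c / N * U.card :=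
      Finset.sum_lt_sum_of_nonempty Finset.univ_nonempty fun a _ => hcon a
    have h3 : c * U.card ≤ ∑ i ∈ U, ((F i).card : ℝ) := by
      have := Finset.card_nsmul_le_sum U (fun i => ((F i).card : ℝ)) c fun i _ => hF i
      simpa [mul_comm] using this
    rw [h1] at h2
    simp only [Finset.sum_const, Finset.card_univ, nsmul_eq_mul] at h2
    rw [← hNdef] at h2
    have : N * (c / N * U.card) = c * U.card := by field_simp
    linarith
  have hind : ∀ j : ℕ, ∃ S : Finset α, S.card ≤ j ∧
      ((Finset.univ.filter fun i => ∀ a ∈ S, a ∉ F i).card : ℝ) ≤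
        Fintype.card ι * (Real.exp (-(c / N))) ^ j := by
    intro j
    induction j with
    | zero => exact ⟨∅, by simp, by simp⟩
    | succ j ih =>
      obtain ⟨S, hS, hU⟩ := ih
      set U := Finset.univ.filter fun i => ∀ a ∈ S, a ∉ F i with hUdef
      obtain ⟨a, ha⟩ := hstep U
      refine ⟨insert a S, (Finset.card_insert_le _ _).trans (by omega), ?_⟩
      have h1 : (Finset.univ.filter fun i => ∀ b ∈ insert a S, b ∉ F i) =
          U.filter fun i => ¬ a ∈ F i := by
        ext i; simp [hUdef, and_comm]
      have h2 := Finset.card_filter_add_card_filter_not (s := U) (fun i => a ∈ F i)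
      have h3 : ((U.filter fun i => a ∈ F i).card : ℝ) + (U.filter fun i => ¬ a ∈ F i).card
          = U.card := by exact_mod_cast h2
      rw [h1, pow_succ]
      have h4 := Real.add_one_le_exp (-(c / N))
      have h5 : (0 : ℝ) ≤ U.card := by positivity
      calc ((U.filter fun i => ¬ a ∈ F i).card : ℝ) ≤ U.card * (1 - c / N) := by linarith
        _ ≤ U.card * Real.exp (-(c / N)) := by gcongr; linarith
        _ ≤ (Fintype.card ι * (Real.exp (-(c / N))) ^ j) * Real.exp (-(c / N)) := by gcongr
        _ = _ := by ring
  set x := N / c * Real.log (Fintype.card ι) with hx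
  have hx0 : 0 ≤ x := by
    have : (1 : ℝ) ≤ Fintype.card ι := by
      exact_mod_cast Fintype.card_pos_iff.mpr ⟨i₀⟩
    have := Real.log_nonneg this
    positivity
  obtain ⟨S, hS, hU⟩ := hind (⌊x⌋₊ + 1)
  refine ⟨S, ?_, ?_⟩
  · by_contra! hcon
    obtain ⟨i, hi⟩ := hcon
    have h1 : 1 ≤ (Finset.univ.filter fun i => ∀ a ∈ S, a ∉ F i).card :=
      Finset.card_pos.mpr ⟨i, by simpa using hi⟩
    have h1' : (1 : ℝ) ≤ (Finset.univ.filter fun i => ∀ a ∈ S, a ∉ F i).card := by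
      exact_mod_cast h1
    have hιpos : (0 : ℝ) < Fintype.card ι := by exact_mod_cast Fintype.card_pos_iff.mpr ⟨i₀⟩
    have h2 := Nat.lt_floor_add_one x
    have h3 : Fintype.card ι * (Real.exp (-(c / N))) ^ (⌊x⌋₊ + 1) < 1 := by
      rw [← Real.exp_nat_mul, ← Real.exp_log hιpos, ← Real.exp_add, Real.exp_lt_one_iff]
      push_cast
      have : c / N * x < c / N * (⌊x⌋₊ + 1) := by gcongr
      have h6 : c / N * x = Real.log (Fintype.card ι) := by rw [hx]; field_simp
      linarith
    linarith
  · have h1 : (S.card : ℝ) ≤ ((⌊x⌋₊ + 1 : ℕ) : ℝ) := by exact_mod_cast hS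
    have h2 := Nat.floor_le hx0
    push_cast at h1
    linarith

open scoped Pointwise in
theorem exists_disjoint_smul_finset {X : Type*} [Fintype X] [DecidableEq X]
    (σ : Equiv.Perm X) :
    ∃ E : Finset X, Disjoint E (σ • E) ∧ σ.support.card ≤ 3 * E.card := by
  classical
  obtain ⟨E, hE, hmax⟩ :=
    (Finset.univ.filter fun E : Finset X => Disjoint E (σ • E)).exists_max_image Finset.card ⟨∅, by simp⟩
  simp only [Finset.mem_filter, Finset.mem_univ, true_and] at hE hmax
  refine ⟨E, hE, ?_⟩
  have hsub : σ.support ⊆ E ∪ (σ • E ∪ σ⁻¹ • E) := by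
    intro x hx
    rw [Equiv.Perm.mem_support] at hx
    by_contra hcon
    simp only [Finset.mem_union, not_or] at hcon
    obtain ⟨h1, h2, h3⟩ := hcon
    have h3' : σ x ∉ E := by rwa [← Equiv.Perm.smul_def, ← Finset.mem_inv_smul_finset_iff]
    have := hmax (insert x E) (by
      rw [Finset.smul_finset_insert, Finset.disjoint_insert_left, Finset.disjoint_insert_right,
        Finset.mem_insert]
      exact ⟨by rintro (h | h); exacts [hx h.symm, h2 h], h3', hE⟩)
    rw [Finset.card_insert_of_notMem h1] at this
    omega
  have := (Finset.card_le_card hsub).trans (Finset.card_union_le _ _)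
  have h2 := Finset.card_union_le (σ • E) (σ⁻¹ • E)
  rw [Finset.card_smul_finset, Finset.card_smul_finset] at h2
  omega

theorem binomial_term_le {n k : ℕ} (hk : k ≤ n) (j : ℕ) (hj : j ≤ n) :
    n.choose j * (k ^ j * (n - k) ^ (n - j)) ≤ n.choose k * (k ^ k * (n - k) ^ (n - k)) := by
  have hstep : ∀ j < n, n.choose (j + 1) * (j + 1) = n.choose j * (n - j) := fun j _ =>
    Nat.choose_succ_right_eq n j
  rcases le_total j k with hjk | hjk
  · induction hjk using Nat.decreasingInduction with
    | self => exact le_rfl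
    | of_succ j hjk ih =>
      refine le_trans ?_ (ih (by omega))
      have h1 := hstep j (by omega)
      have e : n - j = (n - (j + 1)) + 1 := by omega
      have h3 : (j + 1) * (n - k) ≤ (n - j) * k := by
        rw [mul_comm (n - j)]; exact Nat.mul_le_mul (by omega) (by omega)
      refine Nat.le_of_mul_le_mul_right (c := j + 1) ?_ (by omega)
      calc n.choose j * (k ^ j * (n - k) ^ (n - j)) * (j + 1)
          = n.choose j * (k ^ j * (n - k) ^ (n - (j + 1))) * ((j + 1) * (n - k)) := by
            rw [e, pow_succ]; ring
        _ ≤ n.choose j * (k ^ j * (n - k) ^ (n - (j + 1))) * ((n - j) * k) := by gcongr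
        _ = (n.choose j * (n - j)) * (k ^ (j + 1) * (n - k) ^ (n - (j + 1))) := by ring
        _ = _ := by rw [← h1]; ring
  · induction j, hjk using Nat.le_induction with
    | base => exact le_rfl
    | succ j hjk ih =>
      refine le_trans ?_ (ih (by omega))
      have h1 := hstep j (by omega)
      have e : n - j = (n - (j + 1)) + 1 := by omega
      have h3 : (n - j) * k ≤ (j + 1) * (n - k) := by
        rw [mul_comm (n - j)]; exact Nat.mul_le_mul (by omega) (by omega)
      refine Nat.le_of_mul_le_mul_right (c := j + 1) ?_ (by omega)
      calc n.choose (j + 1) * (k ^ (j + 1) * (n - k) ^ (n - (j + 1))) * (j + 1)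
          = (n.choose (j + 1) * (j + 1)) * (k ^ (j + 1) * (n - k) ^ (n - (j + 1))) := by ring
        _ = n.choose j * (k ^ j * (n - k) ^ (n - (j + 1))) * ((n - j) * k) := by rw [h1]; ring
        _ ≤ n.choose j * (k ^ j * (n - k) ^ (n - (j + 1))) * ((j + 1) * (n - k)) := by gcongr
        _ = _ := by rw [e, pow_succ]; ring

theorem one_le_mul_binomial_term {n k : ℕ} (hk : k ≤ n) (hn : 0 < n) {p q : ℝ}
    (hp : p = k / n) (hq : q = 1 - p) :
    1 ≤ (n + 1) * (n.choose k * (p ^ k * q ^ (n - k))) := by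
  have h1 : n ^ n ≤ (n + 1) * (n.choose k * (k ^ k * (n - k) ^ (n - k))) := by
    have h2 := add_pow k (n - k) n
    rw [Nat.add_sub_cancel' hk] at h2
    rw [h2]
    have := Finset.sum_le_card_nsmul (Finset.range (n + 1))
      (fun m => k ^ m * (n - k) ^ (n - m) * n.choose m) _
      (fun m hm => by
        rw [mul_comm]
        exact binomial_term_le hk m (by rw [Finset.mem_range] at hm; omega))
    simpa using this
  have hn' : (0 : ℝ) < n := by exact_mod_cast hn
  have h2 : (n : ℝ) ^ n ≤ (n + 1) * (n.choose k * ((k : ℝ) ^ k * ((n - k : ℕ) : ℝ) ^ (n - k))) := by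
    exact_mod_cast h1
  have e1 : (k : ℝ) = n * p := by rw [hp]; field_simp
  have e2 : ((n - k : ℕ) : ℝ) = n * q := by
    rw [Nat.cast_sub hk, hq, hp]; field_simp
  have e4 : (k : ℝ) ^ k = n ^ k * p ^ k := by rw [← mul_pow, ← e1]
  rw [e2, mul_pow, e4] at h2
  have e3 : (n : ℝ) ^ k * n ^ (n - k) = n ^ n := by rw [← pow_add, Nat.add_sub_cancel' hk]
  have h3 : (n : ℝ) ^ n * 1 ≤ n ^ n * ((n + 1) * (n.choose k * (p ^ k * q ^ (n - k)))) := by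
    rw [mul_one, ← e3]
    rw [← e3] at h2
    exact h2.trans_eq (by ring)
  exact le_of_mul_le_mul_left h3 (by positivity)

open scoped Pointwise in
/-- The number of `k`-sets fixed by a permutation decays exponentially in its support. -/
theorem card_fixed_powersetCard_le {X : Type*} [Fintype X] [DecidableEq X]
    (σ : Equiv.Perm X) (k : ℕ) (hk : 2 * k ≤ Fintype.card X) (hn : 0 < Fintype.card X) :
    ((((Finset.univ : Finset X).powersetCard k).filter fun Y => σ • Y = Y).card : ℝ) ≤
      (Fintype.card X + 1) * (Fintype.card X).choose k *
        Real.exp (-(k / (3 * Fintype.card X)) * σ.support.card) := by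
  classical
  set n := Fintype.card X with hndef
  obtain ⟨E, hE, hE3⟩ := exists_disjoint_smul_finset σ
  have hn' : (0 : ℝ) < n := by exact_mod_cast hn
  obtain ⟨p, hp⟩ : ∃ p : ℝ, p = k / n := ⟨_, rfl⟩
  obtain ⟨q, hq⟩ : ∃ q : ℝ, q = 1 - p := ⟨_, rfl⟩
  have hp0 : 0 ≤ p := by rw [hp]; positivity
  have hp2 : p ≤ 1 / 2 := by
    rw [hp, div_le_div_iff₀ hn' (by norm_num)]
    have : ((2 * k : ℕ) : ℝ) ≤ n := by exact_mod_cast hk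
    push_cast at this; linarith
  have hq0 : 0 ≤ q := by linarith
  set E₂ := (E ∪ σ • E)ᶜ with hE₂
  have hcE : 2 * E.card + E₂.card = n := by
    rw [hE₂, Finset.card_compl, Finset.card_union_of_disjoint hE, Finset.card_smul_finset]
    have := Finset.card_le_univ (E ∪ σ • E)
    rw [Finset.card_union_of_disjoint hE, Finset.card_smul_finset] at this
    omega
  set Fx := ((Finset.univ : Finset X).powersetCard k).filter fun Y => σ • Y = Y with hFx
  -- reconstruction of a fixed set from its traces
  have hrec : ∀ Y ∈ Fx, Y = (Y ∩ E) ∪ σ • (Y ∩ E) ∪ (Y ∩ E₂) := by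
    intro Y hY
    have hσ : σ • Y = Y := by simp [hFx] at hY; exact hY.2
    nth_rw 1 [← Finset.inter_univ Y]
    rw [Finset.smul_finset_inter, hσ, ← Finset.inter_union_distrib_left,
      ← Finset.inter_union_distrib_left, hE₂, Finset.union_compl]
  have hcard : ∀ Y ∈ Fx, Y.card = 2 * (Y ∩ E).card + (Y ∩ E₂).card := by
    intro Y hY
    conv_lhs => rw [hrec Y hY]
    rw [Finset.card_union_of_disjoint, Finset.card_union_of_disjoint, Finset.card_smul_finset]
    · ring
    · exact hE.mono Finset.inter_subset_right
        (Finset.smul_finset_subset_smul_finset Finset.inter_subset_right)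
    · refine Disjoint.mono (Finset.union_subset_union Finset.inter_subset_right
        (Finset.smul_finset_subset_smul_finset Finset.inter_subset_right))
        Finset.inter_subset_right ?_
      exact disjoint_compl_right
  have hsum : (Fx.card : ℝ) * (p ^ k * q ^ (n - k)) ≤ (p ^ 2 + q ^ 2) ^ E.card := by
    have h1 : ∀ Y ∈ Fx, p ^ k * q ^ (n - k) =
        ((p ^ 2) ^ (Y ∩ E).card * (q ^ 2) ^ (E.card - (Y ∩ E).card)) *
          (p ^ (Y ∩ E₂).card * q ^ (E₂.card - (Y ∩ E₂).card)) := by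
      intro Y hY
      have hYk : Y.card = k := by simp [hFx] at hY; exact hY.1
      have h2 := hcard Y hY
      have h3 := Finset.card_le_card (Finset.inter_subset_right : Y ∩ E ⊆ E)
      have h4 := Finset.card_le_card (Finset.inter_subset_right : Y ∩ E₂ ⊆ E₂)
      have e1 : k = 2 * (Y ∩ E).card + (Y ∩ E₂).card := by omega
      have e2 : n - k = 2 * (E.card - (Y ∩ E).card) + (E₂.card - (Y ∩ E₂).card) := by omega
      rw [e2]
      nth_rw 1 [e1]
      rw [pow_add, pow_add, pow_mul, pow_mul]
      ring
    calc (Fx.card : ℝ) * (p ^ k * q ^ (n - k)) = ∑ Y ∈ Fx, p ^ k * q ^ (n - k) := by simp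
      _ = ∑ Y ∈ Fx, ((p ^ 2) ^ (Y ∩ E).card * (q ^ 2) ^ (E.card - (Y ∩ E).card)) *
          (p ^ (Y ∩ E₂).card * q ^ (E₂.card - (Y ∩ E₂).card)) := Finset.sum_congr rfl h1
      _ = ∑ Z ∈ Fx.image fun Y => (Y ∩ E, Y ∩ E₂),
          ((p ^ 2) ^ Z.1.card * (q ^ 2) ^ (E.card - Z.1.card)) *
          (p ^ Z.2.card * q ^ (E₂.card - Z.2.card)) := by
        rw [Finset.sum_image]
        intro Y hY Y' hY' hYY
        simp only [Prod.mk.injEq] at hYY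
        rw [hrec Y hY, hrec Y' hY', hYY.1, hYY.2]
      _ ≤ ∑ Z ∈ E.powerset ×ˢ E₂.powerset,
          ((p ^ 2) ^ Z.1.card * (q ^ 2) ^ (E.card - Z.1.card)) *
          (p ^ Z.2.card * q ^ (E₂.card - Z.2.card)) := by
        refine Finset.sum_le_sum_of_subset_of_nonneg ?_ fun _ _ _ => by positivity
        intro Z hZ
        obtain ⟨Y, -, rfl⟩ := Finset.mem_image.mp hZ
        simp
      _ = (p ^ 2 + q ^ 2) ^ E.card * (p + q) ^ E₂.card := by
        rw [Finset.sum_product, ← Finset.sum_pow_mul_eq_add_pow, ← Finset.sum_pow_mul_eq_add_pow,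
          Finset.sum_mul_sum]
      _ = _ := by rw [hq]; simp
  have h1 := one_le_mul_binomial_term (show k ≤ n by omega) hn hp hq
  have hpq : p ^ 2 + q ^ 2 ≤ Real.exp (-p) := by
    have := Real.add_one_le_exp (-p)
    have : p ^ 2 + q ^ 2 ≤ -p + 1 := by rw [hq]; nlinarith
    linarith
  calc (Fx.card : ℝ) ≤ Fx.card * ((n + 1) * (n.choose k * (p ^ k * q ^ (n - k)))) :=
        le_mul_of_one_le_right (by positivity) h1
    _ = (n + 1) * n.choose k * (Fx.card * (p ^ k * q ^ (n - k))) := by ring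
    _ ≤ (n + 1) * n.choose k * Real.exp (-p) ^ E.card := by
      gcongr
      exact hsum.trans (pow_le_pow_left₀ (by positivity) hpq _)
    _ ≤ _ := by
      rw [← Real.exp_nat_mul]
      refine mul_le_mul_of_nonneg_left (Real.exp_le_exp.mpr ?_) (by positivity)
      have h5 : (σ.support.card : ℝ) ≤ 3 * E.card := by exact_mod_cast hE3
      have e : -(k / (3 * n) : ℝ) = -p / 3 := by rw [hp]; field_simp
      rw [e]
      nlinarith

/-- A set of points whose pointwise stabilizer in `A` is trivial. -/
def IsPointBase {X : Type*} (A : Subgroup (Equiv.Perm X)) (S : Finset X) : Prop :=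
  ∀ σ ∈ A, (∀ x ∈ S, σ x = x) → σ = 1

theorem IsPointBase.eq_of_eqOn {X : Type*} {A : Subgroup (Equiv.Perm X)} {S : Finset X}
    (h : IsPointBase A S) {σ τ : Equiv.Perm X} (hσ : σ ∈ A) (hτ : τ ∈ A)
    (hst : ∀ x ∈ S, σ x = τ x) : σ = τ := by
  have := h (τ⁻¹ * σ) (A.mul_mem (A.inv_mem hτ) hσ) fun x hx => by
    simp [Equiv.Perm.mul_apply, hst x hx]
  exact (inv_mul_eq_one.mp this).symm

open scoped Pointwise in
theorem IsPointBase.smul {X : Type*} [DecidableEq X] {A : Subgroup (Equiv.Perm X)} {S : Finset X}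
    (h : IsPointBase A S) {a : Equiv.Perm X} (ha : a ∈ A) : IsPointBase A (a • S) := by
  intro σ hσ hfix
  have := h (a⁻¹ * σ * a) (A.mul_mem (A.mul_mem (A.inv_mem ha) hσ) ha) fun x hx => by
    have := hfix (a • x) (Finset.smul_mem_smul_finset hx)
    simp only [Equiv.Perm.smul_def] at this
    simp [Equiv.Perm.mul_apply, this]
  rw [mul_assoc, inv_mul_eq_one] at this
  exact mul_eq_right.mp this.symm

theorem IsPointBase.card_le {X : Type*} [Fintype X] {A : Subgroup (Equiv.Perm X)} {S : Finset X}
    (h : IsPointBase A S) : Nat.card A ≤ Fintype.card X ^ S.card := by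
  classical
  have hinj : Function.Injective fun (a : A) (x : S) => (a : Equiv.Perm X) x := by
    intro a b hab
    exact Subtype.ext (h.eq_of_eqOn a.2 b.2 fun x hx => congrFun hab ⟨x, hx⟩)
  have := Nat.card_le_card_of_injective _ hinj
  simpa [Nat.card_eq_fintype_card] using this

/-- Averaging over a transitive group action. -/
theorem card_mul_sum_smul {G Ω : Type*} [Group G] [MulAction G Ω] [Fintype G] [Fintype Ω]
    [MulAction.IsPretransitive G Ω] (f : Ω → ℝ) (x : Ω) :
    (Fintype.card Ω : ℝ) * ∑ g : G, f (g • x) = Fintype.card G * ∑ y, f y := by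
  have h1 : ∀ x', ∑ g : G, f (g • x') = ∑ g : G, f (g • x) := by
    intro x'
    obtain ⟨h, rfl⟩ := MulAction.exists_smul_eq G x x'
    simp only [smul_smul]
    exact Fintype.sum_equiv (Equiv.mulRight h) _ _ fun g => rfl
  calc (Fintype.card Ω : ℝ) * ∑ g : G, f (g • x) = ∑ x' : Ω, ∑ g : G, f (g • x') := by
        simp [h1]
    _ = ∑ g : G, ∑ x' : Ω, f (g • x') := Finset.sum_comm
    _ = ∑ g : G, ∑ x' : Ω, f x' := Finset.sum_congr rfl fun g _ =>
        Equiv.sum_comp (MulAction.toPerm g) f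
    _ = _ := by simp

theorem sum_pow_card_inter_support_le {X : Type*} [Fintype X] [DecidableEq X]
    {A : Subgroup (Equiv.Perm X)} {T : Finset X} (hT : IsPointBase A T) {l : ℝ} (hl : 0 ≤ l)
    {P : Finset (Equiv.Perm X)} (hP : ∀ σ, σ ∈ P → σ ∈ A ∧ σ ≠ 1) :
    ∑ σ ∈ P, l ^ (T ∩ σ.support).card ≤ (1 + Fintype.card X * l) ^ T.card - 1 := by
  classical
  set w : (T → X) → ℝ := fun f => ∏ x : T, if f x = x then 1 else l with hw
  have hw0 : ∀ f, 0 ≤ w f := fun f => Finset.prod_nonneg fun x _ => by split_ifs <;> positivity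
  have hterm : ∀ σ : Equiv.Perm X, l ^ (T ∩ σ.support).card = w fun x => σ x := by
    intro σ
    rw [hw]
    simp only
    rw [Finset.prod_coe_sort T fun x => if σ x = x then (1 : ℝ) else l, Finset.prod_ite]
    simp only [Finset.prod_const, one_pow, one_mul]
    congr 2
    ext x
    simp
  have hone : (1 : ℝ) = w fun x => (1 : Equiv.Perm X) x := by simp [hw]
  have hinj : Set.InjOn (fun (σ : Equiv.Perm X) (x : T) => σ x) (insert 1 P : Finset _) := by
    intro σ hσ τ hτ hst
    have hmem : ∀ ρ ∈ insert 1 P, ρ ∈ A := by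
      intro ρ hρ
      rcases Finset.mem_insert.mp hρ with rfl | h
      · exact A.one_mem
      · exact (hP ρ h).1
    exact hT.eq_of_eqOn (hmem σ hσ) (hmem τ hτ) fun x hx => congrFun hst ⟨x, hx⟩
  have h1 : 1 + ∑ σ ∈ P, l ^ (T ∩ σ.support).card ≤ ∑ f : T → X, w f := by
    have : (1 : Equiv.Perm X) ∉ P := fun h => (hP 1 h).2 rfl
    calc 1 + ∑ σ ∈ P, l ^ (T ∩ σ.support).card
        = ∑ σ ∈ insert 1 P, w fun x => σ x := by
          rw [Finset.sum_insert this, hone]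
          congr 1
          exact Finset.sum_congr rfl fun σ _ => hterm σ
      _ = ∑ f ∈ (insert 1 P).image fun (σ : Equiv.Perm X) (x : T) => σ x, w f := by
          rw [Finset.sum_image hinj]
      _ ≤ _ := Finset.sum_le_sum_of_subset_of_nonneg (Finset.subset_univ _) fun f _ _ => hw0 f
  have h2 : ∑ f : T → X, w f = ∏ x : T, ∑ y : X, if y = x then (1 : ℝ) else l := by
    rw [Finset.prod_univ_sum, Fintype.piFinset_univ]
  have h3 : ∏ x : T, (∑ y : X, if y = x then (1 : ℝ) else l) ≤
      (1 + Fintype.card X * l) ^ T.card := by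
    have : ∀ x : T, (∑ y : X, if y = x then (1 : ℝ) else l) ≤ 1 + Fintype.card X * l := by
      intro x
      calc (∑ y : X, if y = x then (1 : ℝ) else l) ≤ ∑ y : X, ((if y = x then 1 else 0) + l) := by
            refine Finset.sum_le_sum fun y _ => ?_
            split_ifs <;> linarith
        _ = _ := by rw [Finset.sum_add_distrib]; simp
    calc _ ≤ ∏ x : T, (1 + Fintype.card X * l) := Finset.prod_le_prod
          (fun x _ => Finset.sum_nonneg fun y _ => by split_ifs <;> positivity) fun x _ => this x
      _ = _ := by simp
  linarith

open scoped Pointwise in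
/-- In a transitive group with a small base, elements of small support are rare. -/
theorem sum_exp_card_support_le {X : Type*} [Fintype X] [DecidableEq X]
    {A : Subgroup (Equiv.Perm X)} [MulAction.IsPretransitive A X] {S : Finset X}
    (hS : IsPointBase A S) (hS0 : S.Nonempty) (c : ℝ)
    {P : Finset (Equiv.Perm X)} (hP : ∀ σ, σ ∈ P → σ ∈ A ∧ σ ≠ 1) :
    ∑ σ ∈ P, Real.exp (-c * σ.support.card) ≤
      (1 + Fintype.card X * Real.exp (-c * (Fintype.card X / S.card))) ^ S.card - 1 := by
  classical
  have : Fintype A := Fintype.ofFinite _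
  set l := Real.exp (-c * (Fintype.card X / S.card)) with hl
  have hX : (0 : ℝ) < Fintype.card X := by
    have : Nonempty X := ⟨hS0.choose⟩
    exact_mod_cast Fintype.card_pos
  have hb : (0 : ℝ) < S.card := by exact_mod_cast Finset.card_pos.mpr hS0
  have hA : (0 : ℝ) < Fintype.card A := by exact_mod_cast Fintype.card_pos
  have havg : ∀ σ : Equiv.Perm X, ∑ a : A, (((a : Equiv.Perm X) • S ∩ σ.support).card : ℝ) =
      Fintype.card A * S.card * σ.support.card / Fintype.card X := by
    intro σ
    have h1 : ∀ a : A, (((a : Equiv.Perm X) • S ∩ σ.support).card : ℝ) =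
        ∑ x ∈ S, if a • x ∈ σ.support then (1 : ℝ) else 0 := by
      intro a
      rw [Finset.sum_boole, ← Finset.card_smul_finset (a : Equiv.Perm X) (S.filter _)]
      congr 2
      ext y
      simp only [Finset.mem_inter, Finset.mem_smul_finset, Finset.mem_filter]
      constructor
      · rintro ⟨⟨x, hx, rfl⟩, h⟩
        exact ⟨x, ⟨hx, h⟩, rfl⟩
      · rintro ⟨x, ⟨hx, h⟩, rfl⟩
        exact ⟨⟨x, hx, rfl⟩, h⟩
    simp only [h1]
    rw [Finset.sum_comm]
    have h2 : ∀ x ∈ S, ∑ a : A, (if a • x ∈ σ.support then (1 : ℝ) else 0) =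
        Fintype.card A * σ.support.card / Fintype.card X := by
      intro x _
      have := card_mul_sum_smul (G := A) (fun y => if y ∈ σ.support then (1 : ℝ) else 0) x
      rw [eq_div_iff hX.ne', mul_comm, this]
      congr 1
      rw [Finset.sum_boole, Finset.filter_mem_eq_inter, Finset.univ_inter]
    rw [Finset.sum_congr rfl h2]
    simp
    ring
  have hjensen : ∀ σ : Equiv.Perm X, Real.exp (-c * σ.support.card) ≤
      ∑ a : A, (1 / Fintype.card A : ℝ) * l ^ ((a : Equiv.Perm X) • S ∩ σ.support).card := by
    intro σ
    have := convexOn_exp.map_sum_le (t := (Finset.univ : Finset A))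
      (w := fun _ => (1 / Fintype.card A : ℝ))
      (p := fun a => ((a : Equiv.Perm X) • S ∩ σ.support).card * (-c * (Fintype.card X / S.card)))
      (fun _ _ => by positivity) (by simp) (fun _ _ => Set.mem_univ _)
    simp only [smul_eq_mul] at this
    rw [← Finset.mul_sum, ← Finset.sum_mul, havg] at this
    simp only [Real.exp_nat_mul] at this
    refine le_trans (Real.exp_le_exp.mpr (le_of_eq ?_)) this
    field_simp
  calc ∑ σ ∈ P, Real.exp (-c * σ.support.card)
      ≤ ∑ σ ∈ P, ∑ a : A,
          (1 / Fintype.card A : ℝ) * l ^ ((a : Equiv.Perm X) • S ∩ σ.support).card :=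
        Finset.sum_le_sum fun σ _ => hjensen σ
    _ = ∑ a : A, (1 / Fintype.card A : ℝ) *
          ∑ σ ∈ P, l ^ ((a : Equiv.Perm X) • S ∩ σ.support).card := by
        rw [Finset.sum_comm]; simp only [Finset.mul_sum]
    _ ≤ ∑ a : A, (1 / Fintype.card A : ℝ) * ((1 + Fintype.card X * l) ^ S.card - 1) := by
        gcongr with a
        have := sum_pow_card_inter_support_le (hS.smul a.2) (Real.exp_pos _).le hP (l := l)
        rwa [Finset.card_smul_finset] at this
    _ = _ := by simp

theorem two_mul_card_add_card_ne_le {Q Q' : Type*} [Fintype Q] [Fintype Q'] [DecidableEq Q]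
    {π : Q → Q'} (hπ : Function.Surjective π) {f : Q → Q} (hf : ∀ a, π (f a) = π a) :
    2 * Fintype.card Q' + (Finset.univ.filter fun a => f a ≠ a).card ≤ 2 * Fintype.card Q := by
  classical
  have h1 : (Finset.univ.filter fun a => f a ≠ a).card =
      ∑ c : Q', ((Finset.univ.filter fun a => f a ≠ a).filter fun a => π a = c).card :=
    Finset.card_eq_sum_card_fiberwise fun a _ => Finset.mem_coe.mpr (Finset.mem_univ _)
  have h2 : Fintype.card Q = ∑ c : Q', (Finset.univ.filter fun a => π a = c).card :=
    Finset.card_eq_sum_card_fiberwise fun a _ => Finset.mem_coe.mpr (Finset.mem_univ _)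
  have h3 : 2 * Fintype.card Q' = ∑ c : Q', 2 := by simp [mul_comm]
  rw [h1, h2, h3, Finset.mul_sum, ← Finset.sum_add_distrib]
  refine Finset.sum_le_sum fun c _ => ?_
  set B := Finset.univ.filter fun a => π a = c with hB
  have hle : ((Finset.univ.filter fun a => f a ≠ a).filter fun a => π a = c).card ≤ B.card :=
    Finset.card_le_card fun a ha => by simp [hB] at ha ⊢; exact ha.2
  rcases Finset.eq_empty_or_nonempty
    ((Finset.univ.filter fun a => f a ≠ a).filter fun a => π a = c) with h | ⟨a, ha⟩
  · rw [h]
    obtain ⟨a, ha⟩ := hπ c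
    have : 0 < B.card := Finset.card_pos.mpr ⟨a, by simp [hB, ha]⟩
    simp only [Finset.card_empty]
    omega
  · simp only [Finset.mem_filter, Finset.mem_univ, true_and] at ha
    have : 1 < B.card := Finset.one_lt_card.mpr
      ⟨f a, by simp [hB, hf, ha.2], a, by simp [hB, ha.2], ha.1⟩
    omega

theorem exists_merging_element {H Ω : Type*} [Group H] [Finite H] [Finite Ω] [MulAction H Ω]
    (R : Set Ω) (s : Setoid Ω) (hst : s ≤ MulAction.orbitRel H Ω) (hR : ∀ ω, ∃ r ∈ R, s ω r) :
    ∃ h : H, ∀ s' : Setoid Ω, s ≤ s' → (∀ r ∈ R, s' r (h • r)) →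
      2 * Nat.card (Quotient s') ≤
        Nat.card (Quotient s) + Nat.card (MulAction.orbitRel.Quotient H Ω) := by
  classical
  have := Fintype.ofFinite H
  have := Fintype.ofFinite Ω
  choose r hrR hr using hR
  let ρ : Quotient s → Ω := fun C => r C.out
  have hρR : ∀ C, ρ C ∈ R := fun C => hrR _
  have hρ : ∀ C, (⟦ρ C⟧ : Quotient s) = C := fun C => by
    conv_rhs => rw [← Quotient.out_eq C]
    exact Quotient.sound (s.symm (hr _))
  let f : H → Quotient s → Quotient s := fun h C => ⟦h • ρ C⟧
  -- Burnside: the expected number of fixed classes is the number of orbits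
  have hcount : ∑ h : H, (Finset.univ.filter fun C => f h C = C).card =
      Nat.card (MulAction.orbitRel.Quotient H Ω) * Fintype.card H := by
    have h1 : ∀ h, (Finset.univ.filter fun C => f h C = C).card =
        (Finset.univ.filter fun ω : Ω => h • ρ ⟦ω⟧ = ω).card := by
      intro h
      refine Finset.card_bij (fun C _ => h • ρ C) ?_ ?_ ?_
      · intro C hC
        simp only [Finset.mem_filter, Finset.mem_univ, true_and, f] at hC ⊢
        rw [hC]
      · intro C _ C' _ hCC
        rw [← hρ C, ← hρ C', MulAction.injective h hCC]
      · intro ω hω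
        simp only [Finset.mem_filter, Finset.mem_univ, true_and, f] at hω ⊢
        exact ⟨⟦ω⟧, by rw [hω], hω⟩
    have h2 : ∀ ω : Ω, (Finset.univ.filter fun h : H => h • ρ ⟦ω⟧ = ω).card =
        (Finset.univ.filter fun h : H => h • ω = ω).card := by
      intro ω
      have : s (ρ ⟦ω⟧) ω := Quotient.exact (hρ ⟦ω⟧)
      obtain ⟨g, hg⟩ := MulAction.orbitRel_apply.mp (hst this)
      simp only at hg
      refine Finset.card_bij (fun h _ => h * g) ?_ ?_ ?_
      · intro h hh
        simp only [Finset.mem_filter, Finset.mem_univ, true_and] at hh ⊢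
        rw [mul_smul, hg, hh]
      · intro _ _ _ _ h; exact mul_right_cancel h
      · intro h hh
        simp only [Finset.mem_filter, Finset.mem_univ, true_and] at hh ⊢
        exact ⟨h * g⁻¹, by rw [← hg, smul_smul, inv_mul_cancel_right, hh], by simp⟩
    have h3 := MulAction.sum_card_fixedBy_eq_card_orbits_mul_card_group H Ω
    calc _ = ∑ h : H, (Finset.univ.filter fun ω : Ω => h • ρ ⟦ω⟧ = ω).card :=
          Finset.sum_congr rfl fun h _ => h1 h
      _ = ∑ ω : Ω, (Finset.univ.filter fun h : H => h • ρ ⟦ω⟧ = ω).card :=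
          Finset.sum_card_bipartiteAbove_eq_sum_card_bipartiteBelow fun (h : H) (ω : Ω) =>
            h • ρ ⟦ω⟧ = ω
      _ = ∑ ω : Ω, (Finset.univ.filter fun h : H => h • ω = ω).card :=
          Finset.sum_congr rfl fun ω _ => h2 ω
      _ = ∑ h : H, (Finset.univ.filter fun ω : Ω => h • ω = ω).card :=
          (Finset.sum_card_bipartiteAbove_eq_sum_card_bipartiteBelow fun (h : H) (ω : Ω) =>
            h • ω = ω).symm
      _ = _ := by
          rw [Nat.card_eq_fintype_card, ← h3]
          refine Finset.sum_congr rfl fun h _ => ?_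
          rw [Fintype.card_subtype]
          simp [MulAction.mem_fixedBy]
  obtain ⟨h, hh⟩ : ∃ h : H, (Finset.univ.filter fun C => f h C = C).card ≤
      Nat.card (MulAction.orbitRel.Quotient H Ω) := by
    by_contra! hcon
    have := Finset.sum_lt_sum_of_nonempty (Finset.univ_nonempty (α := H)) fun h _ => hcon h
    rw [hcount] at this
    simp [mul_comm] at this
  refine ⟨h, fun s' hss' hs' => ?_⟩
  let π : Quotient s → Quotient s' := Quotient.map id fun a b hab => hss' hab
  have hπ : Function.Surjective π := by
    intro c
    induction c using Quotient.inductionOn with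
    | h a => exact ⟨⟦a⟧, rfl⟩
  have := two_mul_card_add_card_ne_le (π := π) (f := f h) hπ fun C => by
    conv_rhs => rw [← hρ C]
    exact Quotient.sound (s'.symm (hs' _ (hρR C)))
  have h5 := Finset.card_filter_add_card_filter_not (s := (Finset.univ : Finset (Quotient s)))
    (fun C => f h C = C)
  rw [Finset.card_univ] at h5
  rw [Nat.card_eq_fintype_card, Nat.card_eq_fintype_card]
  simp only [ne_eq] at this
  omega

/-- An overgroup of a permutation group with few orbits acquires its orbits from few elements,
each of which needs to be known only on a set of orbit representatives. -/
theorem exists_merging_family {H Ω : Type*} [Group H] [Finite H] [Finite Ω] [MulAction H Ω]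
    (R : Set Ω) (s₀ : Setoid Ω) (hst : s₀ ≤ MulAction.orbitRel H Ω) (hR : ∀ ω, ∃ r ∈ R, s₀ ω r)
    (q : ℕ) (hq : Nat.card (Quotient s₀) < 2 ^ q) :
    ∃ h : Fin q → H, ∀ s : Setoid Ω, s₀ ≤ s → (∀ i, ∀ r ∈ R, s r (h i • r)) →
      MulAction.orbitRel H Ω ≤ s := by
  classical
  have := Fintype.ofFinite Ω
  set N := Nat.card (MulAction.orbitRel.Quotient H Ω) with hN
  have key : ∀ q, ∃ (h : Fin q → H) (s : Setoid Ω), s₀ ≤ s ∧ s ≤ MulAction.orbitRel H Ω ∧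
      (∀ s', s₀ ≤ s' → (∀ i, ∀ r ∈ R, s' r (h i • r)) → s ≤ s') ∧
      2 ^ q * Nat.card (Quotient s) ≤ Nat.card (Quotient s₀) + 2 ^ q * N := by
    intro q
    induction q with
    | zero => exact ⟨Fin.elim0, s₀, le_rfl, hst, fun s' h _ => h, by simp⟩
    | succ q ih =>
      obtain ⟨h, s, hs₀, hsH, hmin, hcard⟩ := ih
      obtain ⟨g, hg⟩ := exists_merging_element R s hsH fun ω => by
        obtain ⟨r, hr, hs⟩ := hR ω
        exact ⟨r, hr, hs₀ hs⟩
      let s' : Setoid Ω := sInf {t | s ≤ t ∧ ∀ r ∈ R, t r (g • r)}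
      have hss' : s ≤ s' := le_sInf fun t ht => ht.1
      refine ⟨Fin.snoc h g, s', hs₀.trans hss', ?_, ?_, ?_⟩
      · refine sInf_le ⟨hsH, fun r _ => ?_⟩
        exact MulAction.orbitRel_apply.mpr ⟨g⁻¹, by simp⟩
      · intro t ht hgen
        refine sInf_le ⟨hmin t ht fun i r hr => ?_, fun r hr => ?_⟩
        · simpa using hgen i.castSucc r hr
        · simpa using hgen (Fin.last q) r hr
      · have := hg s' hss' fun r hr t ht => ht.2 r hr
        rw [pow_succ]
        calc 2 ^ q * 2 * Nat.card (Quotient s') = 2 ^ q * (2 * Nat.card (Quotient s')) := by ring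
          _ ≤ 2 ^ q * (Nat.card (Quotient s) + N) := by gcongr
          _ ≤ _ := by linarith
  obtain ⟨h, s, hs₀, hsH, hmin, hcard⟩ := key q
  refine ⟨h, fun t ht hgen => le_trans ?_ (hmin t ht hgen)⟩
  have hle : Nat.card (Quotient s) ≤ N := by
    by_contra! hcon
    have : 2 ^ q * (N + 1) ≤ 2 ^ q * Nat.card (Quotient s) := by gcongr; omega
    rw [mul_add] at this
    omega
  let π : Quotient s → MulAction.orbitRel.Quotient H Ω := Quotient.map id fun a b hab => hsH hab
  have hπ : Function.Surjective π := by
    intro c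
    induction c using Quotient.inductionOn with
    | h a => exact ⟨⟦a⟧, rfl⟩
  have hbij : Function.Bijective π := by
    rw [Nat.bijective_iff_surjective_and_card]
    exact ⟨hπ, le_antisymm hle (Nat.card_le_card_of_surjective π hπ)⟩
  intro a b hab
  exact Quotient.exact (hbij.1 (a₁ := ⟦a⟧) (a₂ := ⟦b⟧) (Quotient.sound hab))

open scoped Pointwise in
/-- `G` is transitive on `m`-element sets. -/
def IsSetHomogeneous {X : Type*} [DecidableEq X] (G : Subgroup (Equiv.Perm X)) (m : ℕ) : Prop :=
  ∀ S T : Finset X, S.card = m → T.card = m → ∃ g ∈ G, g • S = T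

open scoped Pointwise in
/-- The permutations preserving every `H`-orbit on `m`-element sets. -/
def setClosure {X : Type*} [DecidableEq X] (H : Subgroup (Equiv.Perm X)) (m : ℕ) :
    Subgroup (Equiv.Perm X) where
  carrier := {σ | ∀ T : Finset X, T.card = m → ∃ h ∈ H, h • T = σ • T}
  one_mem' := fun T _ => ⟨1, H.one_mem, rfl⟩
  mul_mem' := by
    intro a b ha hb T hT
    obtain ⟨h₁, hh₁, e₁⟩ := hb T hT
    obtain ⟨h₂, hh₂, e₂⟩ := ha (b • T) (by rw [Finset.card_smul_finset, hT])
    exact ⟨h₂ * h₁, H.mul_mem hh₂ hh₁, by rw [mul_smul, e₁, e₂, mul_smul]⟩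
  inv_mem' := by
    intro a ha T hT
    obtain ⟨h, hh, e⟩ := ha (a⁻¹ • T) (by rw [Finset.card_smul_finset, hT])
    exact ⟨h⁻¹, H.inv_mem hh, by rw [inv_smul_eq_iff, e, smul_inv_smul]⟩

theorem le_setClosure {X : Type*} [DecidableEq X] (H : Subgroup (Equiv.Perm X)) (m : ℕ) :
    H ≤ setClosure H m := fun σ hσ _ _ => ⟨σ, hσ, rfl⟩

theorem isSetHomogeneous_setClosure_iff {X : Type*} [DecidableEq X] {H : Subgroup (Equiv.Perm X)}
    {m : ℕ} : IsSetHomogeneous (setClosure H m) m ↔ IsSetHomogeneous H m := by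
  constructor
  · intro h S T hS hT
    obtain ⟨g, hg, rfl⟩ := h S T hS hT
    exact hg S hS
  · intro h S T hS hT
    obtain ⟨g, hg, e⟩ := h S T hS hT
    exact ⟨g, le_setClosure H m hg, e⟩

theorem IsSetHomogeneous.mono {X : Type*} [DecidableEq X] {G H : Subgroup (Equiv.Perm X)}
    {m : ℕ} (h : IsSetHomogeneous G m) (hGH : G ≤ H) : IsSetHomogeneous H m := by
  intro S T hS hT
  obtain ⟨g, hg, e⟩ := h S T hS hT
  exact ⟨g, hGH hg, e⟩

open scoped Pointwise in
theorem card_setClosure_overgroups_le {X : Type*} [Fintype X] [DecidableEq X]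
    {G : Subgroup (Equiv.Perm X)} {m q : ℕ} {S : Finset X}
    (hS : ∀ T : Finset X, T.card = m → ∃ g ∈ G, g • T ⊆ S)
    (hq : Nat.card (MulAction.orbitRel.Quotient G (Set.powersetCard X m)) < 2 ^ q) :
    ((fun H => setClosure H m) '' {H : Subgroup (Equiv.Perm X) | G ≤ H}).ncard ≤
      (Fintype.card X ^ S.card) ^ q := by
  classical
  let R : Set (Set.powersetCard X m) := {T | (T : Finset X) ⊆ S}
  let s₀ := MulAction.orbitRel G (Set.powersetCard X m)
  have hcoe : ∀ (H : Subgroup (Equiv.Perm X)) (h : H) (T : Set.powersetCard X m),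
      ((h • T : Set.powersetCard X m) : Finset X) = (h : Equiv.Perm X) • (T : Finset X) :=
    fun _ _ _ => rfl
  have hle : ∀ H : Subgroup (Equiv.Perm X), G ≤ H →
      s₀ ≤ MulAction.orbitRel H (Set.powersetCard X m) := by
    intro H hH a b hab
    obtain ⟨g, hg⟩ := MulAction.orbitRel_apply.mp hab
    exact MulAction.orbitRel_apply.mpr ⟨⟨g, hH g.2⟩, hg⟩
  have hR : ∀ ω, ∃ r ∈ R, s₀ ω r := by
    intro T
    obtain ⟨g, hg, hgT⟩ := hS T T.2
    refine ⟨(⟨g, hg⟩ : G) • T, hgT, ?_⟩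
    exact MulAction.orbitRel_apply.mpr ⟨⟨g, hg⟩⁻¹, inv_smul_smul (⟨g, hg⟩ : G) T⟩
  have hex : ∀ H : Subgroup (Equiv.Perm X), ∃ h : Fin q → H, G ≤ H →
      ∀ s : Setoid (Set.powersetCard X m), s₀ ≤ s → (∀ i, ∀ r ∈ R, s r (h i • r)) →
        MulAction.orbitRel H (Set.powersetCard X m) ≤ s := by
    intro H
    by_cases hH : G ≤ H
    · obtain ⟨h, hh⟩ := exists_merging_family (H := H) R s₀ (hle H hH) hR q hq
      exact ⟨h, fun _ => hh⟩
    · exact ⟨fun _ => 1, fun h => absurd h hH⟩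
  choose h hh using hex
  -- the restrictions of the merging elements determine the closure
  let Φ : Subgroup (Equiv.Perm X) → Fin q → S → X := fun H i x => (h H i : Equiv.Perm X) x
  have hsub : ∀ H H', G ≤ H → G ≤ H' → Φ H = Φ H' → setClosure H m ≤ setClosure H' m := by
    intro H H' hH hH' hΦ
    have hrel := hh H hH (MulAction.orbitRel H' _) (hle H' hH') fun i r hr => by
      refine MulAction.orbitRel_apply.mpr ⟨(h H' i)⁻¹, ?_⟩
      simp only
      rw [inv_smul_eq_iff]
      apply Subtype.ext
      rw [hcoe, hcoe]
      ext y
      simp only [Finset.mem_smul_finset]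
      have e : ∀ x ∈ (r : Finset X), (h H i : Equiv.Perm X) • x = (h H' i : Equiv.Perm X) • x :=
        fun x hx => congrFun (congrFun hΦ i) ⟨x, hr hx⟩
      constructor
      · rintro ⟨x, hx, rfl⟩; exact ⟨x, hx, (e x hx).symm⟩
      · rintro ⟨x, hx, rfl⟩; exact ⟨x, hx, e x hx⟩
    intro σ hσ T hT
    obtain ⟨g, hg, e⟩ := hσ T hT
    have h1 : MulAction.orbitRel H (Set.powersetCard X m)
        ((⟨g, hg⟩ : H) • (⟨T, hT⟩ : Set.powersetCard X m)) ⟨T, hT⟩ :=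
      MulAction.orbitRel_apply.mpr ⟨⟨g, hg⟩, rfl⟩
    obtain ⟨g', hg'⟩ := MulAction.orbitRel_apply.mp (hrel h1)
    refine ⟨g', g'.2, ?_⟩
    rw [← e]
    exact congrArg Subtype.val hg'
  have hcard : ((fun H => setClosure H m) '' {H | G ≤ H}).ncard ≤
      (Set.univ : Set (Fin q → S → X)).ncard := by
    refine Set.ncard_le_ncard_of_injOn
      (fun A => if hA : ∃ H, G ≤ H ∧ setClosure H m = A then Φ hA.choose else Φ ⊥)
      (fun _ _ => Set.mem_univ _) ?_ Set.finite_univ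
    rintro _ ⟨H, hH, rfl⟩ _ ⟨H', hH', rfl⟩ hHH
    have e1 : ∃ K, G ≤ K ∧ setClosure K m = setClosure H m := ⟨H, hH, rfl⟩
    have e2 : ∃ K, G ≤ K ∧ setClosure K m = setClosure H' m := ⟨H', hH', rfl⟩
    simp only [dif_pos e1, dif_pos e2] at hHH
    simp only
    rw [← e1.choose_spec.2, ← e2.choose_spec.2]
    exact le_antisymm (hsub _ _ e1.choose_spec.1 e2.choose_spec.1 hHH)
      (hsub _ _ e2.choose_spec.1 e1.choose_spec.1 hHH.symm)
  refine hcard.trans ?_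
  simp [Set.ncard_univ, Nat.card_eq_fintype_card]

open scoped Pointwise in
theorem card_orbits_succ_le {X : Type*} [Fintype X] [DecidableEq X]
    {G : Subgroup (Equiv.Perm X)} {d : ℕ} (hG : IsSetHomogeneous G d) (hd : d ≤ Fintype.card X) :
    Nat.card (MulAction.orbitRel.Quotient G (Set.powersetCard X (d + 1))) ≤ Fintype.card X := by
  classical
  obtain ⟨D, -, hD⟩ := Finset.exists_subset_card_eq (s := (Finset.univ : Finset X))
    (by simpa using hd)
  let F : {x : X // x ∉ D} → MulAction.orbitRel.Quotient G (Set.powersetCard X (d + 1)) :=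
    fun x => ⟦⟨insert x.1 D, by
      rw [Set.powersetCard.mem_iff, Finset.card_insert_of_notMem x.2, hD]⟩⟧
  have hF : Function.Surjective F := by
    intro c
    induction c using Quotient.inductionOn with
    | h T =>
      have hT : (T : Finset X).card = d + 1 := T.2
      obtain ⟨t, ht⟩ : (T : Finset X).Nonempty := by rw [← Finset.card_pos]; omega
      obtain ⟨g, hg, hgD⟩ := hG ((T : Finset X).erase t) D
        (by rw [Finset.card_erase_of_mem ht]; omega) hD
      have hgT : insert (g • t) D = g • (T : Finset X) := by
        rw [← hgD, ← Finset.smul_finset_insert, Finset.insert_erase ht]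
      refine ⟨⟨g • t, ?_⟩, Quotient.sound ?_⟩
      · rw [← hgD, Finset.smul_mem_smul_finset_iff]; simp
      · exact MulAction.orbitRel_apply.mpr ⟨⟨g, hg⟩, Subtype.ext hgT.symm⟩
  have h1 := Nat.card_le_card_of_surjective F hF
  refine h1.trans ?_
  rw [Nat.card_eq_fintype_card]
  exact Fintype.card_subtype_le _

open scoped Pointwise in
theorem exists_small_orbit_representatives {X : Type*} [Fintype X] [DecidableEq X]
    {G : Subgroup (Equiv.Perm X)} {d u : ℕ} (hG : IsSetHomogeneous G (d + 1)) (hu : 0 < u)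
    (hdu : d + u ≤ Fintype.card X) :
    ∃ S : Finset X, (∀ T : Finset X, T.card = d + 2 → ∃ g ∈ G, g • T ⊆ S) ∧
      (S.card : ℝ) ≤ d + u + Fintype.card X / u * Real.log (Fintype.card X) + 1 := by
  classical
  obtain ⟨B, -, hB⟩ := Finset.exists_subset_card_eq (s := (Finset.univ : Finset X))
    (n := d + u) (by simpa using hdu)
  obtain ⟨A, hAB, hA⟩ := Finset.exists_subset_card_eq (s := B) (n := d) (by omega)
  set U := B \ A with hU
  have hUcard : U.card = u := by rw [hU, Finset.card_sdiff_of_subset hAB]; omega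
  have hUA : ∀ x ∈ U, x ∉ A := fun x hx => by simp [hU] at hx; exact hx.2
  let N : Finset X → Finset X → Finset X := fun T D =>
    Finset.univ.filter fun y => y ∉ D ∧ ∃ g ∈ G, g • T = insert y D
  have hN : ∀ T D y, y ∈ N T D ↔ y ∉ D ∧ ∃ g ∈ G, g • T = insert y D := by
    intro T D y; simp [N]
  have hNsmul : ∀ T D, ∀ h ∈ G, (N T (h • D)).card = (N T D).card := by
    intro T D h hh
    rw [← Finset.card_smul_finset h (N T D)]
    congr 1
    ext y
    rw [← Finset.inv_smul_mem_iff, hN, hN, ← Finset.inv_smul_mem_iff]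
    refine and_congr_right fun _ => ⟨?_, ?_⟩
    · rintro ⟨g, hg, e⟩
      refine ⟨h⁻¹ * g, G.mul_mem (G.inv_mem hh) hg, ?_⟩
      rw [mul_smul, e, Finset.smul_finset_insert, inv_smul_smul]
    · rintro ⟨g, hg, e⟩
      refine ⟨h * g, G.mul_mem hh hg, ?_⟩
      rw [mul_smul, e, Finset.smul_finset_insert, smul_inv_smul]
  have hconst : ∀ T D D', D.card = d + 1 → D'.card = d + 1 → (N T D).card = (N T D').card := by
    intro T D D' hD hD'
    obtain ⟨g, hg, rfl⟩ := hG D D' hD hD'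
    rw [hNsmul T D g hg]
  have hpos : ∀ T D, T.card = d + 2 → D.card = d + 1 → 0 < (N T D).card := by
    intro T D hT hD
    obtain ⟨t, ht⟩ : T.Nonempty := by rw [← Finset.card_pos]; omega
    rw [hconst T D (T.erase t) hD (by rw [Finset.card_erase_of_mem ht]; omega)]
    refine Finset.card_pos.mpr ⟨t, ?_⟩
    rw [hN]
    exact ⟨by simp, 1, G.one_mem, by rw [one_smul, Finset.insert_erase ht]⟩
  let L : Finset X → Finset X := fun T => U.biUnion fun x => N T (insert x A)
  have hL : ∀ T, T.card = d + 2 → u ≤ (L T).card := by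
    intro T hT
    obtain ⟨x₀, hx₀⟩ : U.Nonempty := by rw [← Finset.card_pos]; omega
    have hcard : ∀ x, x ∉ A → (insert x A).card = d + 1 := fun x hx => by
      rw [Finset.card_insert_of_notMem hx, hA]
    set c := (N T (insert x₀ A)).card with hc
    have hc0 : 0 < c := hpos T _ hT (hcard _ (hUA _ hx₀))
    have h1 := Finset.sum_card_bipartiteAbove_eq_sum_card_bipartiteBelow
      (s := U) (t := L T) (fun x y => y ∈ N T (insert x A))
    have h2 : ∀ x ∈ U,
        (Finset.bipartiteAbove (fun x y => y ∈ N T (insert x A)) (L T) x).card = c := by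
      intro x hx
      rw [hc, hconst T (insert x₀ A) (insert x A) (hcard _ (hUA _ hx₀)) (hcard _ (hUA _ hx))]
      congr 1
      ext y
      simp only [Finset.bipartiteAbove, Finset.mem_filter, and_iff_right_iff_imp]
      exact fun hy => Finset.mem_biUnion.mpr ⟨x, hx, hy⟩
    have h3 : ∀ y ∈ L T,
        (Finset.bipartiteBelow (fun x y => y ∈ N T (insert x A)) U y).card ≤ c := by
      intro y hy
      obtain ⟨x₁, hx₁, hyx⟩ := Finset.mem_biUnion.mp hy
      have hyA : y ∉ A := fun h => ((hN _ _ _).mp hyx).1 (Finset.mem_insert_of_mem h)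
      rw [hc, hconst T (insert x₀ A) (insert y A) (hcard _ (hUA _ hx₀)) (hcard _ hyA)]
      refine Finset.card_le_card fun x hx => ?_
      simp only [Finset.bipartiteBelow, Finset.mem_filter] at hx
      obtain ⟨hxU, hxy⟩ := hx
      obtain ⟨hy1, g, hg, e⟩ := (hN _ _ _).mp hxy
      rw [hN]
      refine ⟨?_, g, hg, by rw [e, Finset.insert_comm]⟩
      intro h
      rcases Finset.mem_insert.mp h with rfl | h
      · exact hy1 (Finset.mem_insert_self _ _)
      · exact hUA x hxU h
    rw [Finset.sum_congr rfl h2, Finset.sum_const, hUcard, smul_eq_mul] at h1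
    have h4 := Finset.sum_le_card_nsmul _ _ _ h3
    rw [← h1, smul_eq_mul] at h4
    exact Nat.le_of_mul_le_mul_right h4 hc0
  have : Fintype (MulAction.orbitRel.Quotient G (Set.powersetCard X (d + 2))) := Fintype.ofFinite _
  obtain ⟨V, hV, hVcard⟩ := exists_small_hitting_set
    (fun c : MulAction.orbitRel.Quotient G (Set.powersetCard X (d + 2)) => L (c.out : Finset X))
    (u : ℝ) (by exact_mod_cast hu) fun c => by exact_mod_cast hL _ c.out.2
  refine ⟨A ∪ U ∪ V, ?_, ?_⟩
  · intro T hT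
    obtain ⟨y, hyV, hy⟩ := hV ⟦⟨T, hT⟩⟧
    obtain ⟨x, hx, hyx⟩ := Finset.mem_biUnion.mp hy
    obtain ⟨-, g, hg, e⟩ := (hN _ _ _).mp hyx
    obtain ⟨g', hg'⟩ := MulAction.orbitRel_apply.mp
      (Quotient.exact (Quotient.out_eq (⟦⟨T, hT⟩⟧ :
        MulAction.orbitRel.Quotient G (Set.powersetCard X (d + 2)))))
    have hg'' : (g' : Equiv.Perm X) • T = _ := congrArg Subtype.val hg'
    refine ⟨g * g', G.mul_mem hg g'.2, ?_⟩
    rw [mul_smul, hg'']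
    refine (subset_of_eq e).trans ?_
    intro z hz
    simp only [Finset.mem_insert] at hz
    simp only [Finset.mem_union]
    rcases hz with rfl | rfl | hz <;> tauto
  · have hn1 := card_orbits_succ_le hG (by omega)
    have h0 : (A ∪ U ∪ V).card ≤ d + u + V.card := by
      have := Finset.card_union_le (A ∪ U) V
      have := Finset.card_union_le A U
      omega
    have h1 : ((A ∪ U ∪ V).card : ℝ) ≤ d + u + V.card := by exact_mod_cast h0
    have hlog : Real.log (Fintype.card
        (MulAction.orbitRel.Quotient G (Set.powersetCard X (d + 2)))) ≤
        Real.log (Fintype.card X) := by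
      have hle : (Fintype.card (MulAction.orbitRel.Quotient G (Set.powersetCard X (d + 2))) : ℝ)
          ≤ Fintype.card X := by
        rw [Nat.card_eq_fintype_card] at hn1; exact_mod_cast hn1
      rcases (Nat.cast_nonneg (α := ℝ)
        (Fintype.card (MulAction.orbitRel.Quotient G (Set.powersetCard X (d + 2))))).eq_or_lt
        with h | h
      · rw [← h, Real.log_zero]
        exact Real.log_natCast_nonneg _
      · exact Real.log_le_log h hle
    have h2 : (Fintype.card X : ℝ) / u * Real.log (Fintype.card
        (MulAction.orbitRel.Quotient G (Set.powersetCard X (d + 2)))) ≤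
        Fintype.card X / u * Real.log (Fintype.card X) := by gcongr
    linarith

theorem SimpleGraph.Connected.exists_adj_dist_add_one {V : Type*} {Γ : SimpleGraph V}
    (h : Γ.Connected) {x z : V} (hxz : x ≠ z) : ∃ y, Γ.Adj x y ∧ Γ.dist y z + 1 = Γ.dist x z := by
  obtain ⟨p, hp⟩ := h.exists_walk_length_eq_dist x z
  cases p with
  | nil => exact absurd rfl hxz
  | cons hadj q =>
    rename_i y
    refine ⟨y, hadj, ?_⟩
    have h1 := SimpleGraph.dist_le q
    have h2 := h.dist_triangle (u := x) (v := y) (w := z)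
    rw [SimpleGraph.dist_eq_one_iff_adj.mpr hadj] at h2
    rw [SimpleGraph.Walk.length_cons] at hp
    omega

theorem SimpleGraph.Connected.exists_dist_eq {V : Type*} {Γ : SimpleGraph V}
    (h : Γ.Connected) {x z : V} {t : ℕ} (ht : t ≤ Γ.dist x z) : ∃ y, Γ.dist y z = t := by
  obtain ⟨j, hj⟩ : ∃ j, Γ.dist x z = t + j := ⟨_, (Nat.add_sub_cancel' ht).symm⟩
  induction j generalizing x with
  | zero => exact ⟨x, hj⟩
  | succ j ih =>
    obtain ⟨y, -, hy⟩ := h.exists_adj_dist_add_one (x := x) (z := z) (by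
      rintro rfl; simp at hj)
    exact ih (x := y) (by omega) (by omega)

/-- The orbit of the pair `{x, y}`. -/
def pairColor {X : Type*} [DecidableEq X] (A : Subgroup (Equiv.Perm X)) (x y : X) :
    Quot fun s t : Finset X => ∃ g ∈ A, s.image (g : Equiv.Perm X) = t :=
  Quot.mk _ {x, y}

theorem pairColor_comm {X : Type*} [DecidableEq X] (A : Subgroup (Equiv.Perm X)) (x y : X) :
    pairColor A x y = pairColor A y x := by
  rw [pairColor, pairColor, Finset.pair_comm]

theorem pairColor_apply {X : Type*} [DecidableEq X] {A : Subgroup (Equiv.Perm X)}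
    {g : Equiv.Perm X} (hg : g ∈ A) (x y : X) : pairColor A (g x) (g y) = pairColor A x y :=
  (Quot.sound ⟨g, hg, by simp⟩).symm

theorem pairColor_eq_iff {X : Type*} [DecidableEq X] {A : Subgroup (Equiv.Perm X)}
    {x y x' y' : X} : pairColor A x y = pairColor A x' y' ↔
      ∃ g ∈ A, (g x = x' ∧ g y = y') ∨ (g x = y' ∧ g y = x') := by
  constructor
  · intro h
    have heq : Equivalence fun s t : Finset X => ∃ g ∈ A, s.image (g : Equiv.Perm X) = t := by
      refine ⟨fun s => ⟨1, A.one_mem, by simp⟩, ?_, ?_⟩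
      · rintro s _ ⟨g, hg, rfl⟩
        exact ⟨g⁻¹, A.inv_mem hg, by simp [Finset.image_image]⟩
      · rintro s _ _ ⟨g, hg, rfl⟩ ⟨h, hh, rfl⟩
        exact ⟨h * g, A.mul_mem hh hg, by simp [Finset.image_image]⟩
    obtain ⟨g, hg, e⟩ := heq.quot_mk_eq_iff _ _ |>.mp h
    refine ⟨g, hg, ?_⟩
    rw [Finset.image_insert, Finset.image_singleton, ← Finset.coe_inj] at e
    push_cast at e
    exact Set.pair_eq_pair_iff.mp e
  · rintro ⟨g, hg, ⟨rfl, rfl⟩ | ⟨rfl, rfl⟩⟩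
    · rw [pairColor_apply hg]
    · rw [pairColor_comm A (g y), pairColor_apply hg]

theorem eq_of_pairColor_eq {X β : Type*} [DecidableEq X] {A : Subgroup (Equiv.Perm X)}
    {F : X → X → β} (hF : ∀ g ∈ A, ∀ x y, F (g x) (g y) = F x y) (hs : ∀ x y, F x y = F y x)
    {x y x' y' : X} (h : pairColor A x y = pairColor A x' y') : F x y = F x' y' := by
  obtain ⟨g, hg, ⟨rfl, rfl⟩ | ⟨rfl, rfl⟩⟩ := pairColor_eq_iff.mp h
  · rw [hF g hg]
  · rw [hs (g y), hF g hg]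

/-- The graph whose edges are the pairs with a colour satisfying `I`. -/
def colorGraph {X : Type*} [DecidableEq X] (A : Subgroup (Equiv.Perm X))
    (I : (Quot fun s t : Finset X => ∃ g ∈ A, s.image (g : Equiv.Perm X) = t) → Prop) :
    SimpleGraph X where
  Adj x y := x ≠ y ∧ I (pairColor A x y)
  symm := ⟨fun x y h => ⟨h.1.symm, by rw [pairColor_comm]; exact h.2⟩⟩
  loopless := ⟨fun x h => h.1 rfl⟩

theorem colorGraph_adj_apply {X : Type*} [DecidableEq X] {A : Subgroup (Equiv.Perm X)}
    {I : (Quot fun s t : Finset X => ∃ g ∈ A, s.image (g : Equiv.Perm X) = t) → Prop}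
    {g : Equiv.Perm X} (hg : g ∈ A) {x y : X} :
    (colorGraph A I).Adj (g x) (g y) ↔ (colorGraph A I).Adj x y := by
  simp [colorGraph, pairColor_apply hg]

theorem colorGraph_reachable_apply {X : Type*} [DecidableEq X] {A : Subgroup (Equiv.Perm X)}
    {I : (Quot fun s t : Finset X => ∃ g ∈ A, s.image (g : Equiv.Perm X) = t) → Prop}
    {g : Equiv.Perm X} (hg : g ∈ A) {x y : X} :
    (colorGraph A I).Reachable (g x) (g y) ↔ (colorGraph A I).Reachable x y := by
  exact SimpleGraph.Iso.reachable_iff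
    (φ := (⟨g, fun {a b} => colorGraph_adj_apply hg⟩ : colorGraph A I ≃g colorGraph A I))

theorem colorGraph_dist_apply {X : Type*} [DecidableEq X] {A : Subgroup (Equiv.Perm X)}
    {I : (Quot fun s t : Finset X => ∃ g ∈ A, s.image (g : Equiv.Perm X) = t) → Prop}
    (hc : (colorGraph A I).Connected) {g : Equiv.Perm X} (hg : g ∈ A) (x y : X) :
    (colorGraph A I).dist (g x) (g y) = (colorGraph A I).dist x y := by
  have key : ∀ g ∈ A, ∀ x y, (colorGraph A I).dist (g x) (g y) ≤ (colorGraph A I).dist x y := by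
    intro g hg x y
    obtain ⟨p, hp⟩ := hc.exists_walk_length_eq_dist x y
    let φ : colorGraph A I →g colorGraph A I := ⟨g, fun {a b} h => (colorGraph_adj_apply hg).mpr h⟩
    have := SimpleGraph.dist_le (p.map φ)
    rw [SimpleGraph.Walk.length_map, hp] at this
    exact this
  refine le_antisymm (key g hg x y) ?_
  have := key g⁻¹ (A.inv_mem hg) (g x) (g y)
  simpa using this

open scoped Pointwise in
theorem colorGraph_connected {X : Type*} [DecidableEq X] {A : Subgroup (Equiv.Perm X)}
    [MulAction.IsPreprimitive A X]
    {I : (Quot fun s t : Finset X => ∃ g ∈ A, s.image (g : Equiv.Perm X) = t) → Prop}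
    {x₀ y₀ : X} (hne : x₀ ≠ y₀) (hI : I (pairColor A x₀ y₀)) : (colorGraph A I).Connected := by
  set Γ := colorGraph A I with hΓ
  let B : Set X := {y | Γ.Reachable x₀ y}
  have hg : ∀ (g : A), g • B = {y | Γ.Reachable ((g : Equiv.Perm X) x₀) y} := by
    intro g
    ext y
    rw [Set.mem_smul_set_iff_inv_smul_mem]
    have := colorGraph_reachable_apply (I := I) g.2 (x := x₀) (y := (g : Equiv.Perm X)⁻¹ y)
    rw [show (g : Equiv.Perm X) ((g : Equiv.Perm X)⁻¹ y) = y by simp] at this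
    exact this.symm
  have hB : MulAction.IsBlock A B := by
    intro g₁ g₂ hne
    rw [hg, hg] at hne ⊢
    rw [Set.disjoint_left]
    intro y h1 h2
    simp only [Set.mem_ofPred_eq] at h1 h2
    refine hne (Set.ext fun z => ?_)
    exact ⟨fun h => h2.trans (h1.symm.trans h), fun h => h1.trans (h2.symm.trans h)⟩
  rcases MulAction.IsPreprimitive.isTrivialBlock_of_isBlock hB with h | h
  · have hadj : Γ.Adj x₀ y₀ := ⟨hne, hI⟩
    exact absurd (h (SimpleGraph.Reachable.refl x₀ : x₀ ∈ B) (hadj.reachable : y₀ ∈ B)) hne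
  · have h' : ∀ y, Γ.Reachable x₀ y := fun y => by
      have : y ∈ B := h ▸ Set.mem_univ y
      exact this
    have : Nonempty X := ⟨x₀⟩
    exact ⟨fun a b => (h' a).symm.trans (h' b)⟩

/-- The points whose colours seen from `x` and `y` differ. -/
noncomputable def distinguishers {X : Type*} [Fintype X] [DecidableEq X]
    (A : Subgroup (Equiv.Perm X)) (x y : X) : Finset X := by
  classical exact Finset.univ.filter fun z => pairColor A x z ≠ pairColor A y z

theorem mem_distinguishers {X : Type*} [Fintype X] [DecidableEq X]
    {A : Subgroup (Equiv.Perm X)} {x y z : X} :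
    z ∈ distinguishers A x y ↔ pairColor A x z ≠ pairColor A y z := by
  simp [distinguishers]

theorem distinguishers_comm {X : Type*} [Fintype X] [DecidableEq X]
    (A : Subgroup (Equiv.Perm X)) (x y : X) : distinguishers A x y = distinguishers A y x := by
  ext z; rw [mem_distinguishers, mem_distinguishers, ne_comm]

theorem card_distinguishers_apply {X : Type*} [Fintype X] [DecidableEq X]
    {A : Subgroup (Equiv.Perm X)} {g : Equiv.Perm X} (hg : g ∈ A) (x y : X) :
    (distinguishers A (g x) (g y)).card = (distinguishers A x y).card := by
  symm
  refine Finset.card_bij (fun z _ => g z) ?_ (fun _ _ _ _ h => g.injective h) ?_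
  · intro z hz
    rw [mem_distinguishers] at hz ⊢
    rwa [pairColor_apply hg, pairColor_apply hg]
  · intro z hz
    refine ⟨g⁻¹ z, ?_, by simp⟩
    rw [mem_distinguishers] at hz ⊢
    rwa [← pairColor_apply hg, ← pairColor_apply hg y, show g (g⁻¹ z) = z by simp]

theorem card_distinguishers_eq {X : Type*} [Fintype X] [DecidableEq X]
    {A : Subgroup (Equiv.Perm X)} {x y x' y' : X} (h : pairColor A x y = pairColor A x' y') :
    (distinguishers A x y).card = (distinguishers A x' y').card :=
  eq_of_pairColor_eq (F := fun x y => (distinguishers A x y).card)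
    (fun _ hg => card_distinguishers_apply hg) (fun x y => by rw [distinguishers_comm]) h

theorem card_distinguishers_triangle {X : Type*} [Fintype X] [DecidableEq X]
    (A : Subgroup (Equiv.Perm X)) (x y z : X) :
    (distinguishers A x z).card ≤ (distinguishers A x y).card + (distinguishers A y z).card := by
  refine le_trans (Finset.card_le_card fun w hw => ?_) (Finset.card_union_le _ _)
  rw [Finset.mem_union, mem_distinguishers, mem_distinguishers]
  rw [mem_distinguishers] at hw
  by_contra! h
  exact hw (h.1.trans h.2)

/-- The points at colour `i` from `x`. -/
noncomputable def colorNbhd {X : Type*} [Fintype X] [DecidableEq X]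
    (A : Subgroup (Equiv.Perm X))
    (i : Quot fun s t : Finset X => ∃ g ∈ A, s.image (g : Equiv.Perm X) = t) (x : X) :
    Finset X := by
  classical exact Finset.univ.filter fun z => pairColor A x z = i

theorem mem_colorNbhd {X : Type*} [Fintype X] [DecidableEq X] {A : Subgroup (Equiv.Perm X)}
    {i : Quot fun s t : Finset X => ∃ g ∈ A, s.image (g : Equiv.Perm X) = t} {x z : X} :
    z ∈ colorNbhd A i x ↔ pairColor A x z = i := by
  simp [colorNbhd]

theorem card_colorNbhd_eq {X : Type*} [Fintype X] [DecidableEq X] {A : Subgroup (Equiv.Perm X)}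
    [MulAction.IsPretransitive A X]
    (i : Quot fun s t : Finset X => ∃ g ∈ A, s.image (g : Equiv.Perm X) = t) (x y : X) :
    (colorNbhd A i x).card = (colorNbhd A i y).card := by
  obtain ⟨⟨g, hg⟩, rfl⟩ := MulAction.exists_smul_eq A x y
  refine Finset.card_bij (fun z _ => g z) ?_ (fun _ _ _ _ h => g.injective h) ?_
  · intro z hz
    rw [mem_colorNbhd] at hz ⊢
    rw [← hz]
    exact pairColor_apply hg x z
  · intro z hz
    refine ⟨g⁻¹ z, ?_, by simp⟩
    rw [mem_colorNbhd] at hz ⊢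
    rw [← hz, ← pairColor_apply hg, show g (g⁻¹ z) = z by simp]
    rfl

theorem pairColor_self_ne {X : Type*} [DecidableEq X] {A : Subgroup (Equiv.Perm X)} {x y z : X}
    (h : x ≠ y) : pairColor A x y ≠ pairColor A z z := by
  rw [Ne, pairColor_eq_iff]
  rintro ⟨g, -, ⟨h1, h2⟩ | ⟨h1, h2⟩⟩ <;> exact h (g.injective (h1.trans h2.symm))

theorem card_sub_one_le_degree_mul {X : Type*} [Fintype X] [DecidableEq X]
    {A : Subgroup (Equiv.Perm X)} [MulAction.IsPreprimitive A X] {x₀ y₀ : X} (hne : x₀ ≠ y₀) :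
    Fintype.card X - 1 ≤ (colorNbhd A (pairColor A x₀ y₀) x₀).card *
      (distinguishers A x₀ y₀).card := by
  classical
  set i := pairColor A x₀ y₀ with hi
  set Γ := colorGraph A fun j => j = i with hΓ
  have hc : Γ.Connected := colorGraph_connected hne rfl
  have hn : 0 < Fintype.card X := Fintype.card_pos_iff.mpr ⟨x₀⟩
  -- count triples `(x, y, z)` with `x y` an edge and `z` distinguishing `x` from `y`
  have h1 : ∑ x : X, ∑ y ∈ colorNbhd A i x, (distinguishers A x y).card =
      Fintype.card X * ((colorNbhd A i x₀).card * (distinguishers A x₀ y₀).card) := by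
    rw [← smul_eq_mul (Fintype.card X), ← Finset.card_univ, ← Finset.sum_const]
    refine Finset.sum_congr rfl fun x _ => ?_
    rw [← card_colorNbhd_eq i x x₀, ← smul_eq_mul, ← Finset.sum_const]
    exact Finset.sum_congr rfl fun y hy => card_distinguishers_eq (mem_colorNbhd.mp hy)
  have h2 : Fintype.card X * (Fintype.card X - 1) ≤
      ∑ x : X, ∑ y ∈ colorNbhd A i x, (distinguishers A x y).card := by
    have h3 : ∀ z x : X, x ≠ z → ∃ y ∈ colorNbhd A i x, z ∈ distinguishers A x y := by
      intro z x hxz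
      obtain ⟨y, hxy, hy⟩ := hc.exists_adj_dist_add_one hxz
      refine ⟨y, mem_colorNbhd.mpr hxy.2, mem_distinguishers.mpr fun h => ?_⟩
      have := eq_of_pairColor_eq (F := Γ.dist) (fun g hg => colorGraph_dist_apply hc hg)
        (fun x y => SimpleGraph.dist_comm) h
      omega
    have h4 : ∀ x : X, Fintype.card X - 1 ≤
        ∑ y ∈ colorNbhd A i x, (distinguishers A x y).card := by
      intro x
      calc Fintype.card X - 1 = (Finset.univ.erase x).card := by
            rw [Finset.card_erase_of_mem (Finset.mem_univ _), Finset.card_univ]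
        _ ≤ ((colorNbhd A i x).biUnion fun y => distinguishers A x y).card := by
            refine Finset.card_le_card fun z hz => ?_
            rw [Finset.mem_biUnion]
            exact h3 z x (Finset.ne_of_mem_erase hz).symm
        _ ≤ _ := Finset.card_biUnion_le
    calc _ = ∑ x : X, (Fintype.card X - 1) := by simp
      _ ≤ _ := Finset.sum_le_sum fun x _ => h4 x
  rw [h1] at h2
  exact Nat.le_of_mul_le_mul_left h2 hn

theorem exists_card_sub_le_distinguishers {X : Type*} [Fintype X] [DecidableEq X] [Nonempty X]
    {A : Subgroup (Equiv.Perm X)} {Δ : ℕ}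
    (hΔ : ∀ x z, (colorNbhd A (pairColor A z x) z).card ≤ Δ) :
    ∃ x y, Fintype.card X - Δ ≤ (distinguishers A x y).card := by
  classical
  by_contra! hcon
  have h1 : ∑ x : X, ∑ y : X, (distinguishers A x y).card =
      ∑ z : X, ∑ x : X, (colorNbhd A (pairColor A z x) z)ᶜ.card := by
    have : ∀ x y, (distinguishers A x y).card =
        ∑ z : X, if pairColor A x z ≠ pairColor A y z then 1 else 0 := by
      intro x y
      rw [← Finset.card_filter]
      congr 1
    simp only [this]
    have h2 : ∀ z x, (colorNbhd A (pairColor A z x) z)ᶜ.card =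
        ∑ y : X, if pairColor A x z ≠ pairColor A y z then 1 else 0 := by
      intro z x
      rw [← Finset.card_filter]
      congr 1
      ext y
      simp [mem_colorNbhd, pairColor_comm A z, eq_comm]
    simp only [h2]
    rw [Finset.sum_comm' (t' := Finset.univ) (s' := fun _ => Finset.univ) (by simp)]
    calc _ = ∑ y : X, ∑ z : X, ∑ x : X, if pairColor A x z ≠ pairColor A y z then 1 else 0 :=
          Finset.sum_congr rfl fun y _ => Finset.sum_comm
      _ = ∑ z : X, ∑ y : X, ∑ x : X, if pairColor A x z ≠ pairColor A y z then 1 else 0 :=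
          Finset.sum_comm
      _ = _ := Finset.sum_congr rfl fun y _ => Finset.sum_comm
  have h2 : ∑ x : X, ∑ y : X, (distinguishers A x y).card <
      ∑ x : X, ∑ y : X, (Fintype.card X - Δ) :=
    Finset.sum_lt_sum_of_nonempty Finset.univ_nonempty fun x _ =>
      Finset.sum_lt_sum_of_nonempty Finset.univ_nonempty fun y _ => hcon x y
  have h3 : ∑ z : X, ∑ x : X, (Fintype.card X - Δ) ≤
      ∑ z : X, ∑ x : X, (colorNbhd A (pairColor A z x) z)ᶜ.card := by
    refine Finset.sum_le_sum fun z _ => Finset.sum_le_sum fun x _ => ?_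
    rw [Finset.card_compl]
    have := hΔ x z
    omega
  omega

theorem SimpleGraph.Connected.card_le_sq {V : Type*} [Fintype V] [DecidableEq V]
    {Γ : SimpleGraph V} (hc : Γ.Connected) (hdist : ∀ x y, Γ.dist x y ≤ 2) {r : ℕ}
    (N : V → Finset V)
    (hN : ∀ x y, x = y ∨ Γ.Adj x y → y ∈ N x) (hr : ∀ x, (N x).card ≤ r) :
    Fintype.card V ≤ r ^ 2 := by
  have := hc.nonempty
  obtain ⟨v⟩ := this
  have hsub : (Finset.univ : Finset V) ⊆ (N v).biUnion N := by
    intro x _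
    rw [Finset.mem_biUnion]
    by_cases hvx : v = x
    · exact ⟨v, hN _ _ (Or.inl rfl), hN _ _ (Or.inl hvx)⟩
    · obtain ⟨y, hy, hyd⟩ := hc.exists_adj_dist_add_one hvx
      have := hdist v x
      refine ⟨y, hN _ _ (Or.inr hy), hN _ _ ?_⟩
      rcases Nat.eq_zero_or_pos (Γ.dist y x) with h | h
      · exact Or.inl (hc.dist_eq_zero_iff.mp h)
      · exact Or.inr (SimpleGraph.dist_eq_one_iff_adj.mp (by omega))
  calc Fintype.card V ≤ ((N v).biUnion N).card := by
        rw [← Finset.card_univ]; exact Finset.card_le_card hsub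
    _ ≤ (N v).card * r := Finset.card_biUnion_le_card_mul _ _ _ fun x _ => hr x
    _ ≤ r * r := by gcongr; exact hr v
    _ = _ := by ring

theorem exists_sqrt_le_distinguishers {X : Type*} [Fintype X] [DecidableEq X]
    {A : Subgroup (Equiv.Perm X)} [MulAction.IsPreprimitive A X] [Nontrivial X]
    (hA : ¬ IsSetHomogeneous A 2) :
    ∃ x y, Fintype.card X ≤ (distinguishers A x y).card ^ 2 := by
  classical
  obtain ⟨a₀, b₀, hab₀⟩ := exists_pair_ne X
  obtain ⟨⟨z, w⟩, hzw, hmax⟩ := (Finset.univ.filter fun p : X × X => p.1 ≠ p.2).exists_max_image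
    (fun p => (colorNbhd A (pairColor A p.1 p.2) p.1).card) ⟨(a₀, b₀), by simpa using hab₀⟩
  simp only [Finset.mem_filter, Finset.mem_univ, true_and] at hzw hmax
  set j := pairColor A z w with hj
  set Δ := (colorNbhd A j z).card with hΔdef
  have hΔ : ∀ x v, (colorNbhd A (pairColor A v x) v).card ≤ Δ := by
    intro x v
    by_cases hvx : v = x
    · subst hvx
      have h1 : colorNbhd A (pairColor A v v) v ⊆ {v} := by
        intro u hu
        rw [mem_colorNbhd] at hu
        by_contra h
        rw [Finset.mem_singleton] at h
        exact pairColor_self_ne (fun e => h e.symm) hu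
      have h2 : 0 < Δ := Finset.card_pos.mpr ⟨w, mem_colorNbhd.mpr rfl⟩
      have := Finset.card_le_card h1
      rw [Finset.card_singleton] at this
      omega
    · exact hmax (v, x) hvx
  obtain ⟨x, y, hxy⟩ := exists_card_sub_le_distinguishers hΔ
  refine ⟨x, y, le_trans ?_ (Nat.pow_le_pow_left hxy 2)⟩
  obtain ⟨a, b, hab, habj⟩ : ∃ a b, a ≠ b ∧ pairColor A a b ≠ j := by
    by_contra! hcon
    refine hA fun S T hS hT => ?_
    obtain ⟨s, s', hs, rfl⟩ := Finset.card_eq_two.mp hS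
    obtain ⟨t, t', ht, rfl⟩ := Finset.card_eq_two.mp hT
    obtain ⟨g, hg, h⟩ := pairColor_eq_iff.mp ((hcon s s' hs).trans (hcon t t' ht).symm)
    refine ⟨g, hg, ?_⟩
    rw [Finset.smul_finset_def, Finset.image_insert, Finset.image_singleton]
    simp only [Equiv.Perm.smul_def]
    rcases h with ⟨h1, h2⟩ | ⟨h1, h2⟩
    · rw [h1, h2]
    · rw [h1, h2, Finset.pair_comm]
  set Γ := colorGraph A fun c => c ≠ j with hΓ
  have hc : Γ.Connected := colorGraph_connected hab habj
  have hnadj : ∀ u v, u ≠ v → ¬ Γ.Adj u v → pairColor A u v = j := by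
    intro u v huv h
    by_contra h2
    exact h ⟨huv, h2⟩
  refine hc.card_le_sq ?_ (fun u => (colorNbhd A j u)ᶜ) ?_ ?_
  · intro u v
    by_contra! hcon
    have huv : u ≠ v := by rintro rfl; simp at hcon
    obtain ⟨t, ht⟩ := hc.exists_dist_eq (x := u) (z := v) (t := 2) hcon.le
    have htv : t ≠ v := by rintro rfl; simp at ht
    have e1 := hnadj t v htv fun h => by rw [SimpleGraph.dist_eq_one_iff_adj.mpr h] at ht; omega
    have e2 := hnadj u v huv fun h => by rw [SimpleGraph.dist_eq_one_iff_adj.mpr h] at hcon; omega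
    have := eq_of_pairColor_eq (F := Γ.dist) (fun g hg => colorGraph_dist_apply hc hg)
        (fun x y => SimpleGraph.dist_comm) (e1.trans e2.symm)
    omega
  · intro u v h
    rw [Finset.mem_compl, mem_colorNbhd]
    rcases h with rfl | h
    · exact (pairColor_self_ne hzw).symm
    · exact h.2
  · intro u
    rw [Finset.card_compl, card_colorNbhd_eq j u z]

/-- In a primitive group that is not 2-homogeneous any two points are distinguished by many
points. -/
theorem card_le_four_mul_distinguishers_sq {X : Type*} [Fintype X] [DecidableEq X]
    {A : Subgroup (Equiv.Perm X)} [MulAction.IsPreprimitive A X]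
    (hA : ¬ IsSetHomogeneous A 2) {x₀ y₀ : X} (hne : x₀ ≠ y₀) :
    Fintype.card X ≤ 4 * (distinguishers A x₀ y₀).card ^ 2 := by
  classical
  have : Nontrivial X := ⟨x₀, y₀, hne⟩
  have hn : 1 < Fintype.card X := Fintype.one_lt_card
  set i := pairColor A x₀ y₀ with hi
  set D := (distinguishers A x₀ y₀).card with hD
  set Γ := colorGraph A fun j => j = i with hΓ
  have hc : Γ.Connected := colorGraph_connected hne rfl
  have hadj : ∀ u v, Γ.Adj u v → (distinguishers A u v).card = D := fun u v h =>
    card_distinguishers_eq h.2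
  by_cases hdiam : ∀ u v, Γ.dist u v ≤ 2
  · obtain ⟨x, y, hxy⟩ := exists_sqrt_le_distinguishers hA
    have h2 : (distinguishers A x y).card ≤ 2 * D := by
      by_cases hxy' : x = y
      · subst hxy'
        have : distinguishers A x x = ∅ := by ext z; simp [mem_distinguishers]
        simp [this]
      · obtain ⟨t, ht, htd⟩ := hc.exists_adj_dist_add_one hxy'
        have h3 := card_distinguishers_triangle A x t y
        rw [hadj x t ht] at h3
        have h4 := hdiam x y
        by_cases hty : t = y
        · rw [← hty, hadj x t ht]; omega
        · have := hc.pos_dist_of_ne hty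
          rw [hadj t y (SimpleGraph.dist_eq_one_iff_adj.mp (by omega))] at h3
          omega
    calc _ ≤ _ := hxy
      _ ≤ (2 * D) ^ 2 := Nat.pow_le_pow_left h2 2
      _ = _ := by ring
  · push Not at hdiam
    obtain ⟨u, v, huv⟩ := hdiam
    obtain ⟨x, hx⟩ := hc.exists_dist_eq (x := u) (z := v) (t := 3) huv
    have hxv : x ≠ v := by rintro rfl; simp at hx
    obtain ⟨s, hs, hsd⟩ := hc.exists_adj_dist_add_one hxv
    have hsv : s ≠ v := by rintro rfl; simp at hsd; omega
    obtain ⟨t, ht, htd⟩ := hc.exists_adj_dist_add_one hsv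
    have htv : Γ.Adj t v := SimpleGraph.dist_eq_one_iff_adj.mp (by omega)
    have h1 : (distinguishers A x v).card ≤ 3 * D := by
      have e1 := card_distinguishers_triangle A x s v
      have e2 := card_distinguishers_triangle A s t v
      rw [hadj x s hs] at e1
      rw [hadj s t ht, hadj t v htv] at e2
      omega
    have hdisj : Disjoint (colorNbhd A i x) (colorNbhd A i v) := by
      rw [Finset.disjoint_left]
      intro w hw hw'
      rw [mem_colorNbhd] at hw hw'
      have hself : ∀ p q : X, pairColor A p q = i → p ≠ q := by
        rintro p _ h rfl
        exact pairColor_self_ne hne h.symm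
      have a1 : Γ.Adj x w := ⟨hself _ _ hw, hw⟩
      have a2 : Γ.Adj v w := ⟨hself _ _ hw', hw'⟩
      have := hc.dist_triangle (u := x) (v := w) (w := v)
      rw [SimpleGraph.dist_eq_one_iff_adj.mpr a1,
        SimpleGraph.dist_eq_one_iff_adj.mpr a2.symm] at this
      omega
    have h2 : 2 * (colorNbhd A i x₀).card ≤ (distinguishers A x v).card := by
      calc _ = (colorNbhd A i x ∪ colorNbhd A i v).card := by
            rw [Finset.card_union_of_disjoint hdisj, card_colorNbhd_eq i x x₀,
              card_colorNbhd_eq i v x₀]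
            ring
        _ ≤ _ := by
            refine Finset.card_le_card fun w hw => ?_
            rw [mem_distinguishers]
            intro h
            rw [Finset.disjoint_left] at hdisj
            rcases Finset.mem_union.mp hw with hw | hw
            · refine hdisj hw ?_
              rw [mem_colorNbhd] at hw ⊢
              rw [← h, hw]
            · refine hdisj ?_ hw
              rw [mem_colorNbhd] at hw ⊢
              rw [h, hw]
    have h3 := card_sub_one_le_degree_mul (A := A) hne
    rw [← hi, ← hD] at h3
    have h4 : 2 * (Fintype.card X - 1) ≤ 3 * D ^ 2 := by nlinarith
    nlinarith [Nat.zero_le (D ^ 2), Nat.sub_add_cancel hn.le]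

/-- A primitive group that is not 2-homogeneous has a base of size `O(√n log n)`. -/
theorem exists_small_base_of_not_isSetHomogeneous_two {X : Type*} [Fintype X] [DecidableEq X]
    {A : Subgroup (Equiv.Perm X)} [MulAction.IsPreprimitive A X] [Nonempty X]
    (hA : ¬ IsSetHomogeneous A 2) :
    ∃ S : Finset X, IsPointBase A S ∧
      (S.card : ℝ) ≤ 4 * √(Fintype.card X) * Real.log (Fintype.card X) + 1 := by
  classical
  have hX : (0 : ℝ) < Fintype.card X := by exact_mod_cast Fintype.card_pos
  set r := √(Fintype.card X : ℝ) with hr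
  have hr0 : 0 < r := Real.sqrt_pos.mpr hX
  have hrr : r * r = Fintype.card X := Real.mul_self_sqrt hX.le
  obtain ⟨S, hS, hcard⟩ := exists_small_hitting_set
    (fun p : {p : X × X // p.1 ≠ p.2} => distinguishers A p.1.1 p.1.2) (r / 2) (by positivity)
    (fun p => by
      have h1 : (Fintype.card X : ℝ) ≤ 4 * (distinguishers A p.1.1 p.1.2).card ^ 2 := by
        exact_mod_cast card_le_four_mul_distinguishers_sq hA p.2
      refine le_of_sq_le_sq ?_ (by positivity)
      nlinarith)
  refine ⟨S, ?_, ?_⟩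
  · intro σ hσ hfix
    ext x
    by_contra hne
    obtain ⟨z, hzS, hz⟩ := hS ⟨(σ x, x), hne⟩
    refine mem_distinguishers.mp hz ?_
    simp only
    conv_lhs => rw [← hfix z hzS]
    exact pairColor_apply hσ x z
  · refine hcard.trans ?_
    have h1 : Real.log (Fintype.card {p : X × X // p.1 ≠ p.2}) ≤ 2 * Real.log (Fintype.card X) := by
      have h2 : (Fintype.card {p : X × X // p.1 ≠ p.2} : ℝ) ≤ (Fintype.card X : ℝ) ^ 2 := by
        have := Fintype.card_subtype_le fun p : X × X => p.1 ≠ p.2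
        rw [Fintype.card_prod, ← sq] at this
        exact_mod_cast this
      rcases (Nat.cast_nonneg (α := ℝ) (Fintype.card {p : X × X // p.1 ≠ p.2})).eq_or_lt with h | h
      · rw [← h, Real.log_zero]
        have := Real.log_natCast_nonneg (Fintype.card X)
        positivity
      · calc _ ≤ Real.log ((Fintype.card X : ℝ) ^ 2) := Real.log_le_log h h2
          _ = _ := by rw [Real.log_pow]; norm_num
    have h3 : (Fintype.card X : ℝ) / (r / 2) = 2 * r := by rw [← hrr]; field_simp
    rw [h3]
    nlinarith

open scoped Pointwise in
/-- Averaging over a group that is transitive on `m`-element sets. -/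
theorem IsSetHomogeneous.choose_mul_sum_smul {X : Type*} [Fintype X] [DecidableEq X]
    {A : Subgroup (Equiv.Perm X)} [Fintype A] {m : ℕ} (hA : IsSetHomogeneous A m)
    (f : Finset X → ℝ) {T : Finset X} (hT : T.card = m) :
    ((Fintype.card X).choose m : ℝ) * ∑ g : A, f ((g : Equiv.Perm X) • T) =
      Fintype.card A * ∑ Y ∈ Finset.univ.powersetCard m, f Y := by
  classical
  have : MulAction.IsPretransitive A (Set.powersetCard X m) := ⟨fun P Q => by
    obtain ⟨g, hg, e⟩ := hA P Q P.2 Q.2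
    exact ⟨⟨g, hg⟩, Subtype.ext e⟩⟩
  have h := card_mul_sum_smul (G := A) (Ω := Set.powersetCard X m) (fun Y => f Y) ⟨T, hT⟩
  have e1 : Fintype.card (Set.powersetCard X m) = (Fintype.card X).choose m := by
    rw [← Nat.card_eq_fintype_card, Set.powersetCard.card, Nat.card_eq_fintype_card]
  have e2 : ∑ Y : Set.powersetCard X m, f Y = ∑ Y ∈ Finset.univ.powersetCard m, f Y := by
    symm
    refine Finset.sum_bij' (fun Y hY => ⟨Y, (Finset.mem_powersetCard.mp hY).2⟩)
      (fun Y _ => Y.1) ?_ ?_ ?_ ?_ ?_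
    · simp
    · intro Y _
      exact Finset.mem_powersetCard.mpr ⟨Finset.subset_univ _, Y.2⟩
    · simp
    · simp
    · simp
  rw [e1, e2] at h
  exact h

theorem card_support_commutator_le {X : Type*} [Fintype X] [DecidableEq X]
    (x y : Equiv.Perm X) :
    (x * y * x⁻¹ * y⁻¹).support.card ≤ 3 * (x.support ∩ y.support).card := by
  set O := x.support ∩ y.support with hO
  have hsub : (x * y * x⁻¹ * y⁻¹).support ⊆ O ∪ O.image x ∪ O.image y := by
    intro z hz
    by_contra hcon
    simp only [Finset.mem_union, not_or] at hcon
    obtain ⟨⟨h1, h2⟩, h3⟩ := hcon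
    have h2' : x⁻¹ z ∉ O := fun h => h2 (Finset.mem_image.mpr ⟨_, h, by simp⟩)
    have h3' : y⁻¹ z ∉ O := fun h => h3 (Finset.mem_image.mpr ⟨_, h, by simp⟩)
    simp only [hO, Finset.mem_inter, Equiv.Perm.mem_support, not_and_or, not_not] at h1 h2' h3'
    rw [Equiv.Perm.mem_support] at hz
    apply hz
    simp only [Equiv.Perm.mul_apply]
    have hinv : ∀ (p : Equiv.Perm X) w, p w = w ↔ p⁻¹ w = w := fun p w =>
      ⟨fun h => by rw [Equiv.Perm.inv_eq_iff_eq, h], fun h => by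
        rw [Equiv.Perm.inv_eq_iff_eq] at h; exact h.symm⟩
    have hxx : x (x⁻¹ z) = x⁻¹ z ↔ x z = z := by
      rw [hinv x z]; simp [eq_comm]
    have hyy : y (y⁻¹ z) = y⁻¹ z ↔ y z = z := by
      rw [hinv y z]; simp [eq_comm]
    by_cases hx : x z = z
    · by_cases hy : y z = z
      · rw [(hinv y z).1 hy, (hinv x z).1 hx, hy, hx]
      · have h4 : x (y⁻¹ z) = y⁻¹ z := h3'.resolve_right fun h => hy (hyy.1 h)
        rw [(hinv x _).1 h4, show y (y⁻¹ z) = z by simp, hx]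
    · have hy : y z = z := h1.resolve_left hx
      have h4 : y (x⁻¹ z) = x⁻¹ z := h2'.resolve_left fun h => hx (hxx.1 h)
      rw [(hinv y z).1 hy, h4, show x (x⁻¹ z) = z by simp]
  have h1 := Finset.card_le_card hsub
  have h2 := Finset.card_union_le (O ∪ O.image x) (O.image y)
  have h3 := Finset.card_union_le O (O.image x)
  have h4 : (O.image x).card ≤ O.card := Finset.card_image_le
  have h5 : (O.image y).card ≤ O.card := Finset.card_image_le
  omega

theorem two_le_card_support_inter {X : Type*} [Fintype X] [DecidableEq X]
    {A : Subgroup (Equiv.Perm X)} (hp : MulAction.IsPreprimitive A X)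
    (hA : ¬ alternatingGroup X ≤ A) {x y : Equiv.Perm X} (hx : x ∈ A) (hy : y ∈ A)
    (hxy : x * y ≠ y * x) (hmin : ∀ σ ∈ A, σ ≠ 1 → x.support.card ≤ σ.support.card) :
    2 ≤ (x.support ∩ y.support).card ∧
      x.support.card ≤ 3 * (x.support ∩ y.support).card := by
  set c := x * y * x⁻¹ * y⁻¹ with hc
  have hcA : c ∈ A := A.mul_mem (A.mul_mem (A.mul_mem hx hy) (A.inv_mem hx)) (A.inv_mem hy)
  have hc1 : c ≠ 1 := by
    intro h
    apply hxy
    rw [hc, mul_inv_eq_one, mul_inv_eq_iff_eq_mul] at h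
    exact h
  have hle : c.support.card ≤ 3 * (x.support ∩ y.support).card := card_support_commutator_le x y
  have hm := hmin c hcA hc1
  refine ⟨?_, hm.trans hle⟩
  by_contra hcon
  have h3 : c.support.card ≤ 3 := by omega
  have h0 : c.support.card ≠ 0 := by simpa using hc1
  have h1 : c.support.card ≠ 1 := Equiv.Perm.card_support_ne_one c
  have h2 : c.support.card ≠ 2 := by
    intro h
    have := (Equiv.Perm.card_support_eq_two.mp h).sign_eq
    have h' : Equiv.Perm.sign c = 1 := by
      simp [hc, mul_comm, mul_left_comm]
    rw [h'] at this
    exact absurd this (by decide)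
  have h3' : c.IsThreeCycle := card_support_eq_three_iff.mp (by omega)
  exact hA (Equiv.Perm.alternatingGroup_le_of_isPreprimitive_of_isThreeCycle_mem hp h3' hcA)

open scoped Pointwise in
/-- A lower bound for the minimal degree of a primitive `2`-homogeneous group. -/
theorem card_le_ten_mul_card_support {X : Type*} [Fintype X] [DecidableEq X]
    {A : Subgroup (Equiv.Perm X)} (hp : MulAction.IsPreprimitive A X)
    (hA : ¬ alternatingGroup X ≤ A) (h2 : IsSetHomogeneous A 2) {σ : Equiv.Perm X} (hσ : σ ∈ A)
    (hσ1 : σ ≠ 1) : Fintype.card X ≤ 10 * σ.support.card := by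
  classical
  obtain ⟨x, hxm, hmin⟩ := Finset.exists_min_image
    (Finset.univ.filter fun τ : Equiv.Perm X => τ ∈ A ∧ τ ≠ 1) (fun τ => τ.support.card)
    ⟨σ, by simp [hσ, hσ1]⟩
  simp only [Finset.mem_filter, Finset.mem_univ, true_and] at hxm hmin
  obtain ⟨hxA, hx1⟩ := hxm
  refine le_trans ?_ (Nat.mul_le_mul_left 10 (hmin σ ⟨hσ, hσ1⟩))
  set n := Fintype.card X with hn
  set m := x.support.card with hm
  have hm0 : 0 < m := by
    rw [hm, Finset.card_pos, Finset.nonempty_iff_ne_empty]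
    simpa using hx1
  have hmn : m ≤ n := Finset.card_le_univ _
  obtain ⟨a, ha⟩ : ∃ a, x a ≠ a := by
    by_contra! h
    exact hx1 (Equiv.ext h)
  set f : Finset X → ℝ := fun P => if (P ∩ x.support).card = 1 then 1 else 0 with hf
  have hab : ({a, x a} : Finset X).card = 2 := Finset.card_pair ha.symm
  have hsum2 := h2.choose_mul_sum_smul f hab
  have hlow : ((m * (n - m) : ℕ) : ℝ) ≤ ∑ Y ∈ Finset.univ.powersetCard 2, f Y := by
    rw [hf]
    simp only
    rw [← Finset.sum_filter, Finset.sum_const, nsmul_eq_mul, mul_one]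
    have : m * (n - m) = (x.support ×ˢ x.supportᶜ).card := by
      rw [Finset.card_product, Finset.card_compl]
    rw [this]
    norm_cast
    refine Finset.card_le_card_of_injOn (fun p => {p.1, p.2}) ?_ ?_
    · rintro ⟨u, v⟩ huv
      simp only [Finset.coe_product, Set.mem_prod, Finset.mem_coe, Finset.mem_compl] at huv
      have huv' : u ≠ v := fun h => huv.2 (h ▸ huv.1)
      simp only [Finset.coe_filter, Finset.mem_powersetCard, Finset.subset_univ, true_and]
      refine ⟨Finset.card_pair huv', ?_⟩
      rw [Finset.insert_inter_of_mem huv.1, Finset.singleton_inter_of_notMem huv.2]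
      simp
    · rintro ⟨u, v⟩ huv ⟨u', v'⟩ huv' h
      simp only [Finset.coe_product, Set.mem_prod, Finset.mem_coe, Finset.mem_compl] at huv huv'
      simp only at h
      have h1 : u ∈ ({u', v'} : Finset X) := h ▸ (by simp)
      have h2 : v ∈ ({u', v'} : Finset X) := h ▸ (by simp)
      simp only [Finset.mem_insert, Finset.mem_singleton] at h1 h2
      have e1 : u = u' := h1.resolve_right fun h => huv'.2 (h ▸ huv.1)
      have e2 : v = v' := h2.resolve_left fun h => huv.2 (h ▸ huv'.1)
      rw [e1, e2]
  set c : Finset X → ℝ := fun P => if P ⊆ x.support then 1 else 0 with hc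
  have hcsum : ∑ Y ∈ Finset.univ.powersetCard 2, c Y = m.choose 2 := by
    rw [hc]
    simp only
    rw [← Finset.sum_filter, Finset.sum_const, nsmul_eq_mul, mul_one]
    rw [hm, ← Finset.card_powersetCard]
    congr 2
    ext P
    simp [Finset.mem_powersetCard, and_comm]
  have hsum1 : (n.choose 2 : ℝ) * ∑ g : A, ∑ P ∈ x.support.powersetCard 2,
      c ((g : Equiv.Perm X) • P) = Fintype.card A * (m.choose 2 * m.choose 2) := by
    rw [Finset.sum_comm, Finset.mul_sum, Finset.sum_congr rfl fun P hP =>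
      h2.choose_mul_sum_smul c (Finset.mem_powersetCard.mp hP).2]
    rw [Finset.sum_const, hcsum, Finset.card_powersetCard, nsmul_eq_mul]
    ring
  have hpt : ∀ g : A, f ((g : Equiv.Perm X) • {a, x a}) * ((m : ℝ) ^ 2 / 36) ≤
      ∑ P ∈ x.support.powersetCard 2, c ((g : Equiv.Perm X) • P) := by
    intro g
    have hnn : 0 ≤ ∑ P ∈ x.support.powersetCard 2, c ((g : Equiv.Perm X) • P) :=
      Finset.sum_nonneg fun P _ => by rw [hc]; simp only; split_ifs <;> norm_num
    by_cases hfg : (((g : Equiv.Perm X) • ({a, x a} : Finset X)) ∩ x.support).card = 1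
    swap
    · rw [hf]; simp only [hfg, if_false, zero_mul]; exact hnn
    rw [hf]
    simp only [hfg, if_true, one_mul]
    set y : Equiv.Perm X := (g : Equiv.Perm X)⁻¹ * x * g with hy
    have hysupp : ∀ z, z ∈ y.support ↔ (g : Equiv.Perm X) z ∈ x.support := by
      intro z
      rw [Equiv.Perm.mem_support, Equiv.Perm.mem_support, hy]
      simp only [Equiv.Perm.mul_apply, ne_eq]
      rw [Equiv.Perm.inv_eq_iff_eq]
    have hyA : y ∈ A := A.mul_mem (A.mul_mem (A.inv_mem g.2) hxA) g.2
    have hxy : x * y ≠ y * x := by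
      intro hcomm
      have h1 : a ∈ y.support ↔ x a ∈ y.support := by
        rw [Equiv.Perm.mem_support, Equiv.Perm.mem_support]
        have : y (x a) = x (y a) := by
          rw [← Equiv.Perm.mul_apply, ← hcomm, Equiv.Perm.mul_apply]
        rw [this, ne_eq, ne_eq, x.injective.eq_iff]
      rw [hysupp, hysupp] at h1
      rw [Finset.smul_finset_insert, Finset.smul_finset_singleton] at hfg
      simp only [Equiv.Perm.smul_def] at hfg
      have hne : (g : Equiv.Perm X) a ≠ (g : Equiv.Perm X) (x a) := fun h =>
        ha ((g : Equiv.Perm X).injective h).symm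
      by_cases hga : (g : Equiv.Perm X) a ∈ x.support
      · rw [Finset.insert_inter_of_mem hga, Finset.singleton_inter_of_mem (h1.1 hga),
          Finset.card_pair hne] at hfg
        omega
      · rw [Finset.insert_inter_of_notMem hga, Finset.singleton_inter_of_notMem fun h =>
          hga (h1.2 h)] at hfg
        simp at hfg
    obtain ⟨hO2, hO3⟩ := two_le_card_support_inter hp hA hxA hyA hxy fun τ h h' => hmin τ ⟨h, h'⟩
    set O := (x.support ∩ y.support).card with hO
    have hcount : ∑ P ∈ x.support.powersetCard 2, c ((g : Equiv.Perm X) • P) = O.choose 2 := by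
      rw [hc]
      simp only
      rw [← Finset.sum_filter, Finset.sum_const, nsmul_eq_mul, mul_one, hO,
        ← Finset.card_powersetCard]
      congr 2
      ext P
      simp only [Finset.mem_filter, Finset.mem_powersetCard, Finset.subset_inter_iff]
      have : (g : Equiv.Perm X) • P ⊆ x.support ↔ P ⊆ y.support := by
        constructor
        · intro h z hz
          exact (hysupp z).2 (h (Finset.smul_mem_smul_finset hz))
        · intro h z hz
          obtain ⟨w, hw, rfl⟩ := Finset.mem_smul_finset.mp hz
          exact (hysupp w).1 (h hw)
      rw [this]
      tauto
    rw [hcount, Nat.cast_choose_two]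
    have r2 : (2 : ℝ) ≤ O := by exact_mod_cast hO2
    have r3 : (m : ℝ) ≤ 3 * O := by exact_mod_cast hO3
    have r0 : (0 : ℝ) ≤ m := Nat.cast_nonneg _
    nlinarith
  have hA0 : (0 : ℝ) < Fintype.card A := by exact_mod_cast Fintype.card_pos
  have hmain : (Fintype.card A : ℝ) * ((m * (n - m) : ℕ) * ((m : ℝ) ^ 2 / 36)) ≤
      Fintype.card A * (m.choose 2 * m.choose 2) := by
    calc (Fintype.card A : ℝ) * ((m * (n - m) : ℕ) * ((m : ℝ) ^ 2 / 36))
        ≤ Fintype.card A * ((∑ Y ∈ Finset.univ.powersetCard 2, f Y) * ((m : ℝ) ^ 2 / 36)) := by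
          gcongr
      _ = (n.choose 2 : ℝ) * ∑ g : A, f ((g : Equiv.Perm X) • {a, x a}) * ((m : ℝ) ^ 2 / 36) := by
          rw [← Finset.sum_mul, ← mul_assoc, ← mul_assoc, hsum2]
      _ ≤ _ := mul_le_mul_of_nonneg_left (Finset.sum_le_sum fun g _ => hpt g) (Nat.cast_nonneg _)
      _ = _ := hsum1
  have h3 := le_of_mul_le_mul_left hmain hA0
  rw [Nat.cast_choose_two, Nat.cast_mul, Nat.cast_sub hmn] at h3
  have hm0' : (1 : ℝ) ≤ m := by exact_mod_cast hm0
  have h4 : (m : ℝ) ^ 3 * (n - m) ≤ m ^ 3 * (9 * m) := by nlinarith [sq_nonneg (m : ℝ)]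
  have h5 := le_of_mul_le_mul_left h4 (by positivity)
  have : (n : ℝ) ≤ 10 * m := by linarith
  exact_mod_cast this

theorem card_primes_dvd_lt {r P u t n : ℕ} {p : Fin r → ℕ} (hp : ∀ i, (p i).Prime)
    (hinj : Function.Injective p) (hP : ∀ i, P ≤ p i) (hPu : n < P ^ u) (ht : 0 < t)
    (htn : t ≤ n) : (Finset.univ.filter fun i => p i ∣ t).card < u := by
  by_contra! hcon
  set I := Finset.univ.filter fun i => p i ∣ t with hI
  have hP0 : 0 < P := by
    rcases Nat.eq_zero_or_pos P with rfl | h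
    · rcases Nat.eq_zero_or_pos u with rfl | hu
      · simp at hPu; omega
      · rw [zero_pow hu.ne'] at hPu; omega
    · exact h
  have h1 : ∏ i ∈ I, p i ∣ t := by
    rw [← Finset.prod_image (f := fun q => q) (g := p) fun a _ b _ h => hinj h]
    refine Finset.prod_primes_dvd t ?_ ?_
    · intro q hq
      obtain ⟨i, -, rfl⟩ := Finset.mem_image.mp hq
      exact (hp i).prime
    · intro q hq
      obtain ⟨i, hi, rfl⟩ := Finset.mem_image.mp hq
      exact (Finset.mem_filter.mp hi).2
  have h2 : P ^ I.card ≤ ∏ i ∈ I, p i := by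
    rw [← Finset.prod_const]
    exact Finset.prod_le_prod' fun i _ => hP i
  have h3 := Nat.le_of_dvd ht h1
  have h4 : P ^ u ≤ P ^ I.card := Nat.pow_le_pow_right hP0 hcon
  omega

/-- A permutation acting as long cycles of many distinct prime lengths has a power of small
support. -/
theorem exists_pow_small_support {X : Type*} [Fintype X] [DecidableEq X] {r P u : ℕ}
    {p : Fin r → ℕ} (hp : ∀ i, (p i).Prime) (hinj : Function.Injective p)
    (hP : ∀ i, P ≤ p i) (hPu : Fintype.card X < P ^ u) (hr : 10 * u ≤ r) (hX : 0 < Fintype.card X)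
    {α : (Σ i, ZMod (p i)) → X} (hα : Function.Injective α) {j : ℕ} (hj : ∀ i, ¬ p i ∣ j)
    {a : Equiv.Perm X} (ha : ∀ i (z : ZMod (p i)), a (α ⟨i, z⟩) = α ⟨i, z + j⟩) :
    ∃ M : ℕ, a ^ M ≠ 1 ∧ 10 * (a ^ M).support.card < Fintype.card X := by
  classical
  set N := orderOf a with hN
  have hN0 : N ≠ 0 := (orderOf_pos a).ne'
  let M : Fin r → ℕ := fun i => ordCompl[p i] N
  have hpM : ∀ i, ¬ p i ∣ M i := fun i => Nat.not_dvd_ordCompl (hp i) hN0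
  have hne : ∀ i, a ^ M i ≠ 1 := by
    intro i h
    have hpow : ∀ k : ℕ, (a ^ k) (α ⟨i, 0⟩) = α ⟨i, (k * j : ℕ)⟩ := by
      intro k
      induction k with
      | zero => simp
      | succ k ih =>
        rw [pow_succ', Equiv.Perm.mul_apply, ih, ha]
        congr 2
        push_cast
        ring
    have h1 := hpow (M i)
    rw [h, Equiv.Perm.one_apply] at h1
    have h2 := hα h1
    simp only [Sigma.mk.injEq, heq_eq_eq, true_and] at h2
    have h3 := (ZMod.natCast_eq_zero_iff (M i * j) (p i)).mp h2.symm
    rcases (hp i).dvd_mul.mp h3 with h4 | h4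
    · exact hpM i h4
    · exact hj i h4
  have hsupp : ∀ i ω, ω ∈ (a ^ M i).support → p i ∣ Function.minimalPeriod a ω := by
    intro i ω hω
    by_contra hcon
    rw [Equiv.Perm.mem_support] at hω
    apply hω
    have hdvd : Function.minimalPeriod a ω ∣ N := by
      apply Function.IsPeriodicPt.minimalPeriod_dvd
      rw [Function.IsPeriodicPt, Function.IsFixedPt, Equiv.Perm.iterate_eq_pow, hN,
        pow_orderOf_eq_one, Equiv.Perm.one_apply]
    have hcop : Nat.Coprime (Function.minimalPeriod a ω) (p i ^ N.factorization (p i)) :=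
      Nat.Coprime.pow_right _ ((Nat.Prime.coprime_iff_not_dvd (hp i)).mpr hcon).symm
    have h1 : Function.minimalPeriod a ω ∣ M i := by
      rw [← Nat.ordProj_mul_ordCompl_eq_self N (p i)] at hdvd
      exact hcop.dvd_of_dvd_mul_left hdvd
    have h2 := Function.isPeriodicPt_iff_minimalPeriod_dvd.mpr h1
    rwa [Function.IsPeriodicPt, Function.IsFixedPt, Equiv.Perm.iterate_eq_pow] at h2
  have hper : ∀ ω, 0 < Function.minimalPeriod a ω ∧
      Function.minimalPeriod a ω ≤ Fintype.card X := by
    intro ω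
    have h0 : ω ∈ Function.periodicPts a :=
      ⟨N, orderOf_pos a, by
        rw [Function.IsPeriodicPt, Function.IsFixedPt, Equiv.Perm.iterate_eq_pow, hN,
          pow_orderOf_eq_one, Equiv.Perm.one_apply]⟩
    refine ⟨Function.minimalPeriod_pos_of_mem_periodicPts h0, ?_⟩
    have h1 : Function.Injective fun k : Fin (Function.minimalPeriod a ω) => a^[k] ω := by
      intro k l hkl
      exact Fin.ext ((Function.iterate_injOn_Iio_minimalPeriod (f := a) (x := ω)) k.2 l.2 hkl)
    simpa using Fintype.card_le_of_injective _ h1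
  have hu : 0 < u := by
    have ω : X := (Fintype.card_pos_iff.mp hX).some
    exact lt_of_le_of_lt (Nat.zero_le _)
      (card_primes_dvd_lt hp hinj hP hPu (hper ω).1 (hper ω).2)
  by_contra! hcon
  have h1 : ∑ i, (a ^ M i).support.card ≤ (u - 1) * Fintype.card X := by
    calc ∑ i, (a ^ M i).support.card
        = ∑ i, ∑ ω : X, if ω ∈ (a ^ M i).support then 1 else 0 :=
          Finset.sum_congr rfl fun i _ => by
            rw [Finset.sum_ite_mem, Finset.univ_inter, Finset.sum_const, smul_eq_mul, mul_one]
      _ = ∑ ω : X, ∑ i, if ω ∈ (a ^ M i).support then 1 else 0 := Finset.sum_comm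
      _ ≤ ∑ ω : X, (u - 1) := by
          refine Finset.sum_le_sum fun ω _ => ?_
          rw [← Finset.card_filter]
          have h2 := card_primes_dvd_lt hp hinj hP hPu (hper ω).1 (hper ω).2
          have h3 : (Finset.univ.filter fun i => ω ∈ (a ^ M i).support).card ≤
              (Finset.univ.filter fun i => p i ∣ Function.minimalPeriod a ω).card :=
            Finset.card_le_card fun i hi => by
              simp only [Finset.mem_filter, Finset.mem_univ, true_and] at hi ⊢
              exact hsupp i ω hi
          omega
      _ = _ := by simp [mul_comm]
  have h2 : ∑ i : Fin r, Fintype.card X ≤ ∑ i, 10 * (a ^ M i).support.card :=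
    Finset.sum_le_sum fun i _ => hcon (M i) (hne i)
  rw [← Finset.mul_sum, Finset.sum_const, Finset.card_univ, Fintype.card_fin, smul_eq_mul] at h2
  have h3 : 10 * u * Fintype.card X ≤ 10 * ((u - 1) * Fintype.card X) :=
    (Nat.mul_le_mul_right _ hr).trans (h2.trans (Nat.mul_le_mul_left 10 h1))
  obtain ⟨v, rfl⟩ := Nat.exists_eq_add_of_lt hu
  simp at h3
  nlinarith

/-- The pointwise stabilizer of a set of points. -/
def pointStabilizer {X : Type*} (A : Subgroup (Equiv.Perm X)) (S : Finset X) :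
    Subgroup (Equiv.Perm X) where
  carrier := {σ | σ ∈ A ∧ ∀ x ∈ S, σ x = x}
  one_mem' := ⟨A.one_mem, fun _ _ => rfl⟩
  mul_mem' := fun {a b} ha hb => ⟨A.mul_mem ha.1 hb.1, fun x hx => by
    rw [Equiv.Perm.mul_apply, hb.2 x hx, ha.2 x hx]⟩
  inv_mem' := fun {a} ha => ⟨A.inv_mem ha.1, fun x hx => by
    rw [Equiv.Perm.inv_eq_iff_eq, ha.2 x hx]⟩

open Classical in
/-- The orbit of a point under a permutation group, as a finset. -/
noncomputable def pointOrbit {X : Type*} [Fintype X] (A : Subgroup (Equiv.Perm X)) (x : X) :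
    Finset X :=
  Finset.univ.filter fun y => ∃ σ ∈ A, σ x = y

theorem mem_pointOrbit {X : Type*} [Fintype X] {A : Subgroup (Equiv.Perm X)} {x y : X} :
    y ∈ pointOrbit A x ↔ ∃ σ ∈ A, σ x = y := by
  simp [pointOrbit]

theorem card_pointOrbit_mul_le {X : Type*} [Fintype X] [DecidableEq X]
    (A : Subgroup (Equiv.Perm X)) (S : Finset X) (x : X) :
    (pointOrbit (pointStabilizer A S) x).card * Nat.card (pointStabilizer A (insert x S)) ≤
      Nat.card (pointStabilizer A S) := by
  classical
  have hch : ∀ y : pointOrbit (pointStabilizer A S) x, ∃ σ ∈ pointStabilizer A S, σ x = y :=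
    fun y => mem_pointOrbit.mp y.2
  choose s hs hsx using hch
  have hle : ∀ τ ∈ pointStabilizer A (insert x S), τ ∈ pointStabilizer A S := fun τ hτ =>
    ⟨hτ.1, fun z hz => hτ.2 z (Finset.mem_insert_of_mem hz)⟩
  have hinj : Function.Injective
      fun q : pointOrbit (pointStabilizer A S) x × pointStabilizer A (insert x S) =>
        (⟨s q.1 * q.2, Subgroup.mul_mem _ (hs q.1) (hle _ q.2.2)⟩ : pointStabilizer A S) := by
    rintro ⟨y, τ⟩ ⟨y', τ'⟩ h
    have h1 : s y * (τ : Equiv.Perm X) = s y' * τ' := congrArg Subtype.val h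
    have hτx : ∀ τ : pointStabilizer A (insert x S), (τ : Equiv.Perm X) x = x := fun τ =>
      τ.2.2 x (Finset.mem_insert_self _ _)
    have h2 : y = y' := by
      have := congrArg (fun ρ : Equiv.Perm X => ρ x) h1
      simp only [Equiv.Perm.mul_apply, hτx, hsx] at this
      exact Subtype.ext this
    subst h2
    rw [mul_right_inj] at h1
    rw [Subtype.ext h1]
  have := Nat.card_le_card_of_injective _ hinj
  rwa [Nat.card_prod, Nat.card_eq_fintype_card (α := pointOrbit (pointStabilizer A S) x),
    Fintype.card_coe] at this

/-- Either some small pointwise stabilizer has no large orbit, or the group is nearly transitive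
on tuples of some large set. -/
theorem exists_small_orbits_or_large {X : Type*} [Fintype X] [DecidableEq X]
    (A : Subgroup (Equiv.Perm X)) (t l : ℕ) (ht : 0 < t) :
    (∃ S : Finset X, S.card ≤ l ∧ ∀ x, (pointOrbit (pointStabilizer A S) x).card ≤ t) ∨
      ∃ S : Finset X, S.card = l ∧ Nat.card (pointStabilizer A S) * t ^ l ≤ Nat.card A := by
  by_cases hcon : ∃ S : Finset X, S.card ≤ l ∧
      ∀ x, (pointOrbit (pointStabilizer A S) x).card ≤ t
  · exact Or.inl hcon
  right
  push Not at hcon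
  have : ∀ j ≤ l, ∃ S : Finset X, S.card = j ∧
      Nat.card (pointStabilizer A S) * t ^ j ≤ Nat.card A := by
    intro j
    induction j with
    | zero =>
      intro _
      refine ⟨∅, rfl, ?_⟩
      rw [pow_zero, mul_one]
      exact Subgroup.card_le_of_le fun σ hσ => hσ.1
    | succ j ih =>
      intro hj
      obtain ⟨S, hS, hle⟩ := ih (by omega)
      obtain ⟨x, hx⟩ := hcon S (by omega)
      have hxS : x ∉ S := by
        intro hxS
        have : pointOrbit (pointStabilizer A S) x ⊆ {x} := by
          intro y hy
          obtain ⟨σ, hσ, rfl⟩ := mem_pointOrbit.mp hy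
          simp [hσ.2 x hxS]
        have := Finset.card_le_card this
        simp at this
        omega
      refine ⟨insert x S, by rw [Finset.card_insert_of_notMem hxS, hS], ?_⟩
      have h1 := card_pointOrbit_mul_le A S x
      calc Nat.card (pointStabilizer A (insert x S)) * t ^ (j + 1)
          = (t * Nat.card (pointStabilizer A (insert x S))) * t ^ j := by ring
        _ ≤ Nat.card (pointStabilizer A S) * t ^ j :=
            Nat.mul_le_mul_right _ ((Nat.mul_le_mul_right _ hx.le).trans h1)
        _ ≤ _ := hle
  exact this l le_rfl

theorem le_card_image_comp {X ι : Type*} [Fintype X] [DecidableEq X] [Fintype ι] [DecidableEq ι]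
    {A : Subgroup (Equiv.Perm X)} [Fintype A] {S : Finset X} (α : ι ≃ S) {t : ℕ}
    (h : Nat.card (pointStabilizer A S) * t ≤ Nat.card A) :
    t ≤ (Finset.univ.image fun (a : A) (i : ι) => (a : Equiv.Perm X) (α i)).card := by
  classical
  set F : A → ι → X := fun a i => (a : Equiv.Perm X) (α i) with hF
  have h1 : (Finset.univ : Finset A).card ≤
      Nat.card (pointStabilizer A S) * (Finset.univ.image F).card := by
    refine Finset.card_le_mul_card_image _ _ fun f hf => ?_
    obtain ⟨a, -, rfl⟩ := Finset.mem_image.mp hf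
    have : ∀ b ∈ Finset.univ.filter fun b => F b = F a,
        (a : Equiv.Perm X)⁻¹ * b ∈ pointStabilizer A S := by
      intro b hb
      have hb := (Finset.mem_filter.mp hb).2
      refine ⟨A.mul_mem (A.inv_mem a.2) b.2, fun x hx => ?_⟩
      have := congrFun hb (α.symm ⟨x, hx⟩)
      simp only [hF, Equiv.apply_symm_apply] at this
      rw [Equiv.Perm.mul_apply, this]
      simp
    have hinj : Function.Injective fun b : Finset.univ.filter fun b => F b = F a =>
        (⟨_, this b.1 b.2⟩ : pointStabilizer A S) := by
      intro b c hbc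
      have := congrArg Subtype.val hbc
      simp only [mul_right_inj] at this
      exact Subtype.ext (Subtype.ext this)
    have := Nat.card_le_card_of_injective _ hinj
    rwa [Nat.card_eq_fintype_card, Fintype.card_coe] at this
  rw [Finset.card_univ, ← Nat.card_eq_fintype_card] at h1
  exact Nat.le_of_mul_le_mul_left (h.trans h1) Nat.card_pos

theorem exists_perm_acting_as_pow {X ι : Type*} [Fintype X] [DecidableEq X] [Fintype ι]
    [DecidableEq ι] {A : Subgroup (Equiv.Perm X)} [Fintype A] (α : ι → X) (π : Equiv.Perm ι)
    (h : Fintype.card X ^ Fintype.card ι <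
      5 * (Finset.univ.image fun (a : A) (i : ι) => (a : Equiv.Perm X) (α i)).card) :
    ∃ j : ℕ, 0 < j ∧ j < 5 ∧ ∃ a ∈ A, ∀ i, a (α i) = α ((π ^ j) i) := by
  classical
  set O := Finset.univ.image fun (a : A) (i : ι) => (a : Equiv.Perm X) (α i) with hO
  let E : Fin 5 × O → ι → X := fun q => q.2.1 ∘ ⇑(π ^ (q.1 : ℕ))
  obtain ⟨⟨j, f⟩, ⟨j', f'⟩, hne, heq⟩ := Fintype.exists_ne_map_eq_of_card_lt E (by simpa using h)
  have key : ∀ (j j' : Fin 5) (f f' : O), j < j' →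
      f.1 ∘ ⇑(π ^ (j : ℕ)) = f'.1 ∘ ⇑(π ^ (j' : ℕ)) →
      ∃ j : ℕ, 0 < j ∧ j < 5 ∧ ∃ a ∈ A, ∀ i, a (α i) = α ((π ^ j) i) := by
    intro j j' f f' hjj he
    obtain ⟨a, -, ha⟩ := Finset.mem_image.mp f.2
    obtain ⟨b, -, hb⟩ := Finset.mem_image.mp f'.2
    refine ⟨(j' : ℕ) - j, by omega, by omega, (b : Equiv.Perm X)⁻¹ * a,
      A.mul_mem (A.inv_mem b.2) a.2, fun i => ?_⟩
    have h1 := congrFun he ((π ^ (j : ℕ))⁻¹ i)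
    rw [← ha, ← hb] at h1
    simp only [Function.comp_apply] at h1
    rw [Equiv.Perm.mul_apply, Equiv.Perm.inv_eq_iff_eq]
    have h2 : (π ^ (j' : ℕ)) ((π ^ (j : ℕ))⁻¹ i) = (π ^ ((j' : ℕ) - j)) i := by
      rw [← Equiv.Perm.mul_apply, pow_sub π (by omega : (j : ℕ) ≤ j')]
    rw [h2] at h1
    rw [← h1]
    simp
  rcases lt_trichotomy j j' with hlt | he | hlt
  · exact key j j' f f' hlt heq
  · exfalso
    subst he
    apply hne
    congr 1
    refine Subtype.ext (funext fun i => ?_)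
    have := congrFun heq ((π ^ (j : ℕ))⁻¹ i)
    simpa [E] using this
  · exact key j' j f' f hlt heq.symm

theorem exists_pointStabilizer_small_orbits {X : Type*} [Fintype X] [DecidableEq X]
    {A : Subgroup (Equiv.Perm X)} {r P t : ℕ} {p : Fin r → ℕ} (hp : ∀ i, (p i).Prime)
    (hinj : Function.Injective p) (hP : ∀ i, P ≤ p i) (h5 : ∀ i, 5 ≤ p i)
    (hPn : Fintype.card X < P ^ 5) (hr : 50 ≤ r) (hX : 0 < Fintype.card X) (ht : 0 < t)
    (htl : Fintype.card X ^ (∑ i, p i) < 5 * t ^ (∑ i, p i))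
    (hdeg : ∀ σ ∈ A, σ ≠ 1 → Fintype.card X ≤ 10 * σ.support.card) :
    ∃ S : Finset X, S.card ≤ ∑ i, p i ∧
      ∀ x, (pointOrbit (pointStabilizer A S) x).card ≤ t := by
  classical
  rcases exists_small_orbits_or_large A t (∑ i, p i) ht with h | ⟨S, hS, hcard⟩
  · exact h
  exfalso
  have : ∀ i, NeZero (p i) := fun i => ⟨(hp i).ne_zero⟩
  have hι : Fintype.card (Σ i, ZMod (p i)) = ∑ i, p i := by
    rw [Fintype.card_sigma]
    exact Finset.sum_congr rfl fun i _ => ZMod.card (p i)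
  have e : (Σ i, ZMod (p i)) ≃ S := Fintype.equivOfCardEq (by rw [hι, Fintype.card_coe, hS])
  have h1 := le_card_image_comp e hcard
  let π : Equiv.Perm (Σ i, ZMod (p i)) := Equiv.sigmaCongrRight fun i => Equiv.addRight 1
  obtain ⟨j, hj0, hj5, a, haA, ha⟩ := exists_perm_acting_as_pow (A := A) (fun i => (e i : X)) π (by
    rw [hι]; omega)
  have hπ : ∀ (j : ℕ) i (z : ZMod (p i)), (π ^ j) ⟨i, z⟩ = ⟨i, z + j⟩ := by
    intro j i z
    induction j with
    | zero => simp
    | succ j ih =>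
      rw [pow_succ', Equiv.Perm.mul_apply, ih]
      simp [π, add_assoc]
  obtain ⟨M, hM, hM10⟩ := exists_pow_small_support (u := 5) hp hinj hP hPn (by omega) hX
    (Subtype.val_injective.comp e.injective) (j := j)
    (fun i hi => by
      have := Nat.le_of_dvd hj0 hi
      have := h5 i
      omega)
    (a := a) (fun i z => by
      have := ha ⟨i, z⟩
      rw [hπ] at this
      exact this)
  have := hdeg _ (A.pow_mem haA M) hM
  omega

theorem pow_lt_five_mul_sub_div_pow {n l : ℕ} (hl : 3 ≤ l) (hln : l ≤ n) :
    n ^ l < 5 * (n - n / l) ^ l := by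
  have hl0 : (0 : ℝ) < l := by exact_mod_cast (by omega : 0 < l)
  have hl3 : (3 : ℝ) ≤ l := by exact_mod_cast hl
  have hn0 : (0 : ℝ) < n := by exact_mod_cast (by omega : 0 < n)
  have h1 : (n : ℝ) * (1 - 1 / l) ≤ ((n - n / l : ℕ) : ℝ) := by
    rw [Nat.cast_sub (Nat.div_le_self _ _)]
    have : ((n / l : ℕ) : ℝ) ≤ n / l := Nat.cast_div_le
    rw [mul_sub, mul_one_div]
    linarith
  have h2 : (1 : ℝ) < 5 * (1 - 1 / l) ^ l := by
    have h3 : (1 - 1 / (l : ℝ)) * (1 + 1 / (l - 1)) = 1 := by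
      have : (l : ℝ) - 1 ≠ 0 := by linarith
      field_simp
      ring
    have h4 : (1 + 1 / ((l : ℝ) - 1)) ^ l ≤ Real.exp (3 / 2) := by
      have h5 : (1 + 1 / ((l : ℝ) - 1)) ≤ Real.exp (1 / (l - 1)) := by
        rw [add_comm]; exact Real.add_one_le_exp _
      have h6 : (0 : ℝ) ≤ 1 / ((l : ℝ) - 1) := by
        apply div_nonneg <;> linarith
      refine (pow_le_pow_left₀ (by linarith) h5 l).trans ?_
      rw [← Real.exp_nat_mul]
      apply Real.exp_le_exp.mpr
      rw [mul_one_div, div_le_div_iff₀ (by linarith) (by norm_num)]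
      linarith
    have h7 : Real.exp (3 / 2) < 5 := by
      have h8 : Real.exp (3 / 2) ^ 2 = Real.exp 1 ^ 3 := by
        rw [← Real.exp_nat_mul, ← Real.exp_nat_mul]; norm_num
      have h9 := Real.exp_one_lt_d9
      have h10 : Real.exp 1 ^ 3 < 2.72 ^ 3 :=
        pow_lt_pow_left₀ (by linarith) (Real.exp_pos _).le (by norm_num)
      by_contra! hc
      have : (5 : ℝ) ^ 2 ≤ Real.exp (3 / 2) ^ 2 := pow_le_pow_left₀ (by norm_num) hc 2
      rw [h8] at this
      norm_num at h10 this
      linarith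
    have h11 : (0 : ℝ) < (1 - 1 / (l : ℝ)) ^ l := by
      apply pow_pos
      rw [sub_pos, div_lt_one hl0]
      linarith
    calc (1 : ℝ) = ((1 - 1 / (l : ℝ)) * (1 + 1 / (l - 1))) ^ l := by rw [h3, one_pow]
      _ = (1 - 1 / (l : ℝ)) ^ l * (1 + 1 / (l - 1)) ^ l := mul_pow _ _ _
      _ < (1 - 1 / (l : ℝ)) ^ l * 5 := mul_lt_mul_of_pos_left (h4.trans_lt h7) h11
      _ = _ := mul_comm _ _
  have h3 : (0 : ℝ) ≤ n * (1 - 1 / l) := by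
    apply mul_nonneg hn0.le
    rw [sub_nonneg, div_le_one hl0]
    linarith
  have : (n : ℝ) ^ l < 5 * ((n - n / l : ℕ) : ℝ) ^ l := by
    calc (n : ℝ) ^ l = n ^ l * 1 := (mul_one _).symm
      _ < n ^ l * (5 * (1 - 1 / l) ^ l) := mul_lt_mul_of_pos_left h2 (by positivity)
      _ = 5 * (n * (1 - 1 / l)) ^ l := by rw [mul_pow]; ring
      _ ≤ _ := by
        apply mul_le_mul_of_nonneg_left _ (by norm_num)
        exact pow_le_pow_left₀ h3 h1 l
  exact_mod_cast this

open scoped Pointwise in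
theorem exists_pointBase_of_small_orbits {X : Type*} [Fintype X] [DecidableEq X]
    {A : Subgroup (Equiv.Perm X)} (h2 : IsSetHomogeneous A 2) {S : Finset X} {l : ℕ} (hl : 0 < l)
    (hln : l ≤ Fintype.card X) (hX : 2 ≤ Fintype.card X) (hS : S.card ≤ l)
    (horb : ∀ x, (pointOrbit (pointStabilizer A S) x).card ≤
      Fintype.card X - Fintype.card X / l) :
    ∃ B : Finset X, IsPointBase A B ∧
      (B.card : ℝ) ≤ l * (4 * l * Real.log (Fintype.card X) + 1) := by
  classical
  set n := Fintype.card X with hn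
  set f : Finset X → ℝ := fun P =>
    if ∃ u ∈ P, ∃ v ∈ P, v ∉ pointOrbit (pointStabilizer A S) u then 1 else 0 with hf
  set D : Finset (X × X) := Finset.univ.filter fun q =>
    q.2 ∉ pointOrbit (pointStabilizer A S) q.1 with hD
  have hself : ∀ x, x ∈ pointOrbit (pointStabilizer A S) x := fun x =>
    mem_pointOrbit.mpr ⟨1, Subgroup.one_mem _, rfl⟩
  have hdiv : n / l ≤ n := Nat.div_le_self _ _
  have hDcard : n * (n / l) ≤ D.card := by
    have : D.card = ∑ x : X, (pointOrbit (pointStabilizer A S) x)ᶜ.card := by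
      rw [hD, Finset.card_filter, Fintype.sum_prod_type]
      refine Finset.sum_congr rfl fun x _ => ?_
      rw [← Finset.card_filter]
      congr 1
      ext y
      simp
    rw [this]
    have h1 : n * (n / l) = (Finset.univ : Finset X).card • (n / l) := by
      rw [Finset.card_univ, smul_eq_mul]
    rw [h1]
    refine Finset.card_nsmul_le_sum _ _ _ fun x _ => ?_
    rw [Finset.card_compl, ← hn]
    have := horb x
    omega
  have hpairs : (n * (n / l) : ℝ) / 4 ≤ ((n * (n / l : ℕ) : ℕ) : ℝ) / 2 := by
    have : (n / l : ℝ) ≤ 2 * (n / l : ℕ) := by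
      have h1 : 1 ≤ n / l := (Nat.one_le_div_iff hl).mpr hln
      have h3 : n < (n / l + 1) * l := by
        have := Nat.lt_mul_div_succ n hl
        rw [mul_comm]; exact this
      have h4 : (n : ℝ) ≤ ((n / l : ℕ) + 1) * l := by exact_mod_cast h3.le
      have h1' : (1 : ℝ) ≤ (n / l : ℕ) := by exact_mod_cast h1
      rw [div_le_iff₀ (by exact_mod_cast hl)]
      nlinarith [(Nat.cast_nonneg l : (0 : ℝ) ≤ l)]
    rw [Nat.cast_mul]
    nlinarith [(Nat.cast_nonneg n : (0 : ℝ) ≤ n)]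
  have hfsum : (n * (n / l) : ℝ) / 4 ≤ ∑ Y ∈ Finset.univ.powersetCard 2, f Y := by
    refine hpairs.trans ?_
    rw [hf]
    simp only
    rw [← Finset.sum_filter, Finset.sum_const, nsmul_eq_mul, mul_one]
    have h1 : D.card ≤ 2 * (D.image fun q => ({q.1, q.2} : Finset X)).card := by
      refine Finset.card_le_mul_card_image _ _ fun P hP => ?_
      obtain ⟨⟨u, v⟩, huv, rfl⟩ := Finset.mem_image.mp hP
      refine le_trans (Finset.card_le_card (t := {(u, v), (v, u)}) ?_) Finset.card_le_two
      rintro ⟨u', v'⟩ hq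
      obtain ⟨hq, he⟩ := Finset.mem_filter.mp hq
      have hne : v' ≠ u' := fun h => (Finset.mem_filter.mp hq).2 (by
        simp only [h]; exact hself u')
      simp only at he
      have m1 : u' ∈ ({u, v} : Finset X) := he ▸ (by simp)
      have m2 : v' ∈ ({u, v} : Finset X) := he ▸ (by simp)
      simp only [Finset.mem_insert, Finset.mem_singleton, Prod.mk.injEq] at m1 m2 ⊢
      grind
    have h3 : (D.image fun q => ({q.1, q.2} : Finset X)) ⊆
        (Finset.univ.powersetCard 2).filter fun P =>
          ∃ u ∈ P, ∃ v ∈ P, v ∉ pointOrbit (pointStabilizer A S) u := by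
      intro P hP
      obtain ⟨⟨u, v⟩, huv, rfl⟩ := Finset.mem_image.mp hP
      have huv := (Finset.mem_filter.mp huv).2
      have hne : u ≠ v := fun h => huv (by simp only [← h]; exact hself u)
      simp only [Finset.mem_filter, Finset.mem_powersetCard, Finset.subset_univ, true_and]
      exact ⟨Finset.card_pair hne, u, by simp, v, by simp, huv⟩
    have h4 := Finset.card_le_card h3
    rw [div_le_iff₀ (by norm_num)]
    norm_cast
    omega
  let ι := {q : X × X // q.1 ≠ q.2}
  let F : ι → Finset A := fun q => Finset.univ.filter fun g =>
    (g : Equiv.Perm X) q.1.2 ∉ pointOrbit (pointStabilizer A S) ((g : Equiv.Perm X) q.1.1) ∨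
    (g : Equiv.Perm X) q.1.1 ∉ pointOrbit (pointStabilizer A S) ((g : Equiv.Perm X) q.1.2)
  have hl0 : (0 : ℝ) < l := by exact_mod_cast hl
  have hA0 : (0 : ℝ) < Fintype.card A := by exact_mod_cast Fintype.card_pos
  have hn2 : (2 : ℝ) ≤ n := by exact_mod_cast hX
  have hF : ∀ q, (Fintype.card A : ℝ) / (2 * l) ≤ ((F q).card : ℝ) := by
    intro q
    have h1 := h2.choose_mul_sum_smul f (Finset.card_pair q.2)
    have h3 : ∑ g : A, f ((g : Equiv.Perm X) • {q.1.1, q.1.2}) = (F q).card := by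
      rw [hf]
      simp only
      rw [← Finset.sum_filter, Finset.sum_const, nsmul_eq_mul, mul_one]
      congr 2
      ext g
      simp only [Finset.mem_filter, Finset.mem_univ, true_and, Finset.smul_finset_insert,
        Finset.smul_finset_singleton, Equiv.Perm.smul_def, F, Finset.mem_insert,
        Finset.mem_singleton, exists_eq_or_imp, exists_eq_left, hself, not_true_eq_false,
        false_or, or_false]
    rw [h3, ← hn, Nat.cast_choose_two] at h1
    have h4 : (Fintype.card A : ℝ) * (n * (n / l) / 4) ≤ n * (n - 1) / 2 * (F q).card := by
      rw [h1]; gcongr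
    rw [div_le_iff₀ (by positivity)]
    have h5 : (Fintype.card A : ℝ) * (n * (n / l) / 4) = n * n / 4 * (Fintype.card A / l) := by
      ring
    have h6 : (n : ℝ) * (n - 1) / 2 * (F q).card ≤ n * n / 4 * (2 * (F q).card) := by
      have : (0 : ℝ) ≤ (F q).card := Nat.cast_nonneg _
      nlinarith
    rw [h5] at h4
    have h7 := le_of_mul_le_mul_left (h4.trans h6) (by positivity)
    rw [div_le_iff₀ hl0] at h7
    linarith
  obtain ⟨T, hT, hTcard⟩ := exists_small_hitting_set F _ (by positivity) hF
  refine ⟨T.biUnion fun g => ((g : Equiv.Perm X)⁻¹ • S : Finset X), ?_, ?_⟩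
  · intro σ hσ hfix
    by_contra hne
    obtain ⟨x, hx⟩ : ∃ x, σ x ≠ x := by
      by_contra! h
      exact hne (Equiv.ext h)
    obtain ⟨g, hgT, hg⟩ := hT ⟨(x, σ x), hx.symm⟩
    have hτ : (g : Equiv.Perm X) * σ * (g : Equiv.Perm X)⁻¹ ∈ pointStabilizer A S := by
      refine ⟨A.mul_mem (A.mul_mem g.2 hσ) (A.inv_mem g.2), fun z hz => ?_⟩
      have := hfix ((g : Equiv.Perm X)⁻¹ • z) (Finset.mem_biUnion.mpr
        ⟨g, hgT, Finset.smul_mem_smul_finset hz⟩)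
      simp only [Equiv.Perm.smul_def] at this
      rw [Equiv.Perm.mul_apply, Equiv.Perm.mul_apply, this]
      simp
    have h1 : (g : Equiv.Perm X) (σ x) ∈
        pointOrbit (pointStabilizer A S) ((g : Equiv.Perm X) x) :=
      mem_pointOrbit.mpr ⟨_, hτ, by simp [Equiv.Perm.mul_apply]⟩
    have h3 : (g : Equiv.Perm X) x ∈
        pointOrbit (pointStabilizer A S) ((g : Equiv.Perm X) (σ x)) :=
      mem_pointOrbit.mpr ⟨_, Subgroup.inv_mem _ hτ, by simp [Equiv.Perm.mul_apply]⟩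
    rcases (Finset.mem_filter.mp hg).2 with h | h
    · exact h h1
    · exact h h3
  · have h1 : (T.biUnion fun g => ((g : Equiv.Perm X)⁻¹ • S : Finset X)).card ≤ T.card * l :=
      Finset.card_biUnion_le_card_mul _ _ _ fun g _ => by
        rw [Finset.card_smul_finset]; exact hS
    have h3 : Real.log (Fintype.card ι) ≤ 2 * Real.log n := by
      have h4 : Fintype.card ι ≤ n * n :=
        (Fintype.card_subtype_le _).trans (by rw [Fintype.card_prod])
      have hlog : 0 ≤ Real.log n := Real.log_nonneg (by linarith)
      rcases Nat.eq_zero_or_pos (Fintype.card ι) with h0 | h0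
      · rw [h0]; simp; exact hlog
      · have h5 : (Fintype.card ι : ℝ) ≤ n * n := by exact_mod_cast h4
        calc Real.log (Fintype.card ι) ≤ Real.log (n * n) :=
              Real.log_le_log (by exact_mod_cast h0) h5
          _ = 2 * Real.log n := by
              rw [Real.log_mul (by linarith) (by linarith)]; ring
    have h4 : (Fintype.card A : ℝ) / (Fintype.card A / (2 * l)) = 2 * l := by
      field_simp
    rw [h4] at hTcard
    have h5 : (T.card : ℝ) ≤ 4 * l * Real.log n + 1 := by nlinarith
    calc ((T.biUnion fun g => ((g : Equiv.Perm X)⁻¹ • S : Finset X)).card : ℝ) ≤ T.card * l := by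
          exact_mod_cast h1
      _ ≤ _ := by nlinarith

theorem exists_distinct_primes (r : ℕ) : ∃ c : ℕ, ∀ P : ℕ, 0 < P → ∃ p : Fin r → ℕ,
    (∀ i, (p i).Prime) ∧ Function.Injective p ∧ (∀ i, P ≤ p i) ∧ ∑ i, p i ≤ c * P := by
  refine ⟨r * 2 ^ r, fun P hP => ?_⟩
  have hch : ∀ m : ℕ, ∃ q : ℕ, 0 < m → q.Prime ∧ m < q ∧ q ≤ 2 * m := by
    intro m
    by_cases hm : m = 0
    · exact ⟨0, fun h => absurd hm h.ne'⟩
    · obtain ⟨q, h1, h2, h3⟩ := Nat.exists_prime_lt_and_le_two_mul m hm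
      exact ⟨q, fun _ => ⟨h1, h2, h3⟩⟩
  choose q hq using hch
  have hpos : ∀ i, 0 < q^[i] P := by
    intro i
    induction i with
    | zero => exact hP
    | succ i ih =>
      rw [Function.iterate_succ_apply']
      exact (hq _ ih).1.pos
  have hmono : StrictMono fun i => q^[i] P := strictMono_nat_of_lt_succ fun i => by
    rw [Function.iterate_succ_apply']
    exact (hq _ (hpos i)).2.1
  have hle : ∀ i, q^[i] P ≤ 2 ^ i * P := by
    intro i
    induction i with
    | zero => simp
    | succ i ih =>
      rw [Function.iterate_succ_apply']
      refine (hq _ (hpos i)).2.2.trans ?_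
      rw [pow_succ]
      linarith
  refine ⟨fun i => q^[i + 1] P, fun i => ?_, fun i j h => ?_, fun i => ?_, ?_⟩
  · simp only [Function.iterate_succ_apply']
    exact (hq _ (hpos i)).1
  · have := hmono.injective h
    exact Fin.ext (by omega)
  · exact hmono.monotone (Nat.zero_le (i + 1 : ℕ))
  · calc ∑ i : Fin r, q^[i + 1] P ≤ ∑ i : Fin r, 2 ^ r * P := Finset.sum_le_sum fun i _ =>
        (hle _).trans (Nat.mul_le_mul_right _ (Nat.pow_le_pow_right (by norm_num) i.2))
      _ = _ := by simp [mul_assoc]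

theorem exists_fifth_root (n : ℕ) (hn : 0 < n) : ∃ P : ℕ, 0 < P ∧ n < P ^ 5 ∧ P ^ 5 ≤ 32 * n := by
  classical
  have hex : ∃ P : ℕ, n < P ^ 5 := ⟨n + 1, by
    calc n < n + 1 := Nat.lt_succ_self n
      _ ≤ _ := Nat.le_self_pow (by norm_num) _⟩
  obtain ⟨P, hP, hmin⟩ : ∃ P : ℕ, n < P ^ 5 ∧ ∀ m < P, ¬ n < m ^ 5 :=
    ⟨Nat.find hex, Nat.find_spec hex, fun m hm => Nat.find_min hex hm⟩
  have h2 : 2 ≤ P := by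
    by_contra! h
    interval_cases P <;> omega
  obtain ⟨m, rfl⟩ : ∃ m, P = m + 1 := ⟨P - 1, by omega⟩
  have h3 := not_lt.mp (hmin m (Nat.lt_succ_self m))
  refine ⟨m + 1, by omega, hP, ?_⟩
  calc (m + 1) ^ 5 ≤ (2 * m) ^ 5 := Nat.pow_le_pow_left (by omega) 5
    _ = 32 * m ^ 5 := by ring
    _ ≤ _ := Nat.mul_le_mul_left 32 h3

/-- Large primitive groups not containing the alternating group have small bases. -/
theorem exists_small_pointBase : ∃ N : ℕ, ∀ (X : Type) [Fintype X] [DecidableEq X],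
    N ≤ Fintype.card X → ∀ A : Subgroup (Equiv.Perm X), MulAction.IsPreprimitive A X →
      ¬ alternatingGroup X ≤ A → ∃ S : Finset X, IsPointBase A S ∧
        (S.card : ℝ) ≤ 5 * √(Fintype.card X) * Real.log (Fintype.card X) := by
  obtain ⟨r, hr⟩ : ∃ r : ℕ, 50 ≤ r := ⟨50, le_rfl⟩
  obtain ⟨c, hc⟩ := exists_distinct_primes r
  refine ⟨1024 + 32 ^ 4 * c ^ 20, fun X _ _ hN A hp hA => ?_⟩
  set n := Fintype.card X with hn
  have hn1 : 1024 ≤ n := by omega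
  have hn1' : (1024 : ℝ) ≤ n := by exact_mod_cast hn1
  have hX : Nonempty X := Fintype.card_pos_iff.mp (by omega)
  have hlog : 1 ≤ Real.log n := by
    rw [Real.le_log_iff_exp_le (by linarith)]
    have := Real.exp_one_lt_d9
    linarith
  have hsqrt : 1 ≤ √(n : ℝ) := by
    rw [Real.one_le_sqrt]; linarith
  by_cases h2 : IsSetHomogeneous A 2
  swap
  · obtain ⟨S, hS, hcard⟩ := exists_small_base_of_not_isSetHomogeneous_two h2
    refine ⟨S, hS, hcard.trans ?_⟩
    rw [← hn]
    nlinarith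
  have hdeg : ∀ σ ∈ A, σ ≠ 1 → n ≤ 10 * σ.support.card := fun σ hσ hσ1 =>
    card_le_ten_mul_card_support hp hA h2 hσ hσ1
  obtain ⟨P, hP0, hnP, hPn⟩ := exists_fifth_root n (by omega)
  obtain ⟨p, hprime, hinj, hPp, hsum⟩ := hc P hP0
  have hP5 : 5 ≤ P := by
    by_contra! h
    have : P ^ 5 ≤ 4 ^ 5 := Nat.pow_le_pow_left (by omega) 5
    norm_num at this
    omega
  set l := ∑ i, p i with hl
  have hl3 : 3 ≤ l := by
    have := Finset.single_le_sum (f := p) (fun i _ => Nat.zero_le _) (Finset.mem_univ ⟨0, by omega⟩)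
    have := hPp ⟨0, by omega⟩
    omega
  have hl4 : l ^ 4 ≤ n := by
    have h1 : (l ^ 4) ^ 5 ≤ n ^ 5 := by
      calc (l ^ 4) ^ 5 ≤ ((c * P) ^ 4) ^ 5 := by gcongr
        _ = c ^ 20 * (P ^ 5) ^ 4 := by ring
        _ ≤ c ^ 20 * (32 * n) ^ 4 := by gcongr
        _ = 32 ^ 4 * c ^ 20 * n ^ 4 := by ring
        _ ≤ n * n ^ 4 := by gcongr; omega
        _ = _ := by ring
    exact (Nat.pow_le_pow_iff_left (by norm_num)).mp h1
  have hln : l ≤ n := (Nat.le_self_pow (by norm_num) l).trans hl4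
  obtain ⟨S, hS, horb⟩ := exists_pointStabilizer_small_orbits (A := A) (t := n - n / l) hprime hinj
    hPp (fun i => hP5.trans (hPp i)) hnP hr (by omega)
    (by
      have : n / l < n := Nat.div_lt_self (by omega) (by omega)
      omega)
    (pow_lt_five_mul_sub_div_pow hl3 hln) hdeg
  obtain ⟨B, hB, hcard⟩ := exists_pointBase_of_small_orbits h2 (by omega) hln (by omega) hS horb
  refine ⟨B, hB, hcard.trans ?_⟩
  rw [← hn]
  have hl1 : (1 : ℝ) ≤ l := by exact_mod_cast (by omega : 1 ≤ l)
  have hl2 : (l : ℝ) * l ≤ √n := by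
    apply Real.le_sqrt_of_sq_le
    have : (l : ℝ) ^ 4 ≤ n := by exact_mod_cast hl4
    nlinarith
  calc (l : ℝ) * (4 * l * Real.log n + 1) = 4 * (l * l) * Real.log n + l := by ring
    _ ≤ 4 * (l * l) * Real.log n + (l * l) * Real.log n := by nlinarith
    _ = 5 * (l * l) * Real.log n := by ring
    _ ≤ _ := by gcongr

/-- `ψ` is harmonic on the `m`-subsets of `V`: it sums to zero over the `m`-sets containing any
given `(m - 1)`-set. -/
def IsHarmonicOn {α : Type*} [DecidableEq α] (m : ℕ) (V : Finset α) (ψ : Finset α → ℝ) : Prop :=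
  ∀ P ⊆ V, P.card + 1 = m → ∑ x ∈ V \ P, ψ (insert x P) = 0

theorem IsHarmonicOn.diff {α : Type*} [DecidableEq α] {m : ℕ} {V : Finset α} {ψ : Finset α → ℝ}
    (h : IsHarmonicOn (m + 1) V ψ) {u v : α} (hu : u ∈ V) (hv : v ∈ V) (huv : u ≠ v) :
    IsHarmonicOn m ((V.erase u).erase v) fun R => ψ (insert u R) - ψ (insert v R) := by
  intro P hP hPm
  have hPu : u ∉ P := fun hh => by simpa using hP hh
  have hPv : v ∉ P := fun hh => by simpa using hP hh
  have hPV : P ⊆ V := fun x hx => by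
    have := hP hx
    simp at this
    exact this.2.2
  have key : ∀ a b, a ∈ V → b ∈ V → a ≠ b → a ∉ P → b ∉ P →
      ∑ x ∈ ((V.erase a).erase b) \ P, ψ (insert a (insert x P)) +
        ψ (insert a (insert b P)) = 0 := by
    intro a b ha hb hab haP hbP
    have h1 := h (insert a P) (Finset.insert_subset ha hPV) (by
      rw [Finset.card_insert_of_notMem haP, hPm])
    have h2 : V \ insert a P = insert b (((V.erase a).erase b) \ P) := by
      ext x
      simp only [Finset.mem_sdiff, Finset.mem_insert, Finset.mem_erase]
      constructor
      · rintro ⟨h3, h4⟩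
        by_cases hx : x = b
        · exact Or.inl hx
        · right; tauto
      · rintro (rfl | h3)
        · exact ⟨hb, by rintro (h5 | h5); exacts [hab h5.symm, hbP h5]⟩
        · tauto
    rw [h2, Finset.sum_insert (by simp), Finset.insert_comm b a, add_comm] at h1
    rw [← h1]
    congr 1
    exact Finset.sum_congr rfl fun x _ => by rw [Finset.insert_comm]
  have e1 := key u v hu hv huv hPu hPv
  have e2 := key v u hv hu huv.symm hPv hPu
  rw [Finset.erase_right_comm, Finset.insert_comm v u] at e2
  rw [Finset.sum_sub_distrib]
  linarith

theorem choose_le_card_filter_sum_ne_zero {α : Type*} [DecidableEq α] (m : ℕ) :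
    ∀ (V : Finset α) (ψ : Finset α → ℝ) (k : ℕ), IsHarmonicOn m V ψ →
      (∃ R ⊆ V, R.card = m ∧ ψ R ≠ 0) → m ≤ k →
      (V.card - 2 * m).choose (k - m) ≤
        ((V.powersetCard k).filter fun Y => ∑ T ∈ Y.powersetCard m, ψ T ≠ 0).card := by
  induction m with
  | zero =>
    rintro V ψ k - ⟨R, -, hR0, hR⟩ -
    rw [Finset.card_eq_zero] at hR0
    subst hR0
    simp [hR]
  | succ m ih =>
    rintro V ψ k hψ ⟨R, hRV, hRm, hR⟩ hmk
    obtain ⟨u, hu⟩ : R.Nonempty := by rw [← Finset.card_pos]; omega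
    set P := R.erase u with hP
    have hPR : insert u P = R := Finset.insert_erase hu
    have hPV : P ⊆ V := (Finset.erase_subset _ _).trans hRV
    have hPm : P.card = m := by rw [hP, Finset.card_erase_of_mem hu]; omega
    obtain ⟨v, hv, hne⟩ : ∃ v ∈ V \ P, ψ (insert v P) ≠ ψ R := by
      by_contra! hcon
      have := hψ P hPV (by omega)
      rw [Finset.sum_congr rfl hcon, Finset.sum_const, nsmul_eq_mul] at this
      rcases mul_eq_zero.mp this with h0 | h0
      · have : u ∈ V \ P := by simp [hP, hRV hu]
        rw [Nat.cast_eq_zero, Finset.card_eq_zero] at h0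
        simp [h0] at this
      · exact hR h0
    have huv : u ≠ v := by rintro rfl; exact hne (by rw [hPR])
    rw [Finset.mem_sdiff] at hv
    have hPu : u ∉ P := by simp [hP]
    set V' := (V.erase u).erase v with hV'
    have hV'card : V'.card = V.card - 2 := by
      rw [hV', Finset.card_erase_of_mem (by simp [huv.symm, hv.1]),
        Finset.card_erase_of_mem (hRV hu)]
      omega
    have := ih V' (fun R => ψ (insert u R) - ψ (insert v R)) (k - 1)
      (hψ.diff (hRV hu) hv.1 huv)
      ⟨P, fun x hx => by
        simp only [hV', Finset.mem_erase]
        exact ⟨fun h => hv.2 (h ▸ hx), fun h => hPu (h ▸ hx), hPV hx⟩, hPm, by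
        rw [hPR]; exact sub_ne_zero.mpr hne.symm⟩ (by omega)
    have e1 : V'.card - 2 * m = V.card - 2 * (m + 1) := by omega
    have e2 : k - 1 - m = k - (m + 1) := by omega
    rw [e1, e2] at this
    refine this.trans ?_
    have hE : ∀ Q : Finset α, ∀ a, a ∉ Q → ∑ T ∈ (insert a Q).powersetCard (m + 1), ψ T =
        ∑ T ∈ Q.powersetCard (m + 1), ψ T + ∑ T ∈ Q.powersetCard m, ψ (insert a T) := by
      intro Q a ha
      rw [Finset.powersetCard_succ_insert ha, Finset.sum_union, Finset.sum_image]
      · intro S hS T hT hST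
        simp only [Finset.mem_coe, Finset.mem_powersetCard] at hS hT
        rw [← Finset.erase_insert (fun h => ha (hS.1 h)), hST,
          Finset.erase_insert (fun h => ha (hT.1 h))]
      · rw [Finset.disjoint_left]
        intro S hS hS2
        obtain ⟨T, -, rfl⟩ := Finset.mem_image.mp hS2
        exact ha ((Finset.mem_powersetCard.mp hS).1 (Finset.mem_insert_self _ _))
    let f : Finset α → Finset α := fun Q =>
      if ∑ T ∈ (insert u Q).powersetCard (m + 1), ψ T ≠ 0 then insert u Q else insert v Q
    have hf : ∀ Q, Q ⊆ V' → ((f Q).erase u).erase v = Q := by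
      intro Q hQ
      have huQ : u ∉ Q := fun h => by have := hQ h; simp [hV'] at this
      have hvQ : v ∉ Q := fun h => by have := hQ h; simp [hV'] at this
      simp only [f]
      split_ifs
      · rw [Finset.erase_insert huQ, Finset.erase_eq_of_notMem hvQ]
      · rw [Finset.erase_right_comm, Finset.erase_insert hvQ, Finset.erase_eq_of_notMem huQ]
    refine Finset.card_le_card_of_injOn f ?_ ?_
    · intro Q hQ
      simp only [Finset.coe_filter, Finset.mem_powersetCard, Set.mem_ofPred_eq] at hQ ⊢
      obtain ⟨⟨hQV, hQk⟩, hQ0⟩ := hQ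
      have huQ : u ∉ Q := fun h => by have := hQV h; simp [hV'] at this
      have hvQ : v ∉ Q := fun h => by have := hQV h; simp [hV'] at this
      have hQV2 : Q ⊆ V := hQV.trans ((Finset.erase_subset _ _).trans (Finset.erase_subset _ _))
      simp only [f]
      split_ifs with hc
      · exact ⟨⟨Finset.insert_subset (hRV hu) hQV2,
          by rw [Finset.card_insert_of_notMem huQ]; omega⟩, hc⟩
      · refine ⟨⟨Finset.insert_subset hv.1 hQV2,
          by rw [Finset.card_insert_of_notMem hvQ]; omega⟩, fun h0 => hQ0 ?_⟩
        push Not at hc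
        rw [hE _ _ huQ] at hc
        rw [hE _ _ hvQ] at h0
        rw [Finset.sum_sub_distrib]
        linarith
    · intro Q hQ Q' hQ' hQQ
      simp only [Finset.coe_filter, Finset.mem_powersetCard, Set.mem_ofPred_eq] at hQ hQ'
      rw [← hf Q hQ.1.1, hQQ, hf Q' hQ'.1.1]

theorem choose_le_pow_mul_choose (m : ℕ) : ∀ n k : ℕ, m ≤ k → 2 * k ≤ n →
    n.choose k ≤ n ^ m * (n - 2 * m).choose (k - m) := by
  induction m with
  | zero => intro n k _ _; simp
  | succ m ih =>
    intro n k hmk hkn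
    obtain ⟨k, rfl⟩ : ∃ j, k = j + 1 := ⟨k - 1, by omega⟩
    obtain ⟨n, rfl⟩ : ∃ j, n = j + 2 := ⟨n - 2, by omega⟩
    have h1 := ih n k (by omega) (by omega)
    have h2 : (n + 2).choose (k + 1) ≤ (n + 2) * n.choose k := by
      have e1 := Nat.add_one_mul_choose_eq (n + 1) k
      have e2 := Nat.choose_mul_succ_eq n k
      have h3 : n + 1 ≤ (k + 1) * (n + 1 - k) := by
        obtain ⟨j, rfl⟩ : ∃ j, n = k + j := ⟨n - k, by omega⟩
        have : k + j + 1 - k = j + 1 := by omega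
        rw [this]
        nlinarith
      have h4 : (n + 2).choose (k + 1) * ((k + 1) * (n + 1 - k)) =
          (n + 2) * n.choose k * (n + 1) := by
        calc _ = ((n + 1 + 1).choose (k + 1) * (k + 1)) * (n + 1 - k) := by ring
          _ = (n + 1 + 1) * ((n + 1).choose k * (n + 1 - k)) := by rw [← e1]; ring
          _ = _ := by rw [← e2]; ring
      have h5 : (n + 2).choose (k + 1) * (n + 1) ≤ (n + 2) * n.choose k * (n + 1) := by
        rw [← h4]; gcongr
      exact Nat.le_of_mul_le_mul_right h5 (by omega)
    have e1 : n + 2 - 2 * (m + 1) = n - 2 * m := by omega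
    have e2 : k + 1 - (m + 1) = k - m := by omega
    rw [e1, e2]
    calc _ ≤ (n + 2) * n.choose k := h2
      _ ≤ (n + 2) * (n ^ m * (n - 2 * m).choose (k - m)) := by gcongr
      _ ≤ (n + 2) * ((n + 2) ^ m * (n - 2 * m).choose (k - m)) := by gcongr; omega
      _ = _ := by ring

open scoped Pointwise in
/-- The orbit of a finset under a permutation group. -/
def orbitFamily {X : Type*} [DecidableEq X] (G : Subgroup (Equiv.Perm X)) (Y : Finset X) :
    Set (Finset X) :=
  {Z | ∃ g ∈ G, g • Y = Z}

open scoped Pointwise in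
/-- The permutations preserving the `G`-orbit of `Y`. -/
def orbitAut {X : Type*} [DecidableEq X] (G : Subgroup (Equiv.Perm X)) (Y : Finset X) :
    Subgroup (Equiv.Perm X) :=
  MulAction.stabilizer (Equiv.Perm X) (orbitFamily G Y)

open scoped Pointwise in
theorem mem_orbitAut_iff {X : Type*} [Finite X] [DecidableEq X] {G : Subgroup (Equiv.Perm X)}
    {Y : Finset X} {σ : Equiv.Perm X} :
    σ ∈ orbitAut G Y ↔ ∀ g ∈ G, σ • g • Y ∈ orbitFamily G Y := by
  have := Fintype.ofFinite X
  rw [orbitAut, MulAction.mem_stabilizer_set_iff_smul_set_subset (Set.toFinite _)]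
  constructor
  · intro h g hg
    exact h (Set.smul_mem_smul_set ⟨g, hg, rfl⟩)
  · rintro h - ⟨-, ⟨g, hg, rfl⟩, rfl⟩
    exact h g hg

open scoped Pointwise in
theorem le_orbitAut {X : Type*} [Finite X] [DecidableEq X] (G : Subgroup (Equiv.Perm X))
    (Y : Finset X) : G ≤ orbitAut G Y := fun σ hσ =>
  mem_orbitAut_iff.mpr fun g hg => ⟨σ * g, G.mul_mem hσ hg, mul_smul _ _ _⟩

open scoped Pointwise in
theorem exists_smul_eq_of_mem_orbitAut {X : Type*} [Finite X] [DecidableEq X]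
    {G : Subgroup (Equiv.Perm X)} {Y : Finset X} {σ : Equiv.Perm X} (hσ : σ ∈ orbitAut G Y) :
    ∃ g ∈ G, g • Y = σ • Y := by
  have := mem_orbitAut_iff.mp hσ 1 G.one_mem
  rwa [one_smul] at this

open scoped Pointwise in
theorem choose_mul_sum_orbitFamily {X : Type*} [Fintype X] [DecidableEq X]
    {G : Subgroup (Equiv.Perm X)} {m : ℕ} {Y : Finset X} (hH : IsSetHomogeneous (orbitAut G Y) m)
    {f : Finset X → ℝ} (hf : ∀ g ∈ G, ∀ T, f (g • T) = f T) :
    ((Fintype.card X).choose m : ℝ) * ∑ T ∈ Y.powersetCard m, f T =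
      Y.card.choose m * ∑ T ∈ Finset.univ.powersetCard m, f T := by
  classical
  have h1 : ∀ h : orbitAut G Y, ∑ T ∈ Y.powersetCard m, f ((h : Equiv.Perm X) • T) =
      ∑ T ∈ Y.powersetCard m, f T := by
    intro h
    obtain ⟨g, hg, e⟩ := exists_smul_eq_of_mem_orbitAut h.2
    refine Finset.sum_bij' (fun T _ => (g⁻¹ * (h : Equiv.Perm X)) • T)
      (fun T _ => (g⁻¹ * (h : Equiv.Perm X))⁻¹ • T) ?_ ?_ ?_ ?_ ?_
    · intro T hT
      rw [Finset.mem_powersetCard] at hT ⊢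
      refine ⟨?_, by rw [Finset.card_smul_finset, hT.2]⟩
      have : Y = (g⁻¹ * (h : Equiv.Perm X)) • Y := by rw [mul_smul, ← e, inv_smul_smul]
      exact (Finset.smul_finset_subset_smul_finset hT.1).trans this.ge
    · intro T hT
      rw [Finset.mem_powersetCard] at hT ⊢
      refine ⟨?_, by rw [Finset.card_smul_finset, hT.2]⟩
      have : Y = (g⁻¹ * (h : Equiv.Perm X))⁻¹ • Y := by
        rw [eq_inv_smul_iff, mul_smul, ← e, inv_smul_smul]
      exact (Finset.smul_finset_subset_smul_finset hT.1).trans this.ge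
    · intro T _
      exact inv_smul_smul _ _
    · intro T _
      exact smul_inv_smul _ _
    · intro T _
      rw [mul_smul, hf _ (G.inv_mem hg)]
  have h2 : ∀ T ∈ Y.powersetCard m, ((Fintype.card X).choose m : ℝ) *
      ∑ h : orbitAut G Y, f ((h : Equiv.Perm X) • T) =
      Fintype.card (orbitAut G Y) * ∑ T ∈ Finset.univ.powersetCard m, f T := fun T hT =>
    hH.choose_mul_sum_smul f (Finset.mem_powersetCard.mp hT).2
  have h3 := Finset.sum_congr rfl h2
  rw [← Finset.mul_sum, Finset.sum_comm, Finset.sum_congr rfl fun h _ => h1 h, Finset.sum_const,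
    Finset.card_univ, nsmul_eq_mul, Finset.sum_const, Finset.card_powersetCard,
    nsmul_eq_mul] at h3
  have h4 : (Fintype.card (orbitAut G Y) : ℝ) ≠ 0 := by exact_mod_cast Fintype.card_ne_zero
  apply mul_left_cancel₀ h4
  linarith

theorem sum_sum_insert {X : Type*} [Fintype X] [DecidableEq X] (d : ℕ) (f : Finset X → ℝ) :
    ∑ P ∈ Finset.univ.powersetCard d, ∑ x ∈ Finset.univ \ P, f (insert x P) =
      (d + 1) * ∑ T ∈ Finset.univ.powersetCard (d + 1), f T := by
  have h1 : ∀ T ∈ (Finset.univ : Finset X).powersetCard (d + 1), ((d : ℝ) + 1) * f T =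
      ∑ x ∈ T, f T := by
    intro T hT
    rw [Finset.sum_const, (Finset.mem_powersetCard.mp hT).2, nsmul_eq_mul]
    push_cast
    rfl
  rw [Finset.mul_sum, Finset.sum_congr rfl h1, Finset.sum_sigma', Finset.sum_sigma']
  refine Finset.sum_bij' (fun q _ => ⟨insert q.2 q.1, q.2⟩) (fun q _ => ⟨q.1.erase q.2, q.2⟩)
    ?_ ?_ ?_ ?_ ?_
  · rintro ⟨P, x⟩ hq
    simp only [Finset.mem_sigma, Finset.mem_powersetCard, Finset.subset_univ, true_and,
      Finset.mem_sdiff, Finset.mem_univ] at hq ⊢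
    exact ⟨by rw [Finset.card_insert_of_notMem hq.2, hq.1], Finset.mem_insert_self _ _⟩
  · rintro ⟨T, x⟩ hq
    simp only [Finset.mem_sigma, Finset.mem_powersetCard, Finset.subset_univ, true_and,
      Finset.mem_sdiff, Finset.mem_univ] at hq ⊢
    exact ⟨by rw [Finset.card_erase_of_mem hq.2, hq.1]; rfl, Finset.notMem_erase _ _⟩
  · rintro ⟨P, x⟩ hq
    simp only [Finset.mem_sigma, Finset.mem_sdiff] at hq
    simp [Finset.erase_insert hq.2.2]
  · rintro ⟨T, x⟩ hq
    simp only [Finset.mem_sigma] at hq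
    simp [Finset.insert_erase hq.2]
  · rintro ⟨P, x⟩ _
    rfl

open scoped Pointwise in
theorem isHarmonicOn_univ_of_isSetHomogeneous {X : Type*} [Fintype X] [DecidableEq X]
    {G : Subgroup (Equiv.Perm X)} {d : ℕ} (hG : IsSetHomogeneous G d) {f : Finset X → ℝ}
    (hf : ∀ g ∈ G, ∀ T, f (g • T) = f T)
    (h0 : ∑ T ∈ Finset.univ.powersetCard (d + 1), f T = 0) :
    IsHarmonicOn (d + 1) Finset.univ f := by
  intro P _ hP
  have hP : P.card = d := by omega
  have h1 := sum_sum_insert d f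
  rw [h0, mul_zero] at h1
  have h2 : ∀ Q ∈ (Finset.univ : Finset X).powersetCard d,
      ∑ x ∈ Finset.univ \ Q, f (insert x Q) = ∑ x ∈ Finset.univ \ P, f (insert x P) := by
    intro Q hQ
    obtain ⟨g, hg, rfl⟩ := hG P Q hP (Finset.mem_powersetCard.mp hQ).2
    symm
    refine Finset.sum_bij' (fun x _ => g • x) (fun x _ => g⁻¹ • x) ?_ ?_ ?_ ?_ ?_
    · intro x hx
      simp only [Finset.mem_sdiff, Finset.mem_univ, true_and] at hx ⊢
      rwa [Finset.smul_mem_smul_finset_iff]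
    · intro x hx
      simp only [Finset.mem_sdiff, Finset.mem_univ, true_and] at hx ⊢
      rwa [Finset.inv_smul_mem_iff]
    · intro x _
      exact inv_smul_smul _ _
    · intro x _
      exact smul_inv_smul _ _
    · intro x _
      rw [← Finset.smul_finset_insert, hf g hg]
  rw [Finset.sum_congr rfl h2, Finset.sum_const, Finset.card_powersetCard, nsmul_eq_mul] at h1
  refine (mul_eq_zero.mp h1).resolve_left ?_
  have : d ≤ Fintype.card X := hP ▸ Finset.card_le_univ P
  exact_mod_cast (Nat.choose_pos this).ne'

open scoped Pointwise in
/-- Many `k`-sets `Y` for which the automorphism group of the orbit of `Y` is not homogeneous. -/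
theorem choose_le_pow_mul_card_not_isSetHomogeneous {X : Type*} [Fintype X] [DecidableEq X]
    {G : Subgroup (Equiv.Perm X)} {d k : ℕ} (hG : IsSetHomogeneous G d)
    (hG' : ¬ IsSetHomogeneous G (d + 1)) (hdk : d + 1 ≤ k) (hk : 2 * k ≤ Fintype.card X)
    {Q : Finset (Finset X)}
    (hQ : ∀ Y, Y.card = k → ¬ IsSetHomogeneous (orbitAut G Y) (d + 1) → Y ∈ Q) :
    (Fintype.card X).choose k ≤ Fintype.card X ^ (d + 1) * Q.card := by
  classical
  obtain ⟨S₀, T₀, hS₀, hT₀, hST⟩ : ∃ S T : Finset X, S.card = d + 1 ∧ T.card = d + 1 ∧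
      ∀ g ∈ G, g • S ≠ T := by
    by_contra! h
    exact hG' fun S T hS hT => h S T hS hT
  set n := Fintype.card X with hn
  set e : Finset X → ℝ := fun T => if T ∈ orbitFamily G S₀ then 1 else 0 with he
  have he' : ∀ g ∈ G, ∀ T, e (g • T) = e T := by
    intro g hg T
    have : g • T ∈ orbitFamily G S₀ ↔ T ∈ orbitFamily G S₀ := by
      constructor
      · rintro ⟨h, hh, e⟩
        exact ⟨g⁻¹ * h, G.mul_mem (G.inv_mem hg) hh, by rw [mul_smul, e, inv_smul_smul]⟩
      · rintro ⟨h, hh, rfl⟩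
        exact ⟨g * h, G.mul_mem hg hh, mul_smul _ _ _⟩
    simp only [he, this]
  have hd : d + 1 ≤ n := by omega
  have hC : (0 : ℝ) < n.choose (d + 1) := by exact_mod_cast Nat.choose_pos hd
  set D := ∑ T ∈ Finset.univ.powersetCard (d + 1), e T with hD
  have hDlt : D < n.choose (d + 1) := by
    have h1 : (n.choose (d + 1) : ℝ) = ∑ T ∈ (Finset.univ : Finset X).powersetCard (d + 1), 1 := by
      simp [hn]
    rw [hD, h1]
    refine Finset.sum_lt_sum (fun T _ => ?_) ⟨T₀, by simp [hT₀], ?_⟩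
    · simp only [he]; split_ifs <;> norm_num
    · have : T₀ ∉ orbitFamily G S₀ := fun ⟨g, hg, h⟩ => hST g hg h
      simp [he, this]
  set ψ : Finset X → ℝ := fun T => e T - D / n.choose (d + 1) with hψ
  have hharm : IsHarmonicOn (d + 1) Finset.univ ψ := by
    apply isHarmonicOn_univ_of_isSetHomogeneous hG
    · intro g hg T
      simp only [hψ, he' g hg]
    · rw [hψ, Finset.sum_sub_distrib, ← hD, Finset.sum_const, Finset.card_powersetCard,
        Finset.card_univ, ← hn, nsmul_eq_mul]
      field_simp
      ring
  have h1 := choose_le_card_filter_sum_ne_zero (d + 1) Finset.univ ψ k hharm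
    ⟨S₀, Finset.subset_univ _, hS₀, by
      have : S₀ ∈ orbitFamily G S₀ := ⟨1, G.one_mem, one_smul _ _⟩
      simp only [hψ, he, this, if_true]
      have : D / n.choose (d + 1) < 1 := by rwa [div_lt_one hC]
      linarith⟩ hdk
  rw [Finset.card_univ, ← hn] at h1
  refine (choose_le_pow_mul_choose (d + 1) n k hdk hk).trans (Nat.mul_le_mul_left _ (h1.trans ?_))
  refine Finset.card_le_card fun Y hY => ?_
  obtain ⟨hY1, hY2⟩ := Finset.mem_filter.mp hY
  have hYk := (Finset.mem_powersetCard.mp hY1).2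
  refine hQ Y hYk fun hhom => hY2 ?_
  have h2 := choose_mul_sum_orbitFamily hhom he'
  rw [← hn, ← hD] at h2
  rw [hψ, Finset.sum_sub_distrib, Finset.sum_const, Finset.card_powersetCard, nsmul_eq_mul]
  field_simp
  linarith

theorem isPreprimitive_of_le {X : Type*} {G H : Subgroup (Equiv.Perm X)}
    (hG : MulAction.IsPreprimitive G X) (hGH : G ≤ H) : MulAction.IsPreprimitive H X := by
  have ht : MulAction.IsPretransitive H X := ⟨fun x y => by
    obtain ⟨g, hg⟩ := MulAction.exists_smul_eq G x y
    exact ⟨⟨g, hGH g.2⟩, hg⟩⟩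
  refine { isTrivialBlock_of_isBlock := fun {B} hB => hG.isTrivialBlock_of_isBlock ?_ }
  intro g₁ g₂ h
  exact @hB ⟨g₁, hGH g₁.2⟩ ⟨g₂, hGH g₂.2⟩ h

theorem isSetHomogeneous_of_alternatingGroup_le {X : Type*} [Fintype X] [DecidableEq X]
    {A : Subgroup (Equiv.Perm X)} (hX : 3 ≤ Fintype.card X) (hA : alternatingGroup X ≤ A) (m : ℕ) :
    IsSetHomogeneous A m := by
  intro S T hS hT
  have h := Set.powersetCard.isPretransitive_alternatingGroup (α := X) (n := m)
    (by rwa [Nat.card_eq_fintype_card])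
  obtain ⟨g, hg⟩ := h.exists_smul_eq ⟨S, hS⟩ ⟨T, hT⟩
  exact ⟨g, hA g.2, congrArg Subtype.val hg⟩

theorem isSetHomogeneous_one {X : Type*} [DecidableEq X]
    {G : Subgroup (Equiv.Perm X)} [MulAction.IsPretransitive G X] : IsSetHomogeneous G 1 := by
  intro S T hS hT
  obtain ⟨x, rfl⟩ := Finset.card_eq_one.mp hS
  obtain ⟨y, rfl⟩ := Finset.card_eq_one.mp hT
  obtain ⟨g, hg⟩ := MulAction.exists_smul_eq G x y
  exact ⟨g, g.2, by rw [Finset.smul_finset_singleton]; exact congrArg _ hg⟩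

/-- A group all of whose elements have small support fixes many points. -/
theorem exists_common_fixed_points {X : Type*} [Fintype X] [DecidableEq X]
    {L : Subgroup (Equiv.Perm X)} (hL : ∀ σ ∈ L, 4 * σ.support.card < Fintype.card X) :
    ∃ Z : Finset X, (∀ σ ∈ L, ∀ z ∈ Z, σ z = z) ∧ Fintype.card X < 2 * Z.card := by
  classical
  set W : Finset X := Finset.univ.filter fun x => ∃ σ ∈ L, σ x ≠ x with hW
  refine ⟨Wᶜ, fun σ hσ z hz => ?_, ?_⟩
  · by_contra h
    exact Finset.mem_compl.mp hz (Finset.mem_filter.mpr ⟨Finset.mem_univ _, σ, hσ, h⟩)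
  have h1 : ∀ x ∈ W, Fintype.card L ≤
      2 * (Finset.univ.filter fun σ : L => x ∈ (σ : Equiv.Perm X).support).card := by
    intro x hx
    obtain ⟨τ, hτ, hτx⟩ := (Finset.mem_filter.mp hx).2
    have h2 := Finset.card_filter_add_card_filter_not (s := (Finset.univ : Finset L))
      (fun σ : L => x ∈ (σ : Equiv.Perm X).support)
    have h3 : (Finset.univ.filter fun σ : L => ¬ x ∈ (σ : Equiv.Perm X).support).card ≤
        (Finset.univ.filter fun σ : L => x ∈ (σ : Equiv.Perm X).support).card := by
      refine Finset.card_le_card_of_injOn (fun σ => ⟨τ, hτ⟩ * σ) ?_ ?_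
      · intro σ hσ
        simp only [Finset.coe_filter, Finset.mem_univ, true_and, Equiv.Perm.mem_support, not_not,
          Set.mem_ofPred_eq] at hσ ⊢
        rw [Subgroup.coe_mul, Equiv.Perm.mul_apply, hσ]
        exact hτx
      · intro a _ b _ hab
        exact mul_left_cancel hab
    rw [Finset.card_univ] at h2
    omega
  have h2 : W.card * Fintype.card L ≤ 2 * ∑ σ : L, (σ : Equiv.Perm X).support.card := by
    calc W.card * Fintype.card L = ∑ x ∈ W, Fintype.card L := by simp
      _ ≤ ∑ x ∈ W, 2 * (Finset.univ.filter fun σ : L => x ∈ (σ : Equiv.Perm X).support).card :=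
          Finset.sum_le_sum h1
      _ ≤ ∑ x, 2 * (Finset.univ.filter fun σ : L => x ∈ (σ : Equiv.Perm X).support).card :=
          Finset.sum_le_sum_of_subset (Finset.subset_univ _)
      _ = 2 * ∑ x, ∑ σ : L, if x ∈ (σ : Equiv.Perm X).support then 1 else 0 := by
          rw [Finset.mul_sum]
          exact Finset.sum_congr rfl fun x _ => by rw [Finset.card_filter]
      _ = _ := by
          rw [Finset.sum_comm]
          congr 1
          refine Finset.sum_congr rfl fun σ _ => ?_
          rw [Finset.sum_ite_mem, Finset.univ_inter, Finset.sum_const, smul_eq_mul, mul_one]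
  have h3 : ∑ σ : L, 4 * (σ : Equiv.Perm X).support.card < ∑ σ : L, Fintype.card X :=
    Finset.sum_lt_sum_of_nonempty ⟨1, Finset.mem_univ _⟩ fun σ _ => hL σ σ.2
  rw [← Finset.mul_sum, Finset.sum_const, Finset.card_univ, smul_eq_mul] at h3
  have h4 : Fintype.card L * (2 * W.card) < Fintype.card L * Fintype.card X := by linarith
  have h5 := Nat.lt_of_mul_lt_mul_left h4
  rw [Finset.card_compl]
  omega

open scoped Pointwise in
theorem exists_smul_pair_subset {X : Type*} [Fintype X] [DecidableEq X]
    {G : Subgroup (Equiv.Perm X)} [MulAction.IsPretransitive G X] {Z : Finset X}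
    (hZ : Fintype.card X < 2 * Z.card) {T : Finset X} (hT : T.card = 2) :
    ∃ g ∈ G, g • T ⊆ Z := by
  classical
  obtain ⟨x, y, -, rfl⟩ := Finset.card_eq_two.mp hT
  set f : X → ℝ := fun z => if z ∈ Z then 1 else 0 with hf
  have hsum : ∑ z, f z = Z.card := by simp [hf]
  have hx := card_mul_sum_smul (G := G) f x
  have hy := card_mul_sum_smul (G := G) f y
  by_contra! hcon
  have h1 : ∀ g : G, f (g • x) + f (g • y) ≤ 1 := by
    intro g
    have := hcon g g.2
    rw [Finset.smul_finset_insert, Finset.smul_finset_singleton, Finset.insert_subset_iff,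
      Finset.singleton_subset_iff, not_and_or] at this
    simp only [hf]
    rcases this with h | h
    · have h' : g • x ∉ Z := h
      simp only [h', if_false, zero_add]
      split_ifs <;> norm_num
    · have h' : g • y ∉ Z := h
      simp only [h', if_false, add_zero]
      split_ifs <;> norm_num
  have h2 : ∑ g : G, f (g • x) + ∑ g : G, f (g • y) ≤ Fintype.card G := by
    rw [← Finset.sum_add_distrib]
    refine (Finset.sum_le_sum fun g _ => h1 g).trans ?_
    simp
  have hG : (0 : ℝ) < Fintype.card G := by exact_mod_cast Fintype.card_pos
  have hZ' : (Fintype.card X : ℝ) < 2 * Z.card := by exact_mod_cast hZ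
  have hn : (0 : ℝ) ≤ Fintype.card X := Nat.cast_nonneg _
  rw [hsum] at hx hy
  nlinarith

open scoped Pointwise in
/-- If the automorphism group of the orbit of `Y` is too large but not homogeneous, then `Y` is
fixed by a nontrivial element of one of few proper primitive groups. -/
theorem exists_fixing_of_orbitAut_ne {X : Type*} [Fintype X] [DecidableEq X]
    {G : Subgroup (Equiv.Perm X)} (hG : MulAction.IsPreprimitive G X) {d : ℕ}
    (hX : 3 ≤ Fintype.card X) (hd : 1 ≤ d) (hhom : ∀ j, 1 ≤ j → j ≤ d → IsSetHomogeneous G j)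
    {Y : Finset X} (hY : ¬ IsSetHomogeneous (orbitAut G Y) (d + 1)) (hne : orbitAut G Y ≠ G) :
    (∃ σ ∈ setClosure (orbitAut G Y) (d + 1), σ ≠ 1 ∧ σ • Y = Y ∧
      Fintype.card X ≤ 10 * σ.support.card) ∨
    d = 1 ∧ ∃ σ ∈ setClosure G 2, σ ≠ 1 ∧ σ • Y = Y := by
  classical
  set H := orbitAut G Y with hH
  have hGH : G ≤ H := le_orbitAut G Y
  have hHA := le_setClosure H (d + 1)
  have hAp := isPreprimitive_of_le hG (hGH.trans hHA)
  have hAlt : ¬ alternatingGroup X ≤ setClosure H (d + 1) := fun h =>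
    hY (isSetHomogeneous_setClosure_iff.mp (isSetHomogeneous_of_alternatingGroup_le hX h _))
  obtain ⟨σ, hσH, hσ1, hσY⟩ : ∃ σ ∈ H, σ ≠ 1 ∧ σ • Y = Y := by
    obtain ⟨τ, hτ, hτG⟩ : ∃ τ ∈ H, τ ∉ G := by
      by_contra! h
      exact hne (le_antisymm h hGH)
    obtain ⟨g, hg, e⟩ := exists_smul_eq_of_mem_orbitAut hτ
    refine ⟨g⁻¹ * τ, H.mul_mem (H.inv_mem (hGH hg)) hτ, fun h => ?_, ?_⟩
    · rw [inv_mul_eq_one] at h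
      exact hτG (h ▸ hg)
    · rw [mul_smul, ← e, inv_smul_smul]
  by_cases hd2 : 2 ≤ d
  · left
    have h2 : IsSetHomogeneous (setClosure H (d + 1)) 2 :=
      (hhom 2 (by norm_num) hd2).mono (hGH.trans hHA)
    exact ⟨σ, hHA hσH, hσ1, hσY, card_le_ten_mul_card_support hAp hAlt h2 (hHA hσH) hσ1⟩
  have hd1 : d = 1 := by omega
  let L : Subgroup (Equiv.Perm X) := H ⊓ MulAction.stabilizer (Equiv.Perm X) Y
  by_cases hL : ∀ τ ∈ L, 4 * τ.support.card < Fintype.card X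
  · right
    refine ⟨hd1, σ, ?_, hσ1, hσY⟩
    obtain ⟨Z, hZfix, hZ⟩ := exists_common_fixed_points hL
    intro T hT
    have := hG.toIsPretransitive
    obtain ⟨g₁, hg₁, hgT⟩ := exists_smul_pair_subset (G := G) hZ hT
    have hmem : σ * g₁⁻¹ ∈ H := H.mul_mem hσH (H.inv_mem (hGH hg₁))
    obtain ⟨g₂, hg₂, e⟩ := exists_smul_eq_of_mem_orbitAut hmem
    have hl : g₂⁻¹ * (σ * g₁⁻¹) ∈ L :=
      Subgroup.mem_inf.mpr ⟨H.mul_mem (H.inv_mem (hGH hg₂)) hmem,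
        MulAction.mem_stabilizer_iff.mpr (by rw [mul_smul, ← e, inv_smul_smul])⟩
    have hfix : (g₂⁻¹ * (σ * g₁⁻¹)) • (g₁ • T) = g₁ • T := by
      ext z
      rw [Finset.mem_smul_finset]
      constructor
      · rintro ⟨w, hw, rfl⟩
        rw [Equiv.Perm.smul_def, hZfix _ hl w (hgT hw)]
        exact hw
      · intro hz
        exact ⟨z, hz, hZfix _ hl z (hgT hz)⟩
    refine ⟨g₂ * g₁, G.mul_mem hg₂ hg₁, ?_⟩
    rw [mul_smul, inv_smul_eq_iff, mul_smul, inv_smul_smul] at hfix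
    rw [mul_smul]
    exact hfix.symm
  · left
    push Not at hL
    obtain ⟨τ, hτ, hle⟩ := hL
    refine ⟨τ, hHA hτ.1, ?_, MulAction.mem_stabilizer_iff.mp hτ.2, by omega⟩
    rintro rfl
    simp at hle
    omega

open scoped Pointwise in
/-- The `k`-sets fixed by a large element of one of the closures of overgroups of `G`. -/
theorem card_fixed_by_closures_le {X : Type*} [Fintype X] [DecidableEq X]
    {G : Subgroup (Equiv.Perm X)} {m k b q : ℕ} {S : Finset X} (hX : 0 < Fintype.card X)
    (hk : 2 * k ≤ Fintype.card X)
    (hb : ∀ A : Subgroup (Equiv.Perm X), G ≤ A → ¬ alternatingGroup X ≤ A →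
      ∃ S, IsPointBase A S ∧ S.card = b)
    (hS : ∀ T : Finset X, T.card = m → ∃ g ∈ G, g • T ⊆ S)
    (hq : Nat.card (MulAction.orbitRel.Quotient G (Set.powersetCard X m)) < 2 ^ q)
    {Q : Finset (Finset X)}
    (hQ : ∀ Y ∈ Q, Y.card = k ∧ ∃ H : Subgroup (Equiv.Perm X), G ≤ H ∧
      ¬ alternatingGroup X ≤ setClosure H m ∧ ∃ σ ∈ setClosure H m, σ • Y = Y ∧
        Fintype.card X ≤ 10 * σ.support.card) :
    (Q.card : ℝ) ≤ ((Fintype.card X : ℝ) ^ S.card) ^ q * ((Fintype.card X : ℝ) ^ b *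
      ((Fintype.card X + 1) * (Fintype.card X).choose k * Real.exp (-(k / 30)))) := by
  classical
  set n := Fintype.card X with hn
  set F : ℝ := (n + 1) * n.choose k * Real.exp (-(k / 30)) with hF
  have hF0 : 0 ≤ F := by positivity
  have hnR : (0 : ℝ) < n := by exact_mod_cast hX
  set 𝒜 := (fun H => setClosure H m) '' {H : Subgroup (Equiv.Perm X) | G ≤ H} with h𝒜
  have hfin : 𝒜.Finite := Set.toFinite _
  set 𝒯 := hfin.toFinset.filter fun A => ¬ alternatingGroup X ≤ A with h𝒯
  set fx : Equiv.Perm X → Finset (Finset X) := fun σ =>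
    (Finset.univ.powersetCard k).filter fun Y => σ • Y = Y with hfx
  set P : Subgroup (Equiv.Perm X) → Finset (Equiv.Perm X) := fun A =>
    Finset.univ.filter fun σ => σ ∈ A ∧ n ≤ 10 * σ.support.card with hP
  have hsub : Q ⊆ 𝒯.biUnion fun A => (P A).biUnion fx := by
    intro Y hY
    obtain ⟨hYk, H, hGH, hAlt, σ, hσ, hσY, hσn⟩ := hQ Y hY
    simp only [Finset.mem_biUnion]
    refine ⟨setClosure H m, ?_, σ, ?_, ?_⟩
    · exact Finset.mem_filter.mpr ⟨hfin.mem_toFinset.mpr ⟨H, hGH, rfl⟩, hAlt⟩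
    · exact Finset.mem_filter.mpr ⟨Finset.mem_univ _, hσ, hσn⟩
    · exact Finset.mem_filter.mpr
        ⟨Finset.mem_powersetCard.mpr ⟨Finset.subset_univ _, hYk⟩, hσY⟩
  have hfxle : ∀ A, ∀ σ ∈ P A, ((fx σ).card : ℝ) ≤ F := by
    intro A σ hσ
    refine (card_fixed_powersetCard_le σ k hk hX).trans ?_
    rw [hF]
    gcongr
    have h10 : (n : ℝ) ≤ 10 * σ.support.card := by
      exact_mod_cast (Finset.mem_filter.mp hσ).2.2
    have : (k : ℝ) / 30 = k / (3 * n) * (n / 10) := by field_simp; ring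
    have h2 : (k : ℝ) / (3 * n) * (n / 10) ≤ k / (3 * n) * σ.support.card := by
      gcongr
      linarith
    linarith
  have hPle : ∀ A ∈ 𝒯, ((P A).card : ℝ) ≤ (n : ℝ) ^ b := by
    intro A hA
    obtain ⟨hA1, hA2⟩ := Finset.mem_filter.mp hA
    obtain ⟨H, hGH, rfl⟩ := hfin.mem_toFinset.mp hA1
    obtain ⟨B, hB, hBb⟩ := hb _ (le_trans hGH (le_setClosure H m)) hA2
    have h1 : (P (setClosure H m)).card ≤ Nat.card (setClosure H m) := by
      rw [Nat.card_eq_fintype_card, Fintype.card_subtype]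
      refine Finset.card_le_card fun σ hσ => ?_
      exact Finset.mem_filter.mpr ⟨Finset.mem_univ _, (Finset.mem_filter.mp hσ).2.1⟩
    have h2 := h1.trans hB.card_le
    rw [hBb] at h2
    exact_mod_cast h2
  have h𝒯le : (𝒯.card : ℝ) ≤ ((n : ℝ) ^ S.card) ^ q := by
    have h1 := card_setClosure_overgroups_le hS hq
    rw [← h𝒜, Set.ncard_eq_toFinset_card _ hfin] at h1
    exact_mod_cast (Finset.card_filter_le _ _).trans h1
  have h1 : ∀ A ∈ 𝒯, (((P A).biUnion fx).card : ℝ) ≤ (n : ℝ) ^ b * F := by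
    intro A hA
    calc (((P A).biUnion fx).card : ℝ) ≤ ∑ σ ∈ P A, ((fx σ).card : ℝ) := by
          exact_mod_cast Finset.card_biUnion_le
      _ ≤ (P A).card * F := by
          rw [← nsmul_eq_mul]
          exact Finset.sum_le_card_nsmul _ _ _ (hfxle A)
      _ ≤ _ := mul_le_mul_of_nonneg_right (hPle A hA) hF0
  calc (Q.card : ℝ) ≤ ((𝒯.biUnion fun A => (P A).biUnion fx).card : ℝ) := by
        exact_mod_cast Finset.card_le_card hsub
    _ ≤ ∑ A ∈ 𝒯, (((P A).biUnion fx).card : ℝ) := by exact_mod_cast Finset.card_biUnion_le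
    _ ≤ 𝒯.card * ((n : ℝ) ^ b * F) := by
        rw [← nsmul_eq_mul]
        exact Finset.sum_le_card_nsmul _ _ _ h1
    _ ≤ _ := by gcongr

open scoped Pointwise in
/-- The `k`-sets fixed by a nontrivial element of a transitive group with a small base. -/
theorem card_fixed_by_transitive_le {X : Type*} [Fintype X] [DecidableEq X]
    {A : Subgroup (Equiv.Perm X)} [MulAction.IsPretransitive A X] {k : ℕ} {S : Finset X}
    (hX : 0 < Fintype.card X) (hk : 2 * k ≤ Fintype.card X) (hS : IsPointBase A S)
    (hS0 : S.Nonempty) {Q : Finset (Finset X)}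
    (hQ : ∀ Y ∈ Q, Y.card = k ∧ ∃ σ ∈ A, σ ≠ 1 ∧ σ • Y = Y) :
    (Q.card : ℝ) ≤ (Fintype.card X + 1) * (Fintype.card X).choose k *
      ((1 + Fintype.card X * Real.exp (-(k / (3 * S.card)))) ^ S.card - 1) := by
  classical
  set P : Finset (Equiv.Perm X) := Finset.univ.filter fun σ => σ ∈ A ∧ σ ≠ 1 with hP
  set fx : Equiv.Perm X → Finset (Finset X) := fun σ =>
    (Finset.univ.powersetCard k).filter fun Y => σ • Y = Y with hfx
  have hnR : (0 : ℝ) < Fintype.card X := by exact_mod_cast hX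
  have hSR : (0 : ℝ) < S.card := by exact_mod_cast hS0.card_pos
  have hsub : Q ⊆ P.biUnion fx := by
    intro Y hY
    obtain ⟨hYk, σ, hσ, hσ1, hσY⟩ := hQ Y hY
    exact Finset.mem_biUnion.mpr ⟨σ, Finset.mem_filter.mpr ⟨Finset.mem_univ _, hσ, hσ1⟩,
      Finset.mem_filter.mpr ⟨Finset.mem_powersetCard.mpr ⟨Finset.subset_univ _, hYk⟩, hσY⟩⟩
  have hsum := sum_exp_card_support_le hS hS0 ((k : ℝ) / (3 * Fintype.card X)) (P := P)
    fun σ hσ => (Finset.mem_filter.mp hσ).2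
  have he : -((k : ℝ) / (3 * Fintype.card X)) * (Fintype.card X / S.card) =
      -(k / (3 * S.card)) := by field_simp
  rw [he] at hsum
  calc (Q.card : ℝ) ≤ ((P.biUnion fx).card : ℝ) := by exact_mod_cast Finset.card_le_card hsub
    _ ≤ ∑ σ ∈ P, ((fx σ).card : ℝ) := by exact_mod_cast Finset.card_biUnion_le
    _ ≤ ∑ σ ∈ P, (Fintype.card X + 1) * (Fintype.card X).choose k *
        Real.exp (-(k / (3 * Fintype.card X)) * σ.support.card) :=
        Finset.sum_le_sum fun σ _ => card_fixed_powersetCard_le σ k hk hX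
    _ ≤ _ := by
        rw [← Finset.mul_sum]
        gcongr

open scoped Pointwise in
/-- If no `k`-set has an orbit whose automorphism group is `G`, then `k` is small. -/
theorem one_le_of_forall_orbitAut_ne {X : Type*} [Fintype X] [DecidableEq X]
    {G : Subgroup (Equiv.Perm X)} (hG : MulAction.IsPreprimitive G X) (hX : 3 ≤ Fintype.card X)
    {d k b q : ℕ} {S : Finset X} (hd : 1 ≤ d)
    (hhom : ∀ j, 1 ≤ j → j ≤ d → IsSetHomogeneous G j) (hG' : ¬ IsSetHomogeneous G (d + 1))
    (hdk : d + 1 ≤ k) (hk : 2 * k ≤ Fintype.card X) (hb0 : 0 < b)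
    (hb : ∀ A : Subgroup (Equiv.Perm X), G ≤ A → ¬ alternatingGroup X ≤ A →
      ∃ S, IsPointBase A S ∧ S.card = b)
    (hS : ∀ T : Finset X, T.card = d + 1 → ∃ g ∈ G, g • T ⊆ S)
    (hq : Nat.card (MulAction.orbitRel.Quotient G (Set.powersetCard X (d + 1))) < 2 ^ q)
    (hne : ∀ Y : Finset X, Y.card = k → orbitAut G Y ≠ G) :
    (1 : ℝ) ≤ (Fintype.card X : ℝ) ^ (d + 1) * (((Fintype.card X : ℝ) ^ S.card) ^ q *
      ((Fintype.card X : ℝ) ^ b * ((Fintype.card X + 1) * Real.exp (-(k / 30))))) +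
      (Fintype.card X : ℝ) ^ 2 * ((Fintype.card X + 1) *
        ((1 + Fintype.card X * Real.exp (-(k / (3 * b)))) ^ b - 1)) := by
  classical
  have hX0 : 0 < Fintype.card X := by omega
  set n := Fintype.card X with hn
  have hnR : (0 : ℝ) < n := by exact_mod_cast hX0
  set Q := ((Finset.univ : Finset X).powersetCard k).filter fun Y =>
    ¬ IsSetHomogeneous (orbitAut G Y) (d + 1) with hQ
  set Q₁ := Q.filter fun Y => ∃ σ ∈ setClosure (orbitAut G Y) (d + 1), σ ≠ 1 ∧ σ • Y = Y ∧
    n ≤ 10 * σ.support.card with hQ₁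
  set Q₂ := Q.filter fun Y => d = 1 ∧ ∃ σ ∈ setClosure G 2, σ ≠ 1 ∧ σ • Y = Y with hQ₂
  have hmemQ : ∀ Y ∈ Q, Y.card = k ∧ ¬ IsSetHomogeneous (orbitAut G Y) (d + 1) := fun Y hY =>
    ⟨(Finset.mem_powersetCard.mp (Finset.mem_filter.mp hY).1).2, (Finset.mem_filter.mp hY).2⟩
  have hsub : Q ⊆ Q₁ ∪ Q₂ := by
    intro Y hY
    obtain ⟨h1, h2⟩ := hmemQ Y hY
    exact Finset.mem_union.mpr ((exists_fixing_of_orbitAut_ne hG hX hd hhom h2 (hne Y h1)).imp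
      (fun h => Finset.mem_filter.mpr ⟨hY, h⟩) fun h => Finset.mem_filter.mpr ⟨hY, h⟩)
  have hC := choose_le_pow_mul_card_not_isSetHomogeneous (hhom d hd le_rfl) hG' hdk hk (Q := Q)
    fun Y hYk hY => Finset.mem_filter.mpr
      ⟨Finset.mem_powersetCard.mpr ⟨Finset.subset_univ _, hYk⟩, hY⟩
  rw [← hn] at hC
  have hQle : Q.card ≤ Q₁.card + Q₂.card :=
    (Finset.card_le_card hsub).trans (Finset.card_union_le _ _)
  have hC0 : (0 : ℝ) < n.choose k := by exact_mod_cast Nat.choose_pos (by omega)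
  have h1 := card_fixed_by_closures_le hX0 hk hb hS hq (Q := Q₁) (by
    intro Y hY
    obtain ⟨hYQ, σ, hσ, -, hσY, hσn⟩ := Finset.mem_filter.mp hY
    obtain ⟨hYk, hYh⟩ := hmemQ Y hYQ
    refine ⟨hYk, _, le_orbitAut G Y, fun h => hYh ?_, σ, hσ, hσY, hσn⟩
    exact isSetHomogeneous_setClosure_iff.mp (isSetHomogeneous_of_alternatingGroup_le hX h _))
  rw [← hn] at h1
  set U : ℝ := (1 + n * Real.exp (-(k / (3 * b)))) ^ b - 1 with hU
  have hU0 : 0 ≤ U := by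
    rw [hU, sub_nonneg]
    exact one_le_pow₀ (by linarith [mul_pos hnR (Real.exp_pos (-(k / (3 * (b : ℝ)))))])
  have h2 : (n : ℝ) ^ (d + 1) * Q₂.card ≤ (n : ℝ) ^ 2 * ((n + 1) * n.choose k * U) := by
    by_cases hd1 : d = 1
    · subst hd1
      have hAp := isPreprimitive_of_le hG (le_setClosure G 2)
      have hAlt : ¬ alternatingGroup X ≤ setClosure G 2 := fun h =>
        hG' (isSetHomogeneous_setClosure_iff.mp (isSetHomogeneous_of_alternatingGroup_le hX h _))
      obtain ⟨B, hB, hBb⟩ := hb _ (le_setClosure G 2) hAlt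
      have := hAp.toIsPretransitive
      have h3 := card_fixed_by_transitive_le hX0 hk hB (Finset.card_pos.mp (hBb ▸ hb0)) (Q := Q₂)
        (by
          intro Y hY
          obtain ⟨hYQ, -, h⟩ := Finset.mem_filter.mp hY
          exact ⟨(hmemQ Y hYQ).1, h⟩)
      rw [hBb, ← hn, ← hU] at h3
      gcongr
    · have : Q₂ = ∅ := Finset.filter_eq_empty_iff.mpr fun Y _ h => hd1 h.1
      rw [this, Finset.card_empty, Nat.cast_zero, mul_zero]
      positivity
  have hCR : (n.choose k : ℝ) ≤ (n : ℝ) ^ (d + 1) * (Q₁.card + Q₂.card) := by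
    exact_mod_cast hC.trans (Nat.mul_le_mul_left _ hQle)
  have h4 : (n.choose k : ℝ) * 1 ≤ n.choose k * ((n : ℝ) ^ (d + 1) * (((n : ℝ) ^ S.card) ^ q *
      ((n : ℝ) ^ b * ((n + 1) * Real.exp (-(k / 30))))) + (n : ℝ) ^ 2 * ((n + 1) * U)) := by
    calc (n.choose k : ℝ) * 1 ≤ (n : ℝ) ^ (d + 1) * Q₁.card + (n : ℝ) ^ (d + 1) * Q₂.card := by
          linarith
      _ ≤ (n : ℝ) ^ (d + 1) * _ + _ := add_le_add (mul_le_mul_of_nonneg_left h1 (by positivity)) h2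
      _ = _ := by ring
  exact le_of_mul_le_mul_left h4 hC0

theorem eventually_log_bounds {ε : ℝ} (hε : 0 < ε) : ∃ N : ℕ, ∀ n : ℕ, N ≤ n →
    10 ≤ Real.log n ∧ 5 * Real.log n ≤ √(n : ℝ) ∧
      3600 * √(n : ℝ) * Real.log n ^ 4 ≤ (n : ℝ) ^ ((1 : ℝ) / 2 + ε) := by
  have h1 := Real.tendsto_log_atTop.eventually_ge_atTop 10
  have h2 := (isLittleO_log_rpow_atTop (show (0 : ℝ) < 1 / 2 by norm_num)).bound
    (show (0 : ℝ) < 1 / 5 by norm_num)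
  have h3 := (isLittleO_log_rpow_rpow_atTop (4 : ℝ) hε).bound
    (show (0 : ℝ) < 1 / 3600 by norm_num)
  have h := tendsto_natCast_atTop_atTop.eventually
    (h1.and (h2.and (h3.and (Filter.eventually_gt_atTop 0))))
  obtain ⟨N, hN⟩ := Filter.eventually_atTop.mp h
  refine ⟨N, fun n hn => ?_⟩
  obtain ⟨h1, h2, h3, h4⟩ := hN n hn
  refine ⟨h1, ?_, ?_⟩
  · rw [← Real.sqrt_eq_rpow, Real.norm_of_nonneg (by linarith),
      Real.norm_of_nonneg (Real.sqrt_nonneg _)] at h2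
    linarith
  · rw [show (4 : ℝ) = ((4 : ℕ) : ℝ) by norm_num, Real.rpow_natCast,
      Real.norm_of_nonneg (by positivity), Real.norm_of_nonneg (by positivity)] at h3
    rw [Real.rpow_add h4, ← Real.sqrt_eq_rpow, mul_comm 3600, mul_assoc]
    exact mul_le_mul_of_nonneg_left (by linarith) (Real.sqrt_nonneg _)

theorem two_pow_le_choose (k : ℕ) : ∀ n, 2 * k ≤ n → 2 ^ k ≤ n.choose k := by
  induction k with
  | zero => simp
  | succ k ih =>
    intro n hn
    obtain ⟨n, rfl⟩ : ∃ m, n = m + 2 := ⟨n - 2, by omega⟩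
    have h1 := ih n (by omega)
    have h2 : (n + 2).choose (k + 1) = (n + 1).choose k + (n + 1).choose (k + 1) :=
      Nat.choose_succ_succ _ _
    have h3 : n.choose k ≤ (n + 1).choose k := Nat.choose_le_choose _ (Nat.le_succ n)
    have h4 : (n + 1).choose (k + 1) = n.choose k + n.choose (k + 1) := Nat.choose_succ_succ _ _
    rw [pow_succ]
    omega

theorem cast_le_of_two_pow_le {n b m : ℕ} (hn : 0 < n) {s : ℝ} (hb : (b : ℝ) ≤ 5 * s * Real.log n)
    (h : 2 ^ m ≤ n ^ b) : (m : ℝ) ≤ 8 * s * Real.log n ^ 2 := by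
  have hnR : (0 : ℝ) < n := by exact_mod_cast hn
  have h1 : (2 : ℝ) ^ m ≤ (n : ℝ) ^ b := by exact_mod_cast h
  have h2 := Real.log_le_log (by positivity) h1
  rw [Real.log_pow, Real.log_pow] at h2
  have h3 := Real.log_two_gt_d9
  have hL : 0 ≤ Real.log n := Real.log_natCast_nonneg n
  have h4 : (b : ℝ) * Real.log n ≤ 5 * s * Real.log n * Real.log n :=
    mul_le_mul_of_nonneg_right hb hL
  have h5 : (m : ℝ) * (5 / 8) ≤ m * Real.log 2 :=
    mul_le_mul_of_nonneg_left (by linarith) (Nat.cast_nonneg _)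
  nlinarith

theorem cast_log_add_one_le {n : ℕ} (hn : 0 < n) (hL : 1 ≤ Real.log n) :
    ((Nat.log 2 n + 1 : ℕ) : ℝ) ≤ 3 * Real.log n := by
  have h1 : (2 : ℝ) ^ Nat.log 2 n ≤ n := by exact_mod_cast Nat.pow_log_le_self 2 hn.ne'
  have h2 := Real.log_le_log (by positivity) h1
  rw [Real.log_pow] at h2
  have h3 := Real.log_two_gt_d9
  have h5 : (Nat.log 2 n : ℝ) * (1 / 2) ≤ Nat.log 2 n * Real.log 2 :=
    mul_le_mul_of_nonneg_left (by linarith) (Nat.cast_nonneg _)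
  push_cast
  linarith

theorem one_add_mul_exp_pow_sub_one_le {b : ℕ} {x : ℝ} (hx : 0 ≤ x) (hbx : b * x ≤ 1) :
    (1 + x) ^ b - 1 ≤ 2 * (b * x) := by
  have h1 : (1 + x) ^ b ≤ Real.exp (b * x) := by
    rw [Real.exp_nat_mul]
    exact pow_le_pow_left₀ (by linarith) (by linarith [Real.add_one_le_exp x]) _
  have h0 : 0 ≤ (b : ℝ) * x := by positivity
  have h2 := Real.abs_exp_sub_one_le (x := b * x) (by rwa [abs_of_nonneg h0])
  rw [abs_of_nonneg h0] at h2
  linarith [le_abs_self (Real.exp (b * x) - 1)]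

theorem exp_bound_lt_one {n k d b q t : ℕ} (hL : 10 ≤ Real.log n)
    (hLs : 5 * Real.log n ≤ √(n : ℝ)) (hk : 3600 * √(n : ℝ) * Real.log n ^ 4 ≤ k) (hb0 : 0 < b)
    (hb : (b : ℝ) ≤ 5 * √(n : ℝ) * Real.log n) (hd : (d : ℝ) ≤ 8 * √(n : ℝ) * Real.log n ^ 2)
    (hq : (q : ℝ) ≤ 3 * Real.log n) (ht : (t : ℝ) ≤ 12 * √(n : ℝ) * Real.log n ^ 2) :
    (n : ℝ) ^ (d + 1) * (((n : ℝ) ^ t) ^ q * ((n : ℝ) ^ b * ((n + 1) * Real.exp (-(k / 30))))) +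
      (n : ℝ) ^ 2 * ((n + 1) * ((1 + n * Real.exp (-(k / (3 * b)))) ^ b - 1)) < 1 := by
  have hn0 : n ≠ 0 := by rintro rfl; norm_num at hL
  have hn1 : (1 : ℝ) ≤ n := by exact_mod_cast Nat.one_le_iff_ne_zero.mpr hn0
  have hss : √(n : ℝ) * √(n : ℝ) = n := Real.mul_self_sqrt (by linarith)
  set L := Real.log n with hLdef
  set s := √(n : ℝ) with hs
  have hn : (n : ℝ) = Real.exp L := (Real.exp_log (by linarith)).symm
  have hs1 : 50 ≤ s := by linarith
  have hnp : ∀ m : ℕ, (n : ℝ) ^ m = Real.exp (m * L) := fun m => by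
    rw [hn, ← Real.exp_nat_mul]
  have h2e : (2 : ℝ) ≤ Real.exp L := by linarith [Real.add_one_le_exp L]
  have hn2 : (n : ℝ) + 1 ≤ Real.exp (2 * L) := by
    rw [two_mul, Real.exp_add, ← hn]
    nlinarith
  have hexp : Real.exp (-L) ≤ 1 / 4 := by
    rw [Real.exp_neg, inv_le_comm₀ (Real.exp_pos _) (by norm_num)]
    linarith [Real.add_one_le_exp L]
  have hsL : 1 ≤ s * L := by nlinarith
  have hsL3 : s * L ^ 2 * 10 ≤ s * L ^ 3 := by
    have : 0 ≤ s * L ^ 2 := by positivity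
    calc s * L ^ 2 * 10 ≤ s * L ^ 2 * L := mul_le_mul_of_nonneg_left hL this
      _ = _ := by ring
  have hsL2 : s * L * 10 ≤ s * L ^ 2 := by
    calc s * L * 10 ≤ s * L * L := mul_le_mul_of_nonneg_left hL (by positivity)
      _ = _ := by ring
  have htq : (t : ℝ) * q ≤ 36 * (s * L ^ 3) := by
    calc (t : ℝ) * q ≤ (12 * s * L ^ 2) * (3 * L) := by gcongr
      _ = _ := by ring
  have hterm1 : (n : ℝ) ^ (d + 1) * (((n : ℝ) ^ t) ^ q * ((n : ℝ) ^ b *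
      ((n + 1) * Real.exp (-(k / 30))))) ≤ 1 / 4 := by
    calc _ ≤ (n : ℝ) ^ (d + 1) * (((n : ℝ) ^ t) ^ q * ((n : ℝ) ^ b *
          (Real.exp (2 * L) * Real.exp (-(k / 30))))) := by gcongr
      _ = Real.exp ((d + 1 + t * q + b + 2) * L + -(k / 30)) := by
          rw [← pow_mul, hnp, hnp, hnp, ← Real.exp_add, ← Real.exp_add, ← Real.exp_add,
            ← Real.exp_add]
          congr 1
          push_cast
          ring
      _ ≤ Real.exp (-L) := by
          apply Real.exp_le_exp.mpr
          have h1 : ((d : ℝ) + 1 + t * q + b + 2) * L ≤ (60 * (s * L ^ 3)) * L := by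
            apply mul_le_mul_of_nonneg_right _ (by linarith)
            nlinarith
          have h2 : L * 1 ≤ L * (s * L ^ 3) := by
            apply mul_le_mul_of_nonneg_left _ (by linarith)
            linarith
          nlinarith
      _ ≤ _ := hexp
  have hbR : (1 : ℝ) ≤ b := by exact_mod_cast hb0
  have hK : 10 * L ≤ k / (3 * b) := by
    rw [le_div_iff₀ (by positivity)]
    have h1 : 10 * L * (3 * (b : ℝ)) ≤ 10 * L * (3 * (5 * s * L)) := by gcongr
    have h2 : s * L ^ 2 * 1 ≤ s * L ^ 2 * L ^ 2 :=
      mul_le_mul_of_nonneg_left (by nlinarith) (by positivity)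
    nlinarith
  set x : ℝ := n * Real.exp (-(k / (3 * b))) with hx
  have hx0 : 0 ≤ x := by positivity
  have hbn : (b : ℝ) ≤ n := by
    calc (b : ℝ) ≤ s * (5 * L) := by linarith
      _ ≤ s * s := by gcongr
      _ = n := hss
  have hbx : b * x ≤ Real.exp (-8 * L) := by
    calc b * x ≤ Real.exp L * (Real.exp L * Real.exp (-(10 * L))) := by
          rw [hx, hn]
          rw [hn] at hbn
          gcongr
      _ = _ := by
          rw [← Real.exp_add, ← Real.exp_add]
          congr 1
          ring
  have hterm2 : (n : ℝ) ^ 2 * ((n + 1) * ((1 + x) ^ b - 1)) ≤ 1 / 4 := by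
    have h1 := one_add_mul_exp_pow_sub_one_le hx0
      (hbx.trans (Real.exp_le_one_iff.mpr (by linarith)))
    calc _ ≤ (n : ℝ) ^ 2 * (Real.exp (2 * L) * (Real.exp L * Real.exp (-8 * L))) := by
          gcongr
          · rw [sub_nonneg]
            exact one_le_pow₀ (by linarith)
          · refine h1.trans ?_
            gcongr
      _ = Real.exp (-3 * L) := by
          rw [hnp, ← Real.exp_add, ← Real.exp_add, ← Real.exp_add]
          congr 1
          push_cast
          ring
      _ ≤ Real.exp (-L) := Real.exp_le_exp.mpr (by linarith)
      _ ≤ _ := hexp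
  linarith

theorem IsSetHomogeneous.choose_le_card {X : Type*} [Fintype X] [DecidableEq X]
    {G : Subgroup (Equiv.Perm X)} {m : ℕ} (hG : IsSetHomogeneous G m)
    (hm : m ≤ Fintype.card X) : (Fintype.card X).choose m ≤ Nat.card G := by
  classical
  obtain ⟨S, -, hS⟩ := Finset.exists_subset_card_eq (s := (Finset.univ : Finset X))
    (n := m) (by simpa using hm)
  choose! f hfG hf using fun T (hT : T.card = m) => hG S T hS hT
  have hmem : ∀ T ∈ (Finset.univ : Finset X).powersetCard m, T.card = m := fun T hT =>
    (Finset.mem_powersetCard.mp hT).2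
  rw [← Finset.card_univ, ← Finset.card_powersetCard, Nat.card_eq_fintype_card,
    Fintype.card_subtype]
  refine Finset.card_le_card_of_injOn f (fun T hT => ?_) fun T hT U hU h => ?_
  · simpa using hfG T (hmem T hT)
  · rw [← hf T (hmem T hT), ← hf U (hmem U hU), h]

/-- For large `k`, some `k`-set has an orbit whose automorphism group is exactly `G`. -/
theorem exists_orbitAut_eq : ∃ N : ℕ, ∀ (X : Type) [Fintype X] [DecidableEq X],
    N ≤ Fintype.card X → ∀ G : Subgroup (Equiv.Perm X), MulAction.IsPreprimitive G X →
    ¬ alternatingGroup X ≤ G → ∀ k : ℕ, 2 * k ≤ Fintype.card X →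
    10 ≤ Real.log (Fintype.card X) →
    5 * Real.log (Fintype.card X) ≤ √(Fintype.card X : ℝ) →
    3600 * √(Fintype.card X : ℝ) * Real.log (Fintype.card X) ^ 4 ≤ k →
    ∃ Y : Finset X, Y.card = k ∧ orbitAut G Y = G := by
  classical
  obtain ⟨N, hN⟩ := exists_small_pointBase
  refine ⟨max N 3, fun X _ _ hX G hG hAlt k hk hL hLs hkL => ?_⟩
  have hX3 : 3 ≤ Fintype.card X := le_trans (le_max_right _ _) hX
  have hXN : N ≤ Fintype.card X := le_trans (le_max_left _ _) hX
  have hnR : (0 : ℝ) < Fintype.card X := by exact_mod_cast (by omega : 0 < Fintype.card X)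
  have hss : √(Fintype.card X : ℝ) * √(Fintype.card X : ℝ) = Fintype.card X :=
    Real.mul_self_sqrt hnR.le
  set n := Fintype.card X with hn
  set L := Real.log n with hLdef
  set s := √(n : ℝ) with hs
  have hs50 : 50 ≤ s := by linarith
  set b := ⌊5 * s * L⌋₊ with hb
  have hbL : (b : ℝ) ≤ 5 * s * L := Nat.floor_le (by positivity)
  have hb0 : 0 < b := Nat.floor_pos.mpr (by nlinarith)
  have hbn : b ≤ n := by
    have : (b : ℝ) ≤ n := by nlinarith
    exact_mod_cast this
  have hbase : ∀ A : Subgroup (Equiv.Perm X), G ≤ A → ¬ alternatingGroup X ≤ A →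
      ∃ S, IsPointBase A S ∧ S.card = b := by
    intro A hGA hA
    obtain ⟨S, hS, hSb⟩ := hN X hXN A (isPreprimitive_of_le hG hGA) hA
    obtain ⟨T, hST, hT⟩ := Finset.exists_superset_card_eq (Nat.le_floor hSb) hbn
    exact ⟨T, fun σ hσ h => hS σ hσ fun x hx => h x (hST hx), hT⟩
  have hcard : Nat.card G ≤ n ^ b := by
    obtain ⟨S, hS, hSb⟩ := hbase G le_rfl hAlt
    exact hSb ▸ hS.card_le
  have hhomle : ∀ m, 2 * m ≤ n → IsSetHomogeneous G m → (m : ℝ) ≤ 8 * s * L ^ 2 := by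
    intro m hm hGm
    exact cast_le_of_two_pow_le (by omega) hbL
      ((two_pow_le_choose m n hm).trans ((hGm.choose_le_card (by omega)).trans hcard))
  have hsL : 0 ≤ s * L ^ 2 := by positivity
  have hnotk : ¬ IsSetHomogeneous G k := by
    intro h
    have h1 := hhomle k hk h
    have h2 : s * L ^ 2 * 1 ≤ s * L ^ 2 * L ^ 2 :=
      mul_le_mul_of_nonneg_left (by nlinarith) hsL
    have h3 : 0 < s * L ^ 2 := by positivity
    nlinarith
  have hex : ∃ m, ¬ IsSetHomogeneous G (m + 1) := by
    obtain _ | k := k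
    · exact absurd (fun S T hS hT => ⟨1, G.one_mem, by
        rw [Finset.card_eq_zero.mp hS, Finset.card_eq_zero.mp hT]; rfl⟩) hnotk
    · exact ⟨k, hnotk⟩
  have := hG.toIsPretransitive
  set d := Nat.find hex with hd
  have hd1 : 1 ≤ d := by
    by_contra! h
    have h0 : d = 0 := by omega
    have := Nat.find_spec hex
    rw [← hd, h0] at this
    exact this isSetHomogeneous_one
  have hhom : ∀ j, 1 ≤ j → j ≤ d → IsSetHomogeneous G j := by
    intro j hj hjd
    obtain ⟨i, rfl⟩ := Nat.exists_eq_add_of_le' hj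
    exact not_not.mp (Nat.find_min hex (m := i) (by omega))
  have hdk : d + 1 ≤ k := by
    by_contra! h
    obtain _ | k := k
    · exact hnotk fun S T hS hT => ⟨1, G.one_mem, by
        rw [Finset.card_eq_zero.mp hS, Finset.card_eq_zero.mp hT]; rfl⟩
    · exact hnotk (hhom _ (by omega) (by omega))
  have hdL := hhomle d (by omega) (hhom d hd1 le_rfl)
  obtain ⟨e, he⟩ := Nat.exists_eq_add_of_le' hd1
  have hu := Nat.ceil_lt_add_one (show (0 : ℝ) ≤ s by linarith)
  have hu0 : 0 < ⌈s⌉₊ := Nat.ceil_pos.mpr (by linarith)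
  have hun : 2 * ⌈s⌉₊ ≤ n := by
    have : (2 : ℝ) * ⌈s⌉₊ ≤ n := by nlinarith
    exact_mod_cast this
  obtain ⟨S, hS, hSc⟩ := exists_small_orbit_representatives (G := G) (d := e) (u := ⌈s⌉₊)
    (hhom _ (by omega) (by omega)) hu0 (by omega)
  rw [← hn, ← hLdef] at hSc
  have hSL : (S.card : ℝ) ≤ 12 * s * L ^ 2 := by
    have h1 : (n : ℝ) / ⌈s⌉₊ ≤ s := by
      rw [div_le_iff₀ (by exact_mod_cast hu0), ← hss]
      exact mul_le_mul_of_nonneg_left (Nat.le_ceil s) (by linarith)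
    have h2 : (n : ℝ) / ⌈s⌉₊ * L ≤ s * L := mul_le_mul_of_nonneg_right h1 (by linarith)
    have h3 : (e : ℝ) ≤ d := by exact_mod_cast (by omega : e ≤ d)
    have h4 : s * 10 ≤ s * L := mul_le_mul_of_nonneg_left hL (by linarith)
    have h5 : s * L * 10 ≤ s * L * L := mul_le_mul_of_nonneg_left hL (by positivity)
    nlinarith
  by_contra! hne
  have hq := (card_orbits_succ_le (hhom d hd1 le_rfl) (by omega)).trans_lt
    (Nat.lt_pow_succ_log_self (b := 2) (by norm_num) n)
  have h1 := one_le_of_forall_orbitAut_ne hG hX3 hd1 hhom (Nat.find_spec hex) hdk hk hb0 hbase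
    (S := S) (by rw [he]; exact hS) hq hne
  exact absurd h1 (not_le.mpr (exp_bound_lt_one hL hLs hkL hb0 hbL hdL
    (cast_log_add_one_le (by omega) (by linarith)) hSL))

theorem eq_top_of_alternatingGroup_lt {X : Type*} [Fintype X] [DecidableEq X]
    {G : Subgroup (Equiv.Perm X)} (h : alternatingGroup X ≤ G) (hne : G ≠ alternatingGroup X) :
    G = ⊤ := by
  obtain ⟨σ, hσ, hσA⟩ : ∃ σ ∈ G, σ ∉ alternatingGroup X := by
    by_contra! hh
    exact hne (le_antisymm hh h)
  refine eq_top_iff.mpr fun τ _ => ?_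
  by_cases hτ : τ ∈ alternatingGroup X
  · exact h hτ
  · rw [Equiv.Perm.mem_alternatingGroup] at hσA hτ
    have h1 := (Int.units_eq_one_or (Equiv.Perm.sign σ)).resolve_left hσA
    have h2 := (Int.units_eq_one_or (Equiv.Perm.sign τ)).resolve_left hτ
    have h3 : τ * σ⁻¹ ∈ alternatingGroup X := by
      rw [Equiv.Perm.mem_alternatingGroup, Equiv.Perm.sign_mul, Equiv.Perm.sign_inv, h1, h2]
      rfl
    simpa using G.mul_mem (h h3) hσ

open scoped Pointwise in
theorem coe_smul_finset_eq_image {X : Type*} [DecidableEq X] (σ : Equiv.Perm X) (Y : Finset X) :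
    ((σ • Y : Finset X) : Set X) = (σ : X → X) '' (Y : Set X) := by
  rw [Finset.coe_smul_finset]
  rfl

open scoped Pointwise in
/-- The orbit of `Y`, as a family of sets, has the required properties if `orbitAut G Y = G`. -/
theorem orbit_family_spec {X : Type*} [Finite X] [DecidableEq X] {G : Subgroup (Equiv.Perm X)}
    {Y : Finset X} (hY : orbitAut G Y = G) :
    ∃ ℬ : Set (Set X), ℬ.Nonempty ∧ (∀ B ∈ ℬ, B.ncard = Y.card) ∧
      (∀ σ : Equiv.Perm X, ((fun Y : Set X => (σ : X → X) '' Y) '' ℬ = ℬ) ↔ σ ∈ G) ∧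
      (∀ B₁ ∈ ℬ, ∀ B₂ ∈ ℬ, ∃ g ∈ G, (g : X → X) '' B₁ = B₂) := by
  refine ⟨(fun Z : Finset X => (Z : Set X)) '' orbitFamily G Y, ⟨Y, Y, ⟨1, G.one_mem,
    one_smul _ _⟩, rfl⟩, ?_, fun σ => ?_, ?_⟩
  · rintro - ⟨-, ⟨g, hg, rfl⟩, rfl⟩
    rw [Set.ncard_coe_finset, Finset.card_smul_finset]
  · have hinj : Function.Injective (fun Z : Finset X => (Z : Set X)) := Finset.coe_injective
    have h1 : (fun Y : Set X => (σ : X → X) '' Y) ''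
        ((fun Z : Finset X => (Z : Set X)) '' orbitFamily G Y) =
        (fun Z : Finset X => (Z : Set X)) '' (σ • orbitFamily G Y) := by
      rw [← Set.image_smul, Set.image_image, Set.image_image]
      simp only [coe_smul_finset_eq_image]
    rw [h1, hinj.image_injective.eq_iff, ← MulAction.mem_stabilizer_iff]
    change σ ∈ orbitAut G Y ↔ _
    rw [hY]
  · rintro - ⟨-, ⟨g, hg, rfl⟩, rfl⟩ - ⟨-, ⟨h, hh, rfl⟩, rfl⟩
    refine ⟨h * g⁻¹, G.mul_mem hh (G.inv_mem hg), ?_⟩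
    rw [← coe_smul_finset_eq_image, mul_smul, inv_smul_smul]

theorem most_primitive_groups_edge_transitive_hypergraphs
    (ε : ℝ) (hε : 0 < ε) :
    ∃ n₀ : ℕ, ∀ (X : Type) [Fintype X] [DecidableEq X],
      n₀ ≤ Fintype.card X →
      ∀ G : Subgroup (Equiv.Perm X), IsPrimitiveSubgroup G →
        G ≠ alternatingGroup X →
        ∀ k : ℕ, (Fintype.card X : ℝ) ^ ((1 : ℝ) / 2 + ε) ≤ (k : ℝ) →
          2 * k ≤ Fintype.card X →
          ∃ ℬ : Set (Set X), ℬ.Nonempty ∧ (∀ B ∈ ℬ, B.ncard = k) ∧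
            (∀ σ : Equiv.Perm X, ((fun Y : Set X => (σ : X → X) '' Y) '' ℬ = ℬ) ↔ σ ∈ G) ∧
            (∀ B₁ ∈ ℬ, ∀ B₂ ∈ ℬ, ∃ g ∈ G, (g : X → X) '' B₁ = B₂) := by
  obtain ⟨N₁, hN₁⟩ := exists_orbitAut_eq
  obtain ⟨N₂, hN₂⟩ := eventually_log_bounds hε
  refine ⟨max N₁ N₂, fun X _ _ hX G hG hGA k hk hkn => ?_⟩
  have hGp : MulAction.IsPreprimitive G X :=
    { toIsPretransitive := hG.1, isTrivialBlock_of_isBlock := fun {B} hB => hG.2 B hB }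
  by_cases hAlt : alternatingGroup X ≤ G
  · obtain ⟨Y, -, rfl⟩ := Finset.exists_subset_card_eq (s := (Finset.univ : Finset X))
      (n := k) (by rw [Finset.card_univ]; omega)
    have htop := eq_top_of_alternatingGroup_lt hAlt hGA
    exact orbit_family_spec (by rw [htop]; exact top_le_iff.mp (le_orbitAut ⊤ Y))
  · obtain ⟨h1, h2, h3⟩ := hN₂ _ (le_trans (le_max_right _ _) hX)
    obtain ⟨Y, rfl, hY⟩ := hN₁ X (le_trans (le_max_left _ _) hX) G hGp hAlt k hkn h1 h2
      (h3.trans hk)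
    exact orbit_family_spec hY
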